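/- Let ω ⊂ ℝ^d be an open, bounded domain and k ≥ 1. Let v ∈ C¹(ω̄, ℝ^k), w ∈ C¹(ω̄, ℝ^d) and A ∈ C^{0,β}(ω̄, ℝ^{d×d}_sym) with 0 < β ≤ 1, and assume that the deficit D = A − (½(∇v)ᵀ∇v + sym∇w) satisfies D > c·Id_d on ω̄ for some c > 0 (in the sense of symmetric matrix inequalities). Fix ε > 0 and an exponent α with 0 < α < min{β/2, 1/(1 + d(d+1)/k)}. Then there exist ṽ ∈ C^{1,α}(ω̄, ℝ^k) and w̃ ∈ C^{1,α}(ω̄, ℝ^d) such that ‖ṽ − v‖₀ ≤ ε, ‖w̃ − w‖₀ ≤ ε, and A − (½(∇ṽ)ᵀ∇ṽ + sym∇w̃) = 0 on ω̄. -/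

import Mathlib

noncomputable section
open MeasureTheory Real
open scoped BigOperators ENNReal NNReal

/-- Partial derivative of `f` in the `i`-th coordinate direction. -/
def pd {d : ℕ} {E : Type*} [NormedAddCommGroup E] [NormedSpace ℝ E]
    (i : Fin d) (f : (Fin d → ℝ) → E) (x : Fin d → ℝ) : E :=
  fderiv ℝ f x (Pi.single i 1)

/-- The matrix `(∇v)ᵀ∇v`, with entries `⟨∂ᵢv, ∂ⱼv⟩`. -/
def gradTgrad {d k : ℕ} (v : (Fin d → ℝ) → Fin k → ℝ) (x : Fin d → ℝ) :
    Fin d → Fin d → ℝ :=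
  fun i j => ∑ l, pd i (fun y => v y l) x * pd j (fun y => v y l) x

/-- The symmetrized gradient `sym∇w = ½(∇w + (∇w)ᵀ)`. -/
def symGrad {d : ℕ} (w : (Fin d → ℝ) → Fin d → ℝ) (x : Fin d → ℝ) :
    Fin d → Fin d → ℝ :=
  fun i j => (pd i (fun y => w y j) x + pd j (fun y => w y i) x) / 2

/-- The deficit `D = A − (½(∇v)ᵀ∇v + sym∇w)`. -/
def deficit {d k : ℕ} (A : (Fin d → ℝ) → Fin d → Fin d → ℝ)
    (v : (Fin d → ℝ) → Fin k → ℝ) (w : (Fin d → ℝ) → Fin d → ℝ)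
    (x : Fin d → ℝ) : Fin d → Fin d → ℝ :=
  fun i j => A x i j - ((1/2) * gradTgrad v x i j + symGrad w x i j)

/-- `C⁰` norm of `f` on the closure of `ω`. -/
def supNorm {d : ℕ} {E : Type*} [NormedAddCommGroup E]
    (ω : Set (Fin d → ℝ)) (f : (Fin d → ℝ) → E) : ℝ :=
  ⨆ x : closure ω, ‖f x.1‖

/-- `f` is (globally) `β`-Hölder, i.e. the restriction of a `C^{0,β}` map of `ℝ^d`. -/
def IsHolder {d : ℕ} {E : Type*} [NormedAddCommGroup E] (β : ℝ)
    (f : (Fin d → ℝ) → E) : Prop :=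
  ∃ C : ℝ≥0, HolderWith C β.toNNReal f

/-- `f` is of class `C^{1,α}`: it is `C¹` and its gradient is `α`-Hölder. -/
def IsC1Holder {d : ℕ} {E : Type*} [NormedAddCommGroup E] [NormedSpace ℝ E] (α : ℝ)
    (f : (Fin d → ℝ) → E) : Prop :=
  ContDiff ℝ 1 f ∧ IsHolder α (fderiv ℝ f)

/-- `M > c·Id` in the sense of quadratic forms. -/
def MatGt {d : ℕ} (M : Fin d → Fin d → ℝ) (c : ℝ) : Prop :=
  ∀ ξ : Fin d → ℝ, ξ ≠ 0 → c * ∑ i, ξ i ^ 2 < ∑ i, ∑ j, M i j * ξ i * ξ j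

namespace VonKarman

open scoped ContDiff

/-- `f` is smooth and, up to order `m`, its `j`-th derivatives are bounded by `K μ ^ j`. -/
def FreqBd {d : ℕ} (m : ℕ) (K μ : ℝ) (f : (Fin d → ℝ) → ℝ) : Prop :=
  ContDiff ℝ ∞ f ∧ ∀ j ≤ m, ∀ x, ‖iteratedFDeriv ℝ j f x‖ ≤ K * μ ^ j

namespace FreqBd

variable {d m : ℕ} {K K' μ μ' : ℝ} {f g : (Fin d → ℝ) → ℝ}

theorem contDiff (h : FreqBd m K μ f) : ContDiff ℝ ∞ f := h.1

theorem differentiable (h : FreqBd m K μ f) : Differentiable ℝ f :=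
  h.1.differentiable (by simp)

theorem contDiffAt_nat (h : FreqBd m K μ f) (j : ℕ) (x : Fin d → ℝ) : ContDiffAt ℝ j f x :=
  (h.1.of_le (by exact_mod_cast le_top)).contDiffAt

theorem abs_le (h : FreqBd m K μ f) (x : Fin d → ℝ) : |f x| ≤ K := by
  have := h.2 0 (Nat.zero_le _) x
  simpa using this

theorem nonneg (h : FreqBd m K μ f) : 0 ≤ K := (abs_nonneg _).trans (h.abs_le 0)

theorem mono (h : FreqBd m K μ f) (hμ : 0 ≤ μ) (hK : K ≤ K') (hμ' : μ ≤ μ') :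
    FreqBd m K' μ' f := by
  refine ⟨h.1, fun j hj x => (h.2 j hj x).trans ?_⟩
  have := h.nonneg
  have := this.trans hK
  gcongr

theorem mono_const (h : FreqBd m K μ f) (hμ : 0 ≤ μ) (hK : K ≤ K') : FreqBd m K' μ f :=
  h.mono hμ hK le_rfl

theorem of_le {n : ℕ} (h : FreqBd m K μ f) (hn : n ≤ m) : FreqBd n K μ f :=
  ⟨h.1, fun j hj x => h.2 j (hj.trans hn) x⟩

theorem add (hf : FreqBd m K μ f) (hg : FreqBd m K' μ g) :
    FreqBd m (K + K') μ (fun x => f x + g x) := by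
  refine ⟨hf.1.add hg.1, fun j hj x => ?_⟩
  have : iteratedFDeriv ℝ j (fun x => f x + g x) x
      = iteratedFDeriv ℝ j f x + iteratedFDeriv ℝ j g x :=
    iteratedFDeriv_add_apply (hf.contDiffAt_nat j x) (hg.contDiffAt_nat j x)
  rw [this, add_mul]
  exact (norm_add_le _ _).trans (add_le_add (hf.2 j hj x) (hg.2 j hj x))

theorem const_mul (c : ℝ) (hf : FreqBd m K μ f) : FreqBd m (|c| * K) μ (fun x => c * f x) := by
  refine ⟨contDiff_const.mul hf.1, fun j hj x => ?_⟩
  have : iteratedFDeriv ℝ j (fun x => c • f x) x = c • iteratedFDeriv ℝ j f x :=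
    iteratedFDeriv_const_smul_apply' (hf.contDiffAt_nat j x)
  simp only [smul_eq_mul] at this
  rw [this, norm_smul, mul_assoc, Real.norm_eq_abs]
  exact mul_le_mul_of_nonneg_left (hf.2 j hj x) (abs_nonneg _)

theorem neg (hf : FreqBd m K μ f) : FreqBd m K μ (fun x => - f x) := by
  simpa using hf.const_mul (-1)

theorem sub (hf : FreqBd m K μ f) (hg : FreqBd m K' μ g) :
    FreqBd m (K + K') μ (fun x => f x - g x) := by
  simpa [sub_eq_add_neg] using hf.add hg.neg

theorem zero (hK : 0 ≤ K) (hμ : 0 ≤ μ) : FreqBd m K μ (fun _ : Fin d → ℝ => (0 : ℝ)) := by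
  refine ⟨contDiff_const, fun j _ x => ?_⟩
  have : iteratedFDeriv ℝ j (fun _ : Fin d → ℝ => (0 : ℝ)) x = 0 := by
    simp
  rw [this, norm_zero]; positivity

theorem const {c : ℝ} (hc : |c| ≤ K) (hμ : 0 ≤ μ) : FreqBd m K μ (fun _ : Fin d → ℝ => c) := by
  have hK : 0 ≤ K := (abs_nonneg _).trans hc
  refine ⟨contDiff_const, fun j _ x => ?_⟩
  rcases Nat.eq_zero_or_pos j with rfl | hj
  · simpa using hc
  · rw [iteratedFDeriv_const_of_ne hj.ne']
    rw [Pi.zero_apply, norm_zero]; positivity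

theorem sum {ι : Type*} (s : Finset ι) {F : ι → (Fin d → ℝ) → ℝ} {K : ι → ℝ} (hμ : 0 ≤ μ)
    (h : ∀ i ∈ s, FreqBd m (K i) μ (F i)) : FreqBd m (∑ i ∈ s, K i) μ (fun x => ∑ i ∈ s, F i x) := by
  classical
  induction s using Finset.induction_on with
  | empty => simpa using zero le_rfl hμ
  | insert a s ha ih =>
    simp only [Finset.sum_insert ha]
    exact (h a (by simp)).add (ih fun i hi => h i (by simp [hi]))

theorem mul (hf : FreqBd m K μ f) (hg : FreqBd m K' μ g) (hμ : 0 ≤ μ) :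
    FreqBd m (2 ^ m * (K * K')) μ (fun x => f x * g x) := by
  have hK := hf.nonneg
  have hK' := hg.nonneg
  refine ⟨hf.1.mul hg.1, fun j hj x => ?_⟩
  refine (norm_iteratedFDeriv_mul_le hf.1 hg.1 x (n := j) (by exact_mod_cast le_top)).trans ?_
  have h1 : ∀ i ∈ Finset.range (j + 1),
      (j.choose i : ℝ) * ‖iteratedFDeriv ℝ i f x‖ * ‖iteratedFDeriv ℝ (j - i) g x‖
        ≤ (j.choose i : ℝ) * (K * K' * μ ^ j) := by
    intro i hi
    have hij : i ≤ j := Nat.lt_succ_iff.mp (Finset.mem_range.mp hi)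
    have a1 := hf.2 i (hij.trans hj) x
    have a2 := hg.2 (j - i) ((Nat.sub_le _ _).trans hj) x
    have : μ ^ j = μ ^ i * μ ^ (j - i) := by rw [← pow_add, Nat.add_sub_cancel' hij]
    rw [this, mul_assoc]
    refine mul_le_mul_of_nonneg_left ?_ (by positivity)
    calc _ ≤ (K * μ ^ i) * (K' * μ ^ (j - i)) := by gcongr
      _ = _ := by ring
  refine (Finset.sum_le_sum h1).trans ?_
  rw [← Finset.sum_mul]
  have : (∑ i ∈ Finset.range (j + 1), (j.choose i : ℝ)) = 2 ^ j := by
    exact_mod_cast Nat.sum_range_choose j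
  rw [this]
  have h2 : (2 : ℝ) ^ j ≤ 2 ^ m := pow_le_pow_right₀ (by norm_num) hj
  calc (2 : ℝ) ^ j * (K * K' * μ ^ j) ≤ 2 ^ m * (K * K' * μ ^ j) := by gcongr
    _ = _ := by ring

theorem pd (hf : FreqBd (m + 1) K μ f) (i : Fin d) : FreqBd m (K * μ) μ (pd i f) := by
  have hs : ContDiff ℝ ∞ (fderiv ℝ f) := hf.1.fderiv_right (m := ∞) le_rfl
  refine ⟨hs.clm_apply contDiff_const, fun j hj x => ?_⟩
  have h1 := norm_iteratedFDeriv_clm_apply_const (𝕜 := ℝ) (f := fderiv ℝ f)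
    (c := (Pi.single i (1 : ℝ) : Fin d → ℝ)) (x := x) (N := j) (n := j)
    (hs.of_le (by exact_mod_cast le_top)).contDiffAt le_rfl
  rw [norm_iteratedFDeriv_fderiv] at h1
  have h2 : ‖(Pi.single i (1 : ℝ) : Fin d → ℝ)‖ = 1 := by
    rw [Pi.norm_single, norm_one]
  rw [h2, one_mul] at h1
  refine (h1.trans (hf.2 (j + 1) (Nat.succ_le_succ hj) x)).trans (le_of_eq ?_)
  ring

/-- Derivative bounds are covariant under dilations of the variable. -/
theorem comp_smul (hf : FreqBd m K μ f) (l : ℝ) :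
    FreqBd m K (|l| * μ) (fun x => f (l • x)) := by
  refine ⟨hf.1.comp (contDiff_const_smul l), fun j hj x => ?_⟩
  have := congrFun (iteratedFDeriv_comp_const_smul (𝕜 := ℝ) (f := f) (i := j) l
    (hf.1.of_le (by exact_mod_cast le_top))) x
  rw [this]
  simp only [norm_smul, norm_pow, Real.norm_eq_abs]
  rw [mul_pow, mul_left_comm]
  exact mul_le_mul_of_nonneg_left (hf.2 j hj _) (by positivity)

theorem comp_clm {h : ℝ → ℝ} (hh : ContDiff ℝ ∞ h) (ℓ : (Fin d → ℝ) →L[ℝ] ℝ)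
    (hK : ∀ j ≤ m, ∀ t, ‖iteratedDeriv j h t‖ ≤ K) (hℓ : ‖ℓ‖ ≤ μ) :
    FreqBd m K μ (fun x => h (ℓ x)) := by
  refine ⟨hh.comp ℓ.contDiff, fun j hj x => ?_⟩
  have h0 := ℓ.iteratedFDeriv_comp_right (f := h) (n := ∞) hh x (i := j) (by exact_mod_cast le_top)
  have h1 : iteratedFDeriv ℝ j (fun x => h (ℓ x)) x
      = (iteratedFDeriv ℝ j h (ℓ x)).compContinuousLinearMap fun _ => ℓ := h0
  rw [h1]
  refine (ContinuousMultilinearMap.norm_compContinuousLinearMap_le _ _).trans ?_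
  rw [norm_iteratedFDeriv_eq_norm_iteratedDeriv]
  have hK0 : 0 ≤ K := (norm_nonneg _).trans (hK j hj 0)
  simp only [Finset.prod_const, Finset.card_univ, Fintype.card_fin]
  have := hK j hj (ℓ x)
  gcongr

theorem sin_clm (ℓ : (Fin d → ℝ) →L[ℝ] ℝ) (hℓ : ‖ℓ‖ ≤ μ) :
    FreqBd m 1 μ (fun x => Real.sin (ℓ x)) :=
  comp_clm Real.contDiff_sin ℓ (fun j _ t => Real.abs_iteratedDeriv_sin_le_one j t) hℓ

theorem cos_clm (ℓ : (Fin d → ℝ) →L[ℝ] ℝ) (hℓ : ‖ℓ‖ ≤ μ) :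
    FreqBd m 1 μ (fun x => Real.cos (ℓ x)) :=
  comp_clm Real.contDiff_cos ℓ (fun j _ t => Real.abs_iteratedDeriv_cos_le_one j t) hℓ

/-- Rescaling the frequency by a factor `L ≥ 1` costs a factor `L ^ m`. -/
theorem rescale {L : ℝ} (hL : 1 ≤ L) (hμ : 0 ≤ μ) (hf : FreqBd m K (L * μ) f) :
    FreqBd m (L ^ m * K) μ f := by
  refine ⟨hf.1, fun j hj x => (hf.2 j hj x).trans ?_⟩
  have hK := hf.nonneg
  have : L ^ j ≤ L ^ m := pow_le_pow_right₀ hL hj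
  calc K * (L * μ) ^ j = L ^ j * K * μ ^ j := by ring
    _ ≤ _ := by gcongr

/-- The square root of a function which is close to a constant `b ^ 2`. -/
theorem sqrt_comp (m : ℕ) : ∃ C : ℝ, 1 ≤ C ∧ ∀ {d : ℕ} {μ b : ℝ} {f : (Fin d → ℝ) → ℝ},
    0 ≤ μ → 0 ≤ b → FreqBd m 2 μ f → (∀ x, 1 / 4 ≤ f x) →
      FreqBd m (C * b) μ (fun x => b * √(f x)) := by
  have hs : ContDiffOn ℝ ∞ Real.sqrt (Set.Ioi (1 / 8)) := fun t ht =>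
    (Real.contDiffAt_sqrt (by have : (1 / 8 : ℝ) < t := ht; linarith)).contDiffWithinAt
  have hu : UniqueDiffOn ℝ (Set.Ioi (1 / 8 : ℝ)) := isOpen_Ioi.uniqueDiffOn
  have hb : ∀ i : ℕ, ∃ C : ℝ, ∀ t ∈ Set.Icc (1 / 4 : ℝ) 2,
      ‖iteratedFDerivWithin ℝ i Real.sqrt (Set.Ioi (1 / 8)) t‖ ≤ C := fun i =>
    isCompact_Icc.exists_bound_of_continuousOn
      ((hs.continuousOn_iteratedFDerivWithin (by exact_mod_cast le_top) hu).mono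
        fun t ht => lt_of_lt_of_le (by norm_num) ht.1)
  choose B hB using hb
  obtain ⟨B', hB'⟩ : ∃ B' : ℝ, ∀ i ≤ m, B i ≤ B' := by
    refine ⟨∑ i ∈ Finset.range (m + 1), |B i|, fun i hi => (le_abs_self _).trans ?_⟩
    exact Finset.single_le_sum (f := fun i => |B i|) (fun _ _ => abs_nonneg _)
      (Finset.mem_range.mpr (by omega))
  have hB0 : 0 ≤ B' := (norm_nonneg _).trans ((hB 0 1 (by norm_num)).trans (hB' 0 (by omega)))
  refine ⟨m.factorial * B' * 2 ^ m + 1, by have : (0:ℝ) ≤ m.factorial * B' * 2 ^ m := by positivity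
                                           linarith, ?_⟩
  intro d μ b f hμ hb0 hf hf1
  have hfIcc : ∀ x, f x ∈ Set.Icc (1 / 4 : ℝ) 2 := fun x =>
    ⟨hf1 x, (le_abs_self _).trans (hf.abs_le x)⟩
  have hcd : ContDiff ℝ ∞ (fun x => √(f x)) :=
    contDiff_iff_contDiffAt.2 fun x =>
      (hf.1.contDiffAt).sqrt (by have := hf1 x; intro h; linarith)
  have key : FreqBd m (m.factorial * B' * 2 ^ m + 1) μ (fun x => √(f x)) := by
    refine ⟨hcd, fun j hj x => ?_⟩
    have := norm_iteratedFDerivWithin_comp_le (𝕜 := ℝ) (g := Real.sqrt) (f := f) (n := j)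
      (s := Set.univ) (t := Set.Ioi (1 / 8)) (x := x) (N := ∞) (C := B') (D := 2 * μ)
      hs hf.1.contDiffOn (by exact_mod_cast le_top) hu uniqueDiffOn_univ
      (fun y _ => lt_of_lt_of_le (by norm_num) (hf1 y)) (Set.mem_univ x)
      (fun i hi => (hB i _ (hfIcc x)).trans (hB' i (hi.trans hj)))
      (fun i hi hij => by
        rw [iteratedFDerivWithin_univ]
        refine (hf.2 i (hij.trans hj) x).trans ?_
        rw [mul_pow]
        gcongr
        exact le_self_pow₀ (by norm_num) (by omega))
    rw [iteratedFDerivWithin_univ] at this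
    refine this.trans ?_
    have h1 : ((j.factorial : ℕ) : ℝ) ≤ m.factorial := by exact_mod_cast Nat.factorial_le hj
    have h2 : (2 : ℝ) ^ j ≤ 2 ^ m := pow_le_pow_right₀ (by norm_num) hj
    calc (j.factorial : ℝ) * B' * (2 * μ) ^ j = (j.factorial : ℝ) * B' * 2 ^ j * μ ^ j := by ring
      _ ≤ (m.factorial : ℝ) * B' * 2 ^ m * μ ^ j := by gcongr
      _ ≤ _ := by
        have : 0 ≤ μ ^ j := by positivity
        nlinarith
  have := key.const_mul b
  rw [abs_of_nonneg hb0, mul_comm] at this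
  exact this

end FreqBd

section Mollification

open ContinuousLinearMap
open scoped Convolution

variable {d : ℕ}

/-- A smooth bump function supported in the unit ball. -/
def unitBump (d : ℕ) : ContDiffBump (0 : Fin d → ℝ) where
  rIn := 1 / 2
  rOut := 1
  rIn_pos := by norm_num
  rIn_lt_rOut := by norm_num

/-- The smooth mollifying kernel of integral one supported in the unit ball. -/
def kernel (d : ℕ) : (Fin d → ℝ) → ℝ := (unitBump d).normed volume

theorem kernel_contDiff (d : ℕ) : ContDiff ℝ ∞ (kernel d) := (unitBump d).contDiff_normed

theorem kernel_hasCompactSupport (d : ℕ) : HasCompactSupport (kernel d) :=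
  (unitBump d).hasCompactSupport_normed

theorem tsupport_kernel (d : ℕ) : tsupport (kernel d) = Metric.closedBall 0 1 :=
  (unitBump d).tsupport_normed_eq

theorem support_kernel (d : ℕ) : Function.support (kernel d) = Metric.ball 0 1 :=
  (unitBump d).support_normed_eq

/-- Mollification at unit scale. -/
def mollUnit {F : Type*} [NormedAddCommGroup F] [NormedSpace ℝ F] (f : (Fin d → ℝ) → F) :
    (Fin d → ℝ) → F :=
  kernel d ⋆[lsmul ℝ ℝ, volume] f

theorem mollUnit_apply {F : Type*} [NormedAddCommGroup F] [NormedSpace ℝ F]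
    (f : (Fin d → ℝ) → F) (x : Fin d → ℝ) :
    mollUnit f x = ∫ y, kernel d y • f (x - y) := rfl

theorem contDiff_mollUnit {F : Type*} [NormedAddCommGroup F] [NormedSpace ℝ F] [CompleteSpace F]
    {f : (Fin d → ℝ) → F} (hf : Continuous f) : ContDiff ℝ ∞ (mollUnit f) :=
  (kernel_hasCompactSupport d).contDiff_convolution_left _ (kernel_contDiff d) hf.locallyIntegrable

theorem norm_mollUnit_sub_le {F : Type*} [NormedAddCommGroup F] [NormedSpace ℝ F] [CompleteSpace F]
    {f : (Fin d → ℝ) → F} (hf : Continuous f) {K : ℝ} {x : Fin d → ℝ} {z : F}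
    (h : ∀ y ∈ Metric.closedBall x 1, ‖f y - z‖ ≤ K) : ‖mollUnit f x - z‖ ≤ K := by
  have hK : 0 ≤ K := (norm_nonneg _).trans (h x (by simp))
  rw [← dist_eq_norm]
  refine dist_convolution_le hK (R := 1) (support_kernel d).le
    (fun y => (unitBump d).nonneg_normed y) ((unitBump d).integral_normed)
    hf.aestronglyMeasurable fun y hy => ?_
  rw [dist_eq_norm]
  exact h y (Metric.ball_subset_closedBall hy)

theorem norm_mollUnit_le {F : Type*} [NormedAddCommGroup F] [NormedSpace ℝ F] [CompleteSpace F]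
    {f : (Fin d → ℝ) → F} (hf : Continuous f) {K : ℝ} {x : Fin d → ℝ}
    (h : ∀ y ∈ Metric.closedBall x 1, ‖f y‖ ≤ K) : ‖mollUnit f x‖ ≤ K := by
  simpa using norm_mollUnit_sub_le hf (z := 0) (by simpa using h)

theorem hasFDerivAt_mollUnit {F : Type*} [NormedAddCommGroup F] [NormedSpace ℝ F] [CompleteSpace F]
    {f : (Fin d → ℝ) → F} (hf : ContDiff ℝ 1 f) (x : Fin d → ℝ) :
    HasFDerivAt (mollUnit f) (mollUnit (fderiv ℝ f) x) x := by
  have hf' : Continuous (fderiv ℝ f) := hf.continuous_fderiv one_ne_zero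
  have hk : Continuous (kernel d) := (kernel_contDiff d).continuous
  obtain ⟨C, hC⟩ := (isCompact_closedBall x (2 : ℝ)).exists_bound_of_continuousOn
    hf'.continuousOn
  refine hasFDerivAt_integral_of_dominated_of_fderiv_le (𝕜 := ℝ) (μ := volume)
    (F := fun x y => kernel d y • f (x - y)) (F' := fun x y => kernel d y • fderiv ℝ f (x - y))
    (bound := fun y => ‖kernel d y‖ * C) (s := Metric.ball x 1) (Metric.ball_mem_nhds x one_pos)
    ?_ ?_ ?_ ?_ ?_ ?_
  · refine Filter.Eventually.of_forall fun z => Continuous.aestronglyMeasurable ?_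
    exact hk.smul (hf.continuous.comp (by fun_prop))
  · refine Continuous.integrable_of_hasCompactSupport
      (hk.smul (hf.continuous.comp (by fun_prop))) ?_
    exact (kernel_hasCompactSupport d).smul_right
  · exact (hk.smul (hf'.comp (by fun_prop))).aestronglyMeasurable
  · refine Filter.Eventually.of_forall fun y z hz => ?_
    rw [norm_smul]
    by_cases hy : y ∈ Metric.ball (0 : Fin d → ℝ) 1
    · refine mul_le_mul_of_nonneg_left (hC _ ?_) (norm_nonneg _)
      rw [Metric.mem_ball, dist_eq_norm] at hz hy
      rw [Metric.mem_closedBall, dist_eq_norm]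
      calc ‖z - y - x‖ = ‖(z - x) - (y - 0)‖ := by congr 1; abel
        _ ≤ ‖z - x‖ + ‖y - 0‖ := norm_sub_le _ _
        _ ≤ 2 := by linarith
    · rw [← support_kernel, Function.notMem_support] at hy
      simp [hy]
  · exact (((unitBump d).integrable_normed (μ := volume)).norm).mul_const C
  · refine Filter.Eventually.of_forall fun y z _ => ?_
    have h1 : HasFDerivAt f (fderiv ℝ f (z - y)) (z - y) :=
      (hf.differentiable one_ne_zero _).hasFDerivAt
    have h2 : HasFDerivAt (fun z : Fin d → ℝ => z - y) (ContinuousLinearMap.id ℝ _) z :=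
      (hasFDerivAt_id z).sub_const y
    have := (h1.comp z h2).const_smul (kernel d y)
    rw [ContinuousLinearMap.comp_id] at this
    exact this

theorem fderiv_mollUnit {F : Type*} [NormedAddCommGroup F] [NormedSpace ℝ F] [CompleteSpace F]
    {f : (Fin d → ℝ) → F} (hf : ContDiff ℝ 1 f) :
    fderiv ℝ (mollUnit f) = mollUnit (fderiv ℝ f) :=
  funext fun x => (hasFDerivAt_mollUnit hf x).fderiv

theorem fderiv_sub_mollUnit {F : Type*} [NormedAddCommGroup F] [NormedSpace ℝ F] [CompleteSpace F]
    {f : (Fin d → ℝ) → F} (hf : ContDiff ℝ 1 f) :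
    fderiv ℝ (fun x => f x - mollUnit f x) = fun x => fderiv ℝ f x - mollUnit (fderiv ℝ f) x :=
  funext fun x =>
    ((hf.differentiable one_ne_zero x).hasFDerivAt.sub (hasFDerivAt_mollUnit hf x)).fderiv

/-- Smoothing gains one derivative. -/
theorem norm_iteratedFDeriv_sub_mollUnit_le (j : ℕ) : ∀ {F : Type} [NormedAddCommGroup F]
    [NormedSpace ℝ F] [CompleteSpace F] {f : (Fin d → ℝ) → F} {K : ℝ}, ContDiff ℝ ∞ f →
    (∀ x, ‖iteratedFDeriv ℝ (j + 1) f x‖ ≤ K) →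
    ∀ x, ‖iteratedFDeriv ℝ j (fun x => f x - mollUnit f x) x‖ ≤ K := by
  induction j with
  | zero =>
    intro F _ _ _ f K hf h x
    rw [norm_iteratedFDeriv_zero, norm_sub_rev]
    refine norm_mollUnit_sub_le hf.continuous fun y hy => ?_
    have h' : ∀ x, ‖fderiv ℝ f x‖ ≤ K := fun x => by
      have := h x
      rwa [← norm_iteratedFDeriv_fderiv, norm_iteratedFDeriv_zero] at this
    have := (convex_univ (𝕜 := ℝ) (E := Fin d → ℝ)).norm_image_sub_le_of_norm_fderiv_le
      (fun x _ => hf.differentiable (by simp) x) (fun x _ => h' x) (Set.mem_univ x) (Set.mem_univ y)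
    rw [Metric.mem_closedBall, dist_eq_norm] at hy
    have hK : 0 ≤ K := (norm_nonneg _).trans (h' x)
    nlinarith
  | succ j ih =>
    intro F _ _ _ f K hf h x
    rw [← norm_iteratedFDeriv_fderiv, fderiv_sub_mollUnit (hf.of_le (by simp))]
    refine ih (hf.fderiv_right (m := ∞) le_rfl) (fun y => ?_) x
    rw [norm_iteratedFDeriv_fderiv]
    exact h y

theorem norm_iteratedFDeriv_sub_mollUnit_le_two_mul (j : ℕ) : ∀ {F : Type} [NormedAddCommGroup F]
    [NormedSpace ℝ F] [CompleteSpace F] {f : (Fin d → ℝ) → F} {K : ℝ}, ContDiff ℝ ∞ f →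
    (∀ x, ‖iteratedFDeriv ℝ j f x‖ ≤ K) →
    ∀ x, ‖iteratedFDeriv ℝ j (fun x => f x - mollUnit f x) x‖ ≤ 2 * K := by
  induction j with
  | zero =>
    intro F _ _ _ f K hf h x
    simp only [norm_iteratedFDeriv_zero] at h ⊢
    have := norm_mollUnit_le hf.continuous (x := x) fun y _ => h y
    have := norm_sub_le (f x) (mollUnit f x)
    linarith [h x]
  | succ j ih =>
    intro F _ _ _ f K hf h x
    rw [← norm_iteratedFDeriv_fderiv, fderiv_sub_mollUnit (hf.of_le (by simp))]
    refine ih (hf.fderiv_right (m := ∞) le_rfl) (fun y => ?_) x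
    rw [norm_iteratedFDeriv_fderiv]
    exact h y

/-- All derivatives of a convolution with a fixed smooth compactly supported kernel are controlled
by the local size of the convolved function. -/
theorem exists_norm_iteratedFDeriv_convolution_le (j : ℕ) : ∀ {F : Type} [NormedAddCommGroup F]
    [NormedSpace ℝ F] [CompleteSpace F] {g : (Fin d → ℝ) → F}, ContDiff ℝ ∞ g →
    tsupport g ⊆ Metric.closedBall 0 1 →
    ∃ C : ℝ, 0 ≤ C ∧ ∀ {f : (Fin d → ℝ) → ℝ} {K : ℝ} {x : Fin d → ℝ}, Continuous f →
      (∀ y ∈ Metric.closedBall x 1, |f y| ≤ K) →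
      ‖iteratedFDeriv ℝ j (g ⋆[(lsmul ℝ ℝ : ℝ →L[ℝ] F →L[ℝ] F).flip, volume] f) x‖ ≤ C * K := by
  induction j with
  | zero =>
    intro F _ _ _ g hg hs
    have hcs : HasCompactSupport g :=
      (isCompact_closedBall _ _).of_isClosed_subset (isClosed_tsupport g) hs
    refine ⟨∫ y, ‖g y‖, by positivity, fun {f K x} hf h => ?_⟩
    rw [norm_iteratedFDeriv_zero, convolution_def]
    rw [← integral_mul_const]
    refine norm_integral_le_of_norm_le
      ((hg.continuous.integrable_of_hasCompactSupport hcs).norm.mul_const K)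
      (Filter.Eventually.of_forall fun y => ?_)
    simp only [flip_apply, lsmul_apply, norm_smul]
    rw [mul_comm]
    by_cases hy : y ∈ Metric.closedBall (0 : Fin d → ℝ) 1
    · refine mul_le_mul_of_nonneg_left (h _ ?_) (norm_nonneg _)
      simpa [dist_eq_norm] using hy
    · have : g y = 0 := image_eq_zero_of_notMem_tsupport fun h' => hy (hs h')
      simp [this]
  | succ j ih =>
    intro F _ _ _ g hg hs
    have hcs : HasCompactSupport g :=
      (isCompact_closedBall _ _).of_isClosed_subset (isClosed_tsupport g) hs
    obtain ⟨C, hC0, hC⟩ := ih (hg.fderiv_right (m := ∞) le_rfl)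
      ((tsupport_fderiv_subset ℝ).trans hs)
    refine ⟨C, hC0, fun {f K x} hf h => ?_⟩
    rw [← norm_iteratedFDeriv_fderiv]
    have : fderiv ℝ (g ⋆[(lsmul ℝ ℝ : ℝ →L[ℝ] F →L[ℝ] F).flip, volume] f)
        = (fderiv ℝ g ⋆[(lsmul ℝ ℝ : ℝ →L[ℝ] ((Fin d → ℝ) →L[ℝ] F) →L[ℝ] _).flip, volume] f) := by
      funext y
      rw [(hcs.hasFDerivAt_convolution_left _ (hg.of_le (by simp)) hf.locallyIntegrable y).fderiv]
      congr 1
    rw [this]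
    exact hC hf h

theorem mollUnit_eq_flip (f : (Fin d → ℝ) → ℝ) :
    mollUnit f = (kernel d ⋆[(lsmul ℝ ℝ : ℝ →L[ℝ] ℝ →L[ℝ] ℝ).flip, volume] f) := by
  unfold mollUnit
  congr 1
  ext
  simp

theorem exists_norm_iteratedFDeriv_mollUnit_le (d m : ℕ) : ∃ C : ℝ, 1 ≤ C ∧
    ∀ {f : (Fin d → ℝ) → ℝ} {K : ℝ} {x : Fin d → ℝ}, Continuous f →
      (∀ y ∈ Metric.closedBall x 1, |f y| ≤ K) →
      ∀ j ≤ m, ‖iteratedFDeriv ℝ j (mollUnit f) x‖ ≤ C * K := by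
  have := fun j => exists_norm_iteratedFDeriv_convolution_le (d := d) j (kernel_contDiff d)
    (tsupport_kernel d).le
  choose C hC0 hC using this
  refine ⟨1 + ∑ j ∈ Finset.range (m + 1), C j, ?_, fun {f K x} hf h j hj => ?_⟩
  · have := Finset.sum_nonneg fun j (_ : j ∈ Finset.range (m + 1)) => hC0 j
    linarith
  · rw [mollUnit_eq_flip]
    have hK : 0 ≤ K := (abs_nonneg _).trans (h x (by simp))
    refine (hC j hf h).trans (mul_le_mul_of_nonneg_right ?_ hK)
    have := Finset.single_le_sum (f := C) (fun i _ => hC0 i) (Finset.mem_range.mpr (by omega : j < m + 1))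
    linarith

end Mollification

section ScaledMollification

variable {d : ℕ}

/-- Mollification at scale `l`. -/
def moll {F : Type*} [NormedAddCommGroup F] [NormedSpace ℝ F] (l : ℝ) (f : (Fin d → ℝ) → F) :
    (Fin d → ℝ) → F :=
  fun x => mollUnit (fun y => f (l • y)) (l⁻¹ • x)

theorem contDiff_moll {l : ℝ} {f : (Fin d → ℝ) → ℝ} (hf : Continuous f) :
    ContDiff ℝ ∞ (moll l f) :=
  (contDiff_mollUnit (hf.comp (continuous_const_smul l))).comp (contDiff_const_smul l⁻¹)

theorem dist_smul_le_of_mem_closedBall {l : ℝ} (hl : 0 < l) {x y : Fin d → ℝ}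
    (hy : y ∈ Metric.closedBall (l⁻¹ • x) 1) : dist (l • y) x ≤ l := by
  have hx : x = l • (l⁻¹ • x) := by rw [smul_smul, mul_inv_cancel₀ hl.ne', one_smul]
  rw [hx, dist_smul₀, Real.norm_eq_abs, abs_of_pos hl]
  have := Metric.mem_closedBall.1 hy
  nlinarith

theorem norm_moll_sub_le {F : Type*} [NormedAddCommGroup F] [NormedSpace ℝ F] [CompleteSpace F]
    {l : ℝ} (hl : 0 < l) {f : (Fin d → ℝ) → F} (hf : Continuous f)
    {K : ℝ} {x : Fin d → ℝ} {z : F} (h : ∀ y, dist y x ≤ l → ‖f y - z‖ ≤ K) :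
    ‖moll l f x - z‖ ≤ K :=
  norm_mollUnit_sub_le (hf.comp (continuous_const_smul l)) fun y hy =>
    h _ (dist_smul_le_of_mem_closedBall hl hy)

theorem fderiv_moll {l : ℝ} (hl : 0 < l) {f : (Fin d → ℝ) → ℝ} (hf : ContDiff ℝ 1 f) :
    fderiv ℝ (moll l f) = moll l (fderiv ℝ f) := by
  have h1 : ContDiff ℝ 1 fun y => f (l • y) := hf.comp (contDiff_const_smul l)
  have h2 : (fderiv ℝ fun y => f (l • y)) = fun y => l • fderiv ℝ f (l • y) := by
    funext y
    exact fderiv_comp_smul (f := f) (x := y) l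
  funext x
  have h3 : fderiv ℝ (moll l f) x = l⁻¹ • fderiv ℝ (mollUnit fun y => f (l • y)) (l⁻¹ • x) :=
    fderiv_comp_smul (f := mollUnit fun y => f (l • y)) (x := x) l⁻¹
  rw [h3, fderiv_mollUnit h1, h2]
  unfold moll
  rw [mollUnit_apply, mollUnit_apply, ← integral_smul]
  refine integral_congr_ae (Filter.Eventually.of_forall fun y => ?_)
  simp only
  rw [smul_comm (kernel d y) l, smul_smul, inv_mul_cancel₀ hl.ne', one_smul]

theorem mollUnit_sub_const {f : (Fin d → ℝ) → ℝ} (hf : Continuous f) (z : ℝ) :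
    mollUnit (fun y => f y - z) = fun x => mollUnit f x - z := by
  funext x
  have h1 : Integrable fun y => kernel d y • f (x - y) := by
    refine Continuous.integrable_of_hasCompactSupport
      ((kernel_contDiff d).continuous.smul (hf.comp (by fun_prop))) ?_
    exact (kernel_hasCompactSupport d).smul_right
  have h2 : Integrable fun y => kernel d y • z :=
    ((unitBump d).integrable_normed (μ := volume)).smul_const z
  have h3 : ∫ y, kernel d y = 1 := (unitBump d).integral_normed
  rw [mollUnit_apply]
  simp only [smul_sub]
  rw [integral_sub h1 h2, integral_smul_const, h3, one_smul]
  rfl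

theorem exists_norm_iteratedFDeriv_moll_le (d m : ℕ) : ∃ C : ℝ, 1 ≤ C ∧
    ∀ {l : ℝ} {f : (Fin d → ℝ) → ℝ} {K : ℝ} {x : Fin d → ℝ}, 0 < l → Continuous f →
      (∀ y, dist y x ≤ l → |f y| ≤ K) →
      ∀ j ≤ m, ‖iteratedFDeriv ℝ j (moll l f) x‖ ≤ C * K * l⁻¹ ^ j := by
  obtain ⟨C, hC1, hC⟩ := exists_norm_iteratedFDeriv_mollUnit_le d m
  refine ⟨C, hC1, fun {l f K x} hl hf h j hj => ?_⟩
  have hc : Continuous fun y => f (l • y) := hf.comp (continuous_const_smul l)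
  have h1 := congrFun (iteratedFDeriv_comp_const_smul (𝕜 := ℝ) (f := mollUnit fun y => f (l • y))
    (i := j) l⁻¹ ((contDiff_mollUnit hc).of_le (by exact_mod_cast le_top))) x
  have h2 : ‖iteratedFDeriv ℝ j (moll l f) x‖
      = ‖l⁻¹ ^ j • iteratedFDeriv ℝ j (mollUnit fun y => f (l • y)) (l⁻¹ • x)‖ := by
    rw [← h1]; rfl
  rw [h2, norm_smul, norm_pow, Real.norm_eq_abs, abs_of_pos (inv_pos.2 hl), mul_comm]
  exact mul_le_mul_of_nonneg_right
    (hC hc (fun y hy => h _ (dist_smul_le_of_mem_closedBall hl hy)) j hj) (by positivity)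

theorem exists_freqBd_moll (d m : ℕ) : ∃ C : ℝ, 1 ≤ C ∧
    ∀ {l : ℝ} {f : (Fin d → ℝ) → ℝ} {K : ℝ}, 0 < l → Continuous f → (∀ y, |f y| ≤ K) →
      FreqBd m (C * K) l⁻¹ (moll l f) := by
  obtain ⟨C, hC1, hC⟩ := exists_norm_iteratedFDeriv_moll_le d m
  exact ⟨C, hC1, fun hl hf h => ⟨contDiff_moll hf, fun j hj x => hC hl hf (fun y _ => h y) j hj⟩⟩

/-- The difference of two mollifications is controlled by the oscillation. -/
theorem exists_freqBd_moll_sub_moll (d m : ℕ) : ∃ C : ℝ, 1 ≤ C ∧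
    ∀ {l l' : ℝ} {f : (Fin d → ℝ) → ℝ} {K : ℝ}, 0 < l' → l' ≤ l → Continuous f →
      (∀ x y, dist y x ≤ l → |f y - f x| ≤ K) →
      FreqBd m (C * K) l'⁻¹ (fun x => moll l' f x - moll l f x) := by
  obtain ⟨C, hC1, hC⟩ := exists_norm_iteratedFDeriv_moll_le d m
  refine ⟨2 * C, by linarith, fun {l l' f K} hl' hll hf h => ⟨(contDiff_moll hf).sub
    (contDiff_moll hf), fun j hj x => ?_⟩⟩
  have hl : 0 < l := hl'.trans_le hll
  have hK : 0 ≤ K := (abs_nonneg _).trans (h x x (by simpa using hl.le))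
  have hf' : Continuous fun y => f y - f x := hf.sub continuous_const
  have e : ∀ s : ℝ, moll s (fun y => f y - f x) = fun z => moll s f z - f x := fun s => by
    funext z
    unfold moll
    rw [mollUnit_sub_const (f := fun y => f (s • y)) (hf.comp (continuous_const_smul s))]
  have h1 := hC hl hf' (h x) j hj
  have h2 := hC hl' hf' (fun y hy => h x y (hy.trans hll)) j hj
  have h3 : (fun x => moll l' f x - moll l f x)
      = fun z => moll l' (fun y => f y - f x) z - moll l (fun y => f y - f x) z := by
    funext z
    rw [e, e]; ring
  rw [h3]
  have h4 : iteratedFDeriv ℝ j (fun z => moll l' (fun y => f y - f x) z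
      - moll l (fun y => f y - f x) z) x = iteratedFDeriv ℝ j (moll l' fun y => f y - f x) x
      - iteratedFDeriv ℝ j (moll l fun y => f y - f x) x :=
    iteratedFDeriv_sub_apply ((contDiff_moll hf').of_le (by exact_mod_cast le_top)).contDiffAt
      ((contDiff_moll hf').of_le (by exact_mod_cast le_top)).contDiffAt
  rw [h4]
  refine (norm_sub_le _ _).trans ?_
  have h5 : C * K * l⁻¹ ^ j ≤ C * K * l'⁻¹ ^ j := by
    have : l⁻¹ ≤ l'⁻¹ := inv_anti₀ hl' hll
    gcongr
  calc _ ≤ C * K * l'⁻¹ ^ j + C * K * l'⁻¹ ^ j := add_le_add h2 (h1.trans h5)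
    _ = _ := by ring

theorem hasCompactSupport_moll {l : ℝ} (hl : 0 < l) {f : (Fin d → ℝ) → ℝ}
    (hf : HasCompactSupport f) : HasCompactSupport (moll l f) := by
  have h1 : HasCompactSupport (mollUnit fun y => f (l • y)) :=
    (kernel_hasCompactSupport d).convolution _ (hf.comp_smul hl.ne')
  exact h1.comp_smul (inv_ne_zero hl.ne')

end ScaledMollification

section Smoothing

variable {d : ℕ}

/-- The part of `f` removed by mollification at unit scale. -/
def rough (f : (Fin d → ℝ) → ℝ) : (Fin d → ℝ) → ℝ := fun x => f x - mollUnit f x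

theorem contDiff_rough {f : (Fin d → ℝ) → ℝ} (hf : ContDiff ℝ ∞ f) : ContDiff ℝ ∞ (rough f) :=
  hf.sub (contDiff_mollUnit hf.continuous)

theorem iterate_rough_bound {q : ℕ} {K x : ℝ} (hx0 : 0 ≤ x)
    {f : (Fin d → ℝ) → ℝ} (hf : FreqBd q K x f) (i : ℕ) :
    ContDiff ℝ ∞ (rough^[i] f) ∧ ∀ j ≤ q, ∀ y,
      ‖iteratedFDeriv ℝ j (rough^[i] f) y‖ ≤ 2 ^ i * K * x ^ min q (i + j) := by
  have hK := hf.nonneg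
  induction i with
  | zero =>
    refine ⟨hf.1, fun j hj y => ?_⟩
    simpa [min_eq_right hj] using hf.2 j hj y
  | succ i ih =>
    rw [Function.iterate_succ_apply']
    refine ⟨contDiff_rough ih.1, fun j hj y => ?_⟩
    rcases hj.lt_or_eq with hj' | rfl
    · refine (norm_iteratedFDeriv_sub_mollUnit_le j ih.1 (ih.2 (j + 1) hj') y).trans ?_
      have e : i + (j + 1) = i + 1 + j := by ring
      rw [e, pow_succ]
      have : 0 ≤ 2 ^ i * K * x ^ min q (i + 1 + j) := by positivity
      nlinarith
    · refine (norm_iteratedFDeriv_sub_mollUnit_le_two_mul j ih.1 (ih.2 j le_rfl) y).trans ?_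
      rw [min_eq_left (by omega), min_eq_left (by omega), pow_succ]
      exact le_of_eq (by ring)

theorem sub_iterate_rough (f : (Fin d → ℝ) → ℝ) (q : ℕ) :
    (fun x => f x - (rough^[q] f) x) = fun x => ∑ i ∈ Finset.range q, mollUnit (rough^[i] f) x := by
  induction q with
  | zero => simp
  | succ q ih =>
    funext x
    rw [Finset.sum_range_succ, ← congrFun ih x, Function.iterate_succ_apply']
    simp only [rough]
    ring

/-- The higher order smoothing operator at frequency `μ`. -/
def smoothing (q : ℕ) (μ : ℝ) (f : (Fin d → ℝ) → ℝ) : (Fin d → ℝ) → ℝ :=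
  fun x => f x - (rough^[q] fun y => f (μ⁻¹ • y)) (μ • x)

theorem exists_freqBd_smoothing (d m q : ℕ) : ∃ C : ℝ, 1 ≤ C ∧
    ∀ {μ l K : ℝ} {f : (Fin d → ℝ) → ℝ}, 0 < μ → 0 ≤ l → l ≤ μ → FreqBd q K l f →
      FreqBd m (C * K) μ (smoothing q μ f) ∧
        FreqBd q (2 ^ q * K * (l / μ) ^ q) μ (fun x => f x - smoothing q μ f x) := by
  obtain ⟨C, hC1, hC⟩ := exists_norm_iteratedFDeriv_mollUnit_le d m
  refine ⟨1 + C * ∑ i ∈ Finset.range q, 2 ^ i, ?_, fun {μ l K f} hμ hl hlμ hf => ?_⟩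
  · have : 0 ≤ C * ∑ i ∈ Finset.range q, (2 : ℝ) ^ i := by positivity
    linarith
  have hK := hf.nonneg
  have hx0 : 0 ≤ l / μ := by positivity
  have hx1 : l / μ ≤ 1 := (div_le_one hμ).2 hlμ
  set g : (Fin d → ℝ) → ℝ := fun y => f (μ⁻¹ • y) with hg
  have hgb : FreqBd q K (l / μ) g := by
    have := hf.comp_smul μ⁻¹
    rwa [abs_of_pos (inv_pos.2 hμ), inv_mul_eq_div] at this
  have hb := iterate_rough_bound hx0 hgb
  have hgf : ∀ x, f x = g (μ • x) := fun x => by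
    rw [hg]; simp only [smul_smul]; rw [inv_mul_cancel₀ hμ.ne', one_smul]
  constructor
  · have h1 : ∀ i, FreqBd m (C * (2 ^ i * K)) 1 (mollUnit (rough^[i] g)) := fun i =>
      ⟨contDiff_mollUnit (hb i).1.continuous, fun j hj x => by
        rw [one_pow, mul_one]
        refine hC (hb i).1.continuous (fun y _ => ?_) j hj
        have := (hb i).2 0 (Nat.zero_le _) y
        rw [norm_iteratedFDeriv_zero, Real.norm_eq_abs] at this
        refine this.trans ?_
        have h2 : (l / μ) ^ min q (i + 0) ≤ 1 := pow_le_one₀ hx0 hx1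
        have : 0 ≤ 2 ^ i * K := by positivity
        nlinarith⟩
    have h2 := (FreqBd.sum (Finset.range q) zero_le_one fun i _ => h1 i).comp_smul μ
    have h3 : smoothing q μ f = fun x => ∑ i ∈ Finset.range q, mollUnit (rough^[i] g) (μ • x) := by
      funext x
      have := congrFun (sub_iterate_rough g q) (μ • x)
      rw [← this]
      unfold smoothing
      rw [← hgf]
    rw [h3]
    rw [abs_of_pos hμ, mul_one] at h2
    refine h2.mono_const hμ.le ?_
    rw [add_mul, one_mul, mul_assoc, Finset.sum_mul, Finset.mul_sum]
    linarith
  · have h1 : FreqBd q (2 ^ q * K * (l / μ) ^ q) 1 (rough^[q] g) :=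
      ⟨(hb q).1, fun j hj x => by
        have := (hb q).2 j hj x
        rw [min_eq_left (Nat.le_add_right q j)] at this
        rwa [one_pow, mul_one]⟩
    have h2 := h1.comp_smul μ
    rw [abs_of_pos hμ, mul_one] at h2
    have h3 : (fun x => f x - smoothing q μ f x) = fun x => (rough^[q] g) (μ • x) := by
      funext x; unfold smoothing; rw [hg]; ring
    rwa [h3]

end Smoothing

section PartialDerivatives

variable {d : ℕ} {f g : (Fin d → ℝ) → ℝ} {x : Fin d → ℝ}

theorem pd_add (i : Fin d) (hf : DifferentiableAt ℝ f x) (hg : DifferentiableAt ℝ g x) :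
    pd i (fun y => f y + g y) x = pd i f x + pd i g x := by
  unfold pd
  rw [(hf.hasFDerivAt.fun_add hg.hasFDerivAt).fderiv]
  rfl

theorem pd_sub (i : Fin d) (hf : DifferentiableAt ℝ f x) (hg : DifferentiableAt ℝ g x) :
    pd i (fun y => f y - g y) x = pd i f x - pd i g x := by
  unfold pd
  rw [(hf.hasFDerivAt.fun_sub hg.hasFDerivAt).fderiv]
  rfl

theorem pd_mul (i : Fin d) (hf : DifferentiableAt ℝ f x) (hg : DifferentiableAt ℝ g x) :
    pd i (fun y => f y * g y) x = f x * pd i g x + g x * pd i f x := by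
  unfold pd
  rw [(hf.hasFDerivAt.fun_mul hg.hasFDerivAt).fderiv]
  rfl

theorem pd_const_mul (i : Fin d) (c : ℝ) (hf : DifferentiableAt ℝ f x) :
    pd i (fun y => c * f y) x = c * pd i f x := by
  unfold pd
  rw [(hf.hasFDerivAt.const_mul c).fderiv]
  rfl

theorem contDiff_pd (hf : ContDiff ℝ ∞ f) (i : Fin d) : ContDiff ℝ ∞ (pd i f) :=
  (hf.fderiv_right (m := ∞) le_rfl).clm_apply contDiff_const

theorem pd_comm (hf : ContDiff ℝ ∞ f) (i j : Fin d) (x : Fin d → ℝ) :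
    pd i (pd j f) x = pd j (pd i f) x := by
  have hd : DifferentiableAt ℝ (fderiv ℝ f) x :=
    (hf.fderiv_right (m := ∞) le_rfl).differentiable (by simp) x
  have h : ∀ a b : Fin d, pd a (pd b f) x
      = fderiv ℝ (fderiv ℝ f) x (Pi.single a 1) (Pi.single b 1) := fun a b => by
    have : pd b f = fun y => fderiv ℝ f y (Pi.single b 1) := rfl
    unfold pd at this ⊢
    rw [fderiv_clm_apply hd (differentiableAt_const _)]
    simp
  rw [h, h]
  exact (hf.contDiffAt.isSymmSndFDerivAt (by simpa using WithTop.coe_le_coe.2 (le_top : (2 : ℕ∞) ≤ ⊤))) _ _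

end PartialDerivatives

section Corrugation

variable {d k : ℕ}

/-- The matrix field `½(∇v)ᵀ∇v + sym∇w`. -/
def strain (v : (Fin d → ℝ) → Fin k → ℝ) (w : (Fin d → ℝ) → Fin d → ℝ) (x : Fin d → ℝ) :
    Fin d → Fin d → ℝ :=
  fun i j => (1 / 2) * gradTgrad v x i j + symGrad w x i j

/-- The linear phase `x ↦ l ⟨η, x⟩`. -/
def phase (l : ℝ) (η : Fin d → ℝ) : (Fin d → ℝ) →L[ℝ] ℝ :=
  l • ∑ i, η i • ContinuousLinearMap.proj (R := ℝ) (φ := fun _ : Fin d => ℝ) i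

theorem phase_single (l : ℝ) (η : Fin d → ℝ) (i : Fin d) :
    phase l η (Pi.single i 1) = l * η i := by
  simp [phase, Pi.single_apply]

theorem norm_phase_le {l : ℝ} (hl : 0 ≤ l) {η : Fin d → ℝ} (hη : ∑ i, |η i| ≤ 1) :
    ‖phase l η‖ ≤ l := by
  refine ContinuousLinearMap.opNorm_le_bound _ hl fun x => ?_
  have : phase l η x = l * ∑ i, η i * x i := by
    simp [phase]
  rw [this, norm_mul, Real.norm_eq_abs l, abs_of_nonneg hl]
  refine mul_le_mul_of_nonneg_left ?_ hl
  calc ‖∑ i, η i * x i‖ ≤ ∑ i, ‖η i * x i‖ := norm_sum_le _ _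
    _ ≤ ∑ i, |η i| * ‖x‖ := Finset.sum_le_sum fun i _ => by
        rw [norm_mul]
        exact mul_le_mul_of_nonneg_left (norm_le_pi_norm x i) (abs_nonneg _)
    _ = (∑ i, |η i|) * ‖x‖ := by rw [Finset.sum_mul]
    _ ≤ 1 * ‖x‖ := mul_le_mul_of_nonneg_right hη (norm_nonneg _)
    _ = ‖x‖ := one_mul _

/-- The oscillatory perturbation of one component of `v`. -/
def wave (l : ℝ) (η : Fin d → ℝ) (a : (Fin d → ℝ) → ℝ) (x : Fin d → ℝ) : ℝ :=
  2 / l * (a x * sin (phase l η x))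

/-- The field `v` after one corrugation of its component `e₀`. -/
def corrV (e₀ : Fin k) (l : ℝ) (η : Fin d → ℝ) (a : (Fin d → ℝ) → ℝ)
    (v : (Fin d → ℝ) → Fin k → ℝ) (x : Fin d → ℝ) (e : Fin k) : ℝ :=
  v x e + if e = e₀ then wave l η a x else 0

/-- The change of `w` in one corrugation. -/
def incW (e₀ : Fin k) (l : ℝ) (η : Fin d → ℝ) (a : (Fin d → ℝ) → ℝ)
    (v : (Fin d → ℝ) → Fin k → ℝ) (j : Fin d) (x : Fin d → ℝ) : ℝ :=
  (-1) * (wave l η a x * pd j (fun y => v y e₀) x)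
    + ((-(1 / l) * η j) * ((a x * a x) * (sin (phase l η x) * cos (phase l η x)))
    + 1 / (2 * l ^ 2) * ((a x * pd j a x) * (1 - 2 * (sin (phase l η x) * sin (phase l η x)))))

/-- The field `w` after one corrugation. -/
def corrW (e₀ : Fin k) (l : ℝ) (η : Fin d → ℝ) (a : (Fin d → ℝ) → ℝ)
    (v : (Fin d → ℝ) → Fin k → ℝ) (w : (Fin d → ℝ) → Fin d → ℝ) (x : Fin d → ℝ) (j : Fin d) : ℝ :=
  w x j + incW e₀ l η a v j x

/-- The error of one corrugation. -/
def corrErr (e₀ : Fin k) (l : ℝ) (η : Fin d → ℝ) (a : (Fin d → ℝ) → ℝ)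
    (v : (Fin d → ℝ) → Fin k → ℝ) (i j : Fin d) (x : Fin d → ℝ) : ℝ :=
  (-1) * (wave l η a x * pd i (pd j fun y => v y e₀) x)
    + (1 / l ^ 2 * ((pd i a x * pd j a x) * (1 / 2 + sin (phase l η x) * sin (phase l η x)))
    + 1 / (2 * l ^ 2) * ((a x * pd i (pd j a) x)
      * (1 - 2 * (sin (phase l η x) * sin (phase l η x)))))

variable {e₀ : Fin k} {l : ℝ} {η : Fin d → ℝ} {a : (Fin d → ℝ) → ℝ}
  {v : (Fin d → ℝ) → Fin k → ℝ} {w : (Fin d → ℝ) → Fin d → ℝ}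

theorem contDiff_wave (ha : ContDiff ℝ ∞ a) : ContDiff ℝ ∞ (wave l η a) :=
  contDiff_const.mul (ha.mul (Real.contDiff_sin.comp (phase l η).contDiff))

theorem contDiff_incW (hv : ContDiff ℝ ∞ fun x => v x e₀) (ha : ContDiff ℝ ∞ a) (j : Fin d) :
    ContDiff ℝ ∞ (incW e₀ l η a v j) := by
  have h1 : ContDiff ℝ ∞ fun x => sin (phase l η x) :=
    Real.contDiff_sin.comp (phase l η).contDiff
  have h2 : ContDiff ℝ ∞ fun x => cos (phase l η x) :=
    Real.contDiff_cos.comp (phase l η).contDiff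
  unfold incW
  exact (contDiff_const.mul ((contDiff_wave ha).mul (contDiff_pd hv j))).add
    ((contDiff_const.mul ((ha.mul ha).mul (h1.mul h2))).add
    (contDiff_const.mul ((ha.mul (contDiff_pd ha j)).mul
      (contDiff_const.sub (contDiff_const.mul (h1.mul h1))))))

theorem contDiff_corrV (hv : ∀ e, ContDiff ℝ ∞ fun x => v x e) (ha : ContDiff ℝ ∞ a) (e : Fin k) :
    ContDiff ℝ ∞ fun x => corrV e₀ l η a v x e := by
  unfold corrV
  by_cases h : e = e₀
  · simpa [h] using (hv e₀).add (contDiff_wave ha)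
  · simpa [h] using hv e

theorem contDiff_corrW (hv : ∀ e, ContDiff ℝ ∞ fun x => v x e)
    (hw : ∀ j, ContDiff ℝ ∞ fun x => w x j) (ha : ContDiff ℝ ∞ a) (j : Fin d) :
    ContDiff ℝ ∞ fun x => corrW e₀ l η a v w x j :=
  (hw j).add (contDiff_incW (hv e₀) ha j)

theorem pd_sin_phase (i : Fin d) (x : Fin d → ℝ) :
    pd i (fun y => sin (phase l η y)) x = l * η i * cos (phase l η x) := by
  unfold pd
  rw [((phase l η).hasFDerivAt.sin).fderiv, smul_apply, phase_single,
    smul_eq_mul]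
  ring

theorem pd_cos_phase (i : Fin d) (x : Fin d → ℝ) :
    pd i (fun y => cos (phase l η y)) x = - (l * η i * sin (phase l η x)) := by
  unfold pd
  rw [((phase l η).hasFDerivAt.cos).fderiv, smul_apply, phase_single,
    smul_eq_mul]
  ring

theorem pd_wave (ha : ContDiff ℝ ∞ a) (i : Fin d) (x : Fin d → ℝ) :
    pd i (wave l η a) x = 2 / l * (a x * (l * η i * cos (phase l η x))
      + sin (phase l η x) * pd i a x) := by
  have h1 : DifferentiableAt ℝ (fun x => sin (phase l η x)) x := by fun_prop
  have h2 : DifferentiableAt ℝ a x := ha.differentiable (by simp) x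
  unfold wave
  rw [pd_const_mul i _ (h2.fun_mul h1), pd_mul i h2 h1, pd_sin_phase]

theorem pd_incW (hv : ContDiff ℝ ∞ fun x => v x e₀) (ha : ContDiff ℝ ∞ a) (i j : Fin d)
    (x : Fin d → ℝ) :
    pd i (incW e₀ l η a v j) x =
      (-1) * (wave l η a x * pd i (pd j fun y => v y e₀) x
        + pd j (fun y => v y e₀) x * pd i (wave l η a) x)
      + ((-(1 / l) * η j) * ((a x * a x) * (sin (phase l η x) * - (l * η i * sin (phase l η x))
          + cos (phase l η x) * (l * η i * cos (phase l η x)))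
        + (sin (phase l η x) * cos (phase l η x)) * (a x * pd i a x + a x * pd i a x))
      + 1 / (2 * l ^ 2) * ((a x * pd j a x) * (- (2 * (sin (phase l η x)
          * (l * η i * cos (phase l η x)) + sin (phase l η x) * (l * η i * cos (phase l η x)))))
        + (1 - 2 * (sin (phase l η x) * sin (phase l η x)))
          * (a x * pd i (pd j a) x + pd j a x * pd i a x))) := by
  have hs : DifferentiableAt ℝ (fun x => sin (phase l η x)) x := by fun_prop
  have hc : DifferentiableAt ℝ (fun x => cos (phase l η x)) x := by fun_prop
  have h2 : DifferentiableAt ℝ a x := ha.differentiable (by simp) x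
  have h3 : DifferentiableAt ℝ (pd j a) x := (contDiff_pd ha j).differentiable (by simp) x
  have h4 : DifferentiableAt ℝ (pd j fun y => v y e₀) x :=
    (contDiff_pd hv j).differentiable (by simp) x
  have h5 : DifferentiableAt ℝ (wave l η a) x := (contDiff_wave ha).differentiable (by simp) x
  have h6 : DifferentiableAt ℝ (fun x => 2 * (sin (phase l η x) * sin (phase l η x))) x :=
    (hs.fun_mul hs).const_mul 2
  have h7 : DifferentiableAt ℝ (fun x => 1 - 2 * (sin (phase l η x) * sin (phase l η x))) x :=
    h6.const_sub 1
  have h8 : pd i (fun x => 1 - 2 * (sin (phase l η x) * sin (phase l η x))) x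
      = - pd i (fun x => 2 * (sin (phase l η x) * sin (phase l η x))) x := by
    rw [pd_sub i (differentiableAt_const 1) h6]
    simp [pd]
  unfold incW
  rw [pd_add i ((h5.fun_mul h4).const_mul _)
      ((((h2.fun_mul h2).fun_mul (hs.fun_mul hc)).const_mul _).fun_add (((h2.fun_mul h3).fun_mul h7).const_mul _)),
    pd_const_mul i _ (h5.fun_mul h4), pd_mul i h5 h4,
    pd_add i (((h2.fun_mul h2).fun_mul (hs.fun_mul hc)).const_mul _) (((h2.fun_mul h3).fun_mul h7).const_mul _),
    pd_const_mul i _ ((h2.fun_mul h2).fun_mul (hs.fun_mul hc)), pd_mul i (h2.fun_mul h2) (hs.fun_mul hc),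
    pd_mul i h2 h2, pd_mul i hs hc, pd_const_mul i _ ((h2.fun_mul h3).fun_mul h7),
    pd_mul i (h2.fun_mul h3) h7, pd_mul i h2 h3, h8, pd_const_mul i _ (hs.fun_mul hs), pd_mul i hs hs,
    pd_sin_phase, pd_cos_phase]

/-- One corrugation adds the rank one matrix `a² η ⊗ η` up to a small error. -/
theorem strain_corr (hl : l ≠ 0) (hv : ∀ e, ContDiff ℝ ∞ fun x => v x e)
    (hw : ∀ j, ContDiff ℝ ∞ fun x => w x j) (ha : ContDiff ℝ ∞ a) (x : Fin d → ℝ) (i j : Fin d) :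
    strain (corrV e₀ l η a v) (corrW e₀ l η a v w) x i j
      = strain v w x i j + a x ^ 2 * (η i * η j) + corrErr e₀ l η a v i j x := by
  have hψ : DifferentiableAt ℝ (wave l η a) x := (contDiff_wave ha).differentiable (by simp) x
  have hg : gradTgrad (corrV e₀ l η a v) x i j = gradTgrad v x i j
      + (pd i (fun y => v y e₀) x * pd j (wave l η a) x
        + pd i (wave l η a) x * pd j (fun y => v y e₀) x
        + pd i (wave l η a) x * pd j (wave l η a) x) := by
    have h1 : ∀ (b : Fin d) (e : Fin k), pd b (fun y => corrV e₀ l η a v y e) x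
        = pd b (fun y => v y e) x + if e = e₀ then pd b (wave l η a) x else 0 := fun b e => by
      unfold corrV
      by_cases h : e = e₀
      · simp only [h, if_true]
        exact pd_add b ((hv e₀).differentiable (by simp) x) hψ
      · simp [h]
    unfold gradTgrad
    simp only [h1]
    rw [← Finset.add_sum_erase _ _ (Finset.mem_univ e₀),
      ← Finset.add_sum_erase (a := e₀) _ (fun e => pd i (fun y => v y e) x * _)
        (Finset.mem_univ e₀)]
    have h2 : ∀ e ∈ Finset.univ.erase e₀,
        (pd i (fun y => v y e) x + if e = e₀ then pd i (wave l η a) x else 0)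
          * (pd j (fun y => v y e) x + if e = e₀ then pd j (wave l η a) x else 0)
        = pd i (fun y => v y e) x * pd j (fun y => v y e) x := fun e he => by
      simp [Finset.ne_of_mem_erase he]
    rw [Finset.sum_congr rfl h2]
    simp only [if_true]
    ring
  have hs : ∀ b c : Fin d, pd b (fun y => corrW e₀ l η a v w y c) x
      = pd b (fun y => w y c) x + pd b (incW e₀ l η a v c) x := fun b c =>
    pd_add b ((hw c).differentiable (by simp) x)
      ((contDiff_incW (hv e₀) ha c).differentiable (by simp) x)
  unfold strain
  rw [hg]
  unfold symGrad
  rw [hs, hs, pd_incW (hv e₀) ha, pd_incW (hv e₀) ha, pd_comm (hv e₀) j i, pd_comm ha j i,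
    pd_wave ha, pd_wave ha]
  unfold corrErr
  have hcs : cos (phase l η x) ^ 2 = 1 - sin (phase l η x) ^ 2 := cos_sq' _
  set s := sin (phase l η x)
  set c := cos (phase l η x)
  have h0 : a x ^ 2 * (η i * η j) = a x ^ 2 * (η i * η j) * (c ^ 2 + s ^ 2) := by rw [hcs]; ring
  rw [h0]
  field_simp
  ring

end Corrugation

section CorrugationBounds

variable {d k : ℕ} {e₀ : Fin k} {l : ℝ} {η : Fin d → ℝ} {a : (Fin d → ℝ) → ℝ}
  {v : (Fin d → ℝ) → Fin k → ℝ} {w : (Fin d → ℝ) → Fin d → ℝ}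

theorem freqBd_wave {m : ℕ} {B : ℝ} (hl : 0 < l) (hη : ∑ i, |η i| ≤ 1) (ha : FreqBd m B l a) :
    FreqBd m (2 * 2 ^ m * (B / l)) l (wave l η a) := by
  have h := ((ha.mul (FreqBd.sin_clm (m := m) (phase l η) (norm_phase_le hl.le hη)) hl.le).const_mul
    (2 / l))
  refine h.mono_const hl.le (le_of_eq ?_)
  rw [abs_of_pos (by positivity)]
  field_simp

theorem freqBd_sin_sq {m : ℕ} (hl : 0 < l) (hη : ∑ i, |η i| ≤ 1) (c s : ℝ) :
    FreqBd m (|c| + |s| * 2 ^ m) l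
      (fun x => c + s * (sin (phase l η x) * sin (phase l η x))) := by
  have hs := FreqBd.sin_clm (m := m) (phase l η) (norm_phase_le hl.le hη)
  refine ((FreqBd.const (le_refl |c|) hl.le).add ((hs.mul hs hl.le).const_mul s)).mono_const
    hl.le ?_
  simp

theorem freqBd_incW {m : ℕ} {B μ V : ℝ} (hμ : 0 ≤ μ) (hμl : μ ≤ l) (hl : 0 < l)
    (hη : ∑ i, |η i| ≤ 1) (ha : FreqBd (m + 1) B μ a) {j : Fin d}
    (hv : FreqBd m V l (pd j fun y => v y e₀)) :
    FreqBd m (8 * 8 ^ m * (B * (V + B) / l)) l (incW e₀ l η a v j) := by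
  have hB := ha.nonneg
  have hV := hv.nonneg
  have ha' : FreqBd m B l a := (ha.of_le (Nat.le_succ m)).mono hμ le_rfl hμl
  have hda : FreqBd m (B * l) l (pd j a) :=
    (ha.pd j).mono hμ (mul_le_mul_of_nonneg_left hμl hB) hμl
  have hs := FreqBd.sin_clm (m := m) (phase l η) (norm_phase_le hl.le hη)
  have hc := FreqBd.cos_clm (m := m) (phase l η) (norm_phase_le hl.le hη)
  have h1 := (((freqBd_wave hl hη ha').mul hv hl.le).const_mul (-1))
  have h2 := (((ha'.mul ha' hl.le).mul (hs.mul hc hl.le) hl.le).const_mul (-(1 / l) * η j))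
  have h3 := (((ha'.mul hda hl.le).mul (freqBd_sin_sq (m := m) hl hη 1 (-2)) hl.le).const_mul
    (1 / (2 * l ^ 2)))
  have h := h1.add (h2.add h3)
  have e : incW e₀ l η a v j = fun x => (-1) * (wave l η a x * pd j (fun y => v y e₀) x)
      + ((-(1 / l) * η j) * ((a x * a x) * (sin (phase l η x) * cos (phase l η x)))
      + 1 / (2 * l ^ 2) * ((a x * pd j a x)
        * (1 + (-2) * (sin (phase l η x) * sin (phase l η x))))) := by
    funext x; unfold incW; ring
  rw [e]
  refine h.mono_const hl.le ?_
  have hj : |η j| ≤ 1 :=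
    (Finset.single_le_sum (f := fun i => |η i|) (fun i _ => abs_nonneg _) (Finset.mem_univ j)).trans
      hη
  have e1 : |(-(1 / l) * η j)| ≤ 1 / l := by
    rw [abs_mul, abs_neg, abs_of_pos (by positivity : (0:ℝ) < 1 / l)]
    exact mul_le_of_le_one_right (by positivity) hj
  have e2 : |(1 / (2 * l ^ 2))| = 1 / (2 * l ^ 2) := abs_of_pos (by positivity)
  have p1 : (1 : ℝ) ≤ 2 ^ m := one_le_pow₀ (by norm_num)
  have p3 : (8 : ℝ) ^ m = 2 ^ m * 2 ^ m * 2 ^ m := by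
    rw [← mul_pow, ← mul_pow]; norm_num
  rw [e2]
  simp only [abs_neg, abs_one, one_mul]
  rw [abs_of_pos (by norm_num : (0:ℝ) < 2), p3]
  set P : ℝ := 2 ^ m
  have q1 : 2 ^ m * (2 * P * (B / l) * V) ≤ 2 * (P * P * P) * (B * V / l) := by
    have : 0 ≤ B * V / l := by positivity
    calc 2 ^ m * (2 * P * (B / l) * V) = 2 * (P * P * 1) * (B * V / l) := by
          simp only [P]; ring
      _ ≤ _ := by gcongr
  have q2 : |(-(1 / l) * η j)| * (2 ^ m * (2 ^ m * (B * B) * (2 ^ m * (1 * 1))))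
      ≤ 1 * (P * P * P) * (B * B / l) := by
    calc _ ≤ 1 / l * (2 ^ m * (2 ^ m * (B * B) * (2 ^ m * (1 * 1)))) := by gcongr
      _ = _ := by simp only [P]; ring
  have q3 : 1 / (2 * l ^ 2) * (2 ^ m * (2 ^ m * (B * (B * l)) * (1 + 2 * 2 ^ m)))
      ≤ 2 * (P * P * P) * (B * B / l) := by
    have : 0 ≤ B * B / l := by positivity
    calc _ = 1 / 2 * (P * P * (1 + 2 * P)) * (B * B / l) := by simp only [P]; field_simp
      _ ≤ 1 / 2 * (P * P * (P + 2 * P)) * (B * B / l) := by gcongr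
      _ = 3 / 2 * (P * P * P * (B * B / l)) := by ring
      _ ≤ 2 * (P * P * P * (B * B / l)) := by gcongr; norm_num
      _ = _ := by ring
  have q4 : 8 * (P * P * P) * (B * (V + B) / l)
      = 8 * (P * P * P) * (B * V / l) + 8 * (P * P * P) * (B * B / l) := by ring
  have q5 : 0 ≤ P * P * P * (B * V / l) := by positivity
  have q6 : 0 ≤ P * P * P * (B * B / l) := by positivity
  linarith [q1, q2, q3]

theorem freqBd_corrErr {m : ℕ} {B μ Q : ℝ} (hμ : 0 ≤ μ) (hμl : μ ≤ l) (hl : 0 < l)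
    (hη : ∑ i, |η i| ≤ 1) (ha : FreqBd (m + 2) B μ a) {i j : Fin d}
    (hv : FreqBd m Q l (pd i (pd j fun y => v y e₀))) :
    FreqBd m (8 * 8 ^ m * (B * Q / l + (B * μ / l) ^ 2)) l (corrErr e₀ l η a v i j) := by
  have hB := ha.nonneg
  have hQ := hv.nonneg
  have ha' : FreqBd m B l a := (ha.of_le (by omega)).mono hμ le_rfl hμl
  have hda : ∀ j, FreqBd (m + 1) (B * μ) μ (pd j a) := fun j => ha.pd j
  have hda' : ∀ j, FreqBd m (B * μ) l (pd j a) := fun j =>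
    ((hda j).of_le (by omega)).mono hμ le_rfl hμl
  have hdda : FreqBd m (B * μ * μ) l (pd i (pd j a)) := ((hda j).pd i).mono hμ le_rfl hμl
  have h1 := (((freqBd_wave hl hη ha').mul hv hl.le).const_mul (-1))
  have h2 := ((((hda' i).mul (hda' j) hl.le).mul (freqBd_sin_sq (m := m) hl hη (1 / 2) 1)
    hl.le).const_mul (1 / l ^ 2))
  have h3 := (((ha'.mul hdda hl.le).mul (freqBd_sin_sq (m := m) hl hη 1 (-2)) hl.le).const_mul
    (1 / (2 * l ^ 2)))
  have h := h1.add (h2.add h3)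
  have e : corrErr e₀ l η a v i j = fun x =>
      (-1) * (wave l η a x * pd i (pd j fun y => v y e₀) x)
      + (1 / l ^ 2 * ((pd i a x * pd j a x) * (1 / 2 + 1 * (sin (phase l η x) * sin (phase l η x))))
      + 1 / (2 * l ^ 2) * ((a x * pd i (pd j a) x)
        * (1 + (-2) * (sin (phase l η x) * sin (phase l η x))))) := by
    funext x; unfold corrErr; ring
  rw [e]
  refine h.mono_const hl.le ?_
  have e2 : |(1 / (2 * l ^ 2))| = 1 / (2 * l ^ 2) := abs_of_pos (by positivity)
  have e3 : |(1 / l ^ 2)| = 1 / l ^ 2 := abs_of_pos (by positivity)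
  have p1 : (1 : ℝ) ≤ 2 ^ m := one_le_pow₀ (by norm_num)
  have p3 : (8 : ℝ) ^ m = 2 ^ m * 2 ^ m * 2 ^ m := by
    rw [← mul_pow, ← mul_pow]; norm_num
  rw [e2, e3]
  simp only [abs_neg, abs_one, one_mul]
  rw [abs_of_pos (by norm_num : (0:ℝ) < 2), abs_of_pos (by norm_num : (0:ℝ) < 1 / 2), p3]
  set P : ℝ := 2 ^ m
  have q0 : 0 ≤ (B * μ / l) ^ 2 := by positivity
  have q1 : P * (2 * P * (B / l) * Q) ≤ 2 * (P * P * P) * (B * Q / l) := by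
    have : 0 ≤ B * Q / l := by positivity
    calc P * (2 * P * (B / l) * Q) = 2 * (P * P * 1) * (B * Q / l) := by ring
      _ ≤ _ := by gcongr
  have q2 : 1 / l ^ 2 * (P * (P * (B * μ * (B * μ)) * (1 / 2 + P)))
      ≤ 2 * (P * P * P) * (B * μ / l) ^ 2 := by
    calc _ = P * P * (1 / 2 + P) * (B * μ / l) ^ 2 := by field_simp
      _ ≤ P * P * (P + P) * (B * μ / l) ^ 2 := by gcongr; linarith
      _ = _ := by ring
  have q3 : 1 / (2 * l ^ 2) * (P * (P * (B * (B * μ * μ)) * (1 + 2 * P)))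
      ≤ 2 * (P * P * P) * (B * μ / l) ^ 2 := by
    calc _ = 1 / 2 * (P * P * (1 + 2 * P)) * (B * μ / l) ^ 2 := by field_simp
      _ ≤ 1 / 2 * (P * P * (P + 2 * P)) * (B * μ / l) ^ 2 := by gcongr
      _ = 3 / 2 * (P * P * P * (B * μ / l) ^ 2) := by ring
      _ ≤ 2 * (P * P * P * (B * μ / l) ^ 2) := by gcongr; norm_num
      _ = _ := by ring
  have q5 : 0 ≤ P * P * P * (B * Q / l) := by positivity
  have q6 : 0 ≤ P * P * P * (B * μ / l) ^ 2 := by positivity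
  linarith

end CorrugationBounds

section Tame

variable {d k : ℕ} {f g : (Fin d → ℝ) → ℝ}

/-- Smooth functions all of whose derivatives are bounded. -/
def Tame (f : (Fin d → ℝ) → ℝ) : Prop := ∀ m, ∃ K, FreqBd m K 1 f

theorem Tame.contDiff (hf : Tame f) : ContDiff ℝ ∞ f := (hf 0).choose_spec.contDiff

theorem FreqBd.freq_one {m : ℕ} {K μ : ℝ} (hf : FreqBd m K μ f) (hμ : 0 ≤ μ) :
    ∃ K', FreqBd m K' 1 f :=
  ⟨_, FreqBd.rescale (L := max 1 μ) (le_max_left _ _) zero_le_one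
    (hf.mono hμ le_rfl (by rw [mul_one]; exact le_max_right _ _))⟩

theorem Tame.freqBd (hf : Tame f) (m : ℕ) : ∃ K, ∀ μ, 1 ≤ μ → FreqBd m K μ f := by
  obtain ⟨K, hK⟩ := hf m
  exact ⟨K, fun μ hμ => hK.mono zero_le_one le_rfl hμ⟩

theorem Tame.add (hf : Tame f) (hg : Tame g) : Tame fun x => f x + g x := fun m => by
  obtain ⟨K, hK⟩ := hf m
  obtain ⟨K', hK'⟩ := hg m
  exact ⟨_, hK.add hK'⟩

theorem Tame.pd (hf : Tame f) (i : Fin d) : Tame (pd i f) := fun m => by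
  obtain ⟨K, hK⟩ := hf (m + 1)
  exact ⟨_, hK.pd i⟩

theorem Tame.of_hasCompactSupport (hf : ContDiff ℝ ∞ f) (hs : HasCompactSupport f) : Tame f :=
  fun m => by
  have h : ∀ j : ℕ, ∃ C, ∀ x, ‖iteratedFDeriv ℝ j f x‖ ≤ C := fun j =>
    (hf.continuous_iteratedFDeriv (by exact_mod_cast le_top)).bounded_above_of_compact_support
      (hs.iteratedFDeriv j)
  choose C hC using h
  have hC0 : ∀ j, 0 ≤ C j := fun j => (norm_nonneg _).trans (hC j 0)
  refine ⟨∑ j ∈ Finset.range (m + 1), C j, hf, fun j hj x => ?_⟩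
  rw [one_pow, mul_one]
  exact (hC j x).trans (Finset.single_le_sum (f := C) (fun i _ => hC0 i)
    (Finset.mem_range.2 (by omega)))

variable {e₀ : Fin k} {l : ℝ} {η : Fin d → ℝ} {a : (Fin d → ℝ) → ℝ}
  {v : (Fin d → ℝ) → Fin k → ℝ} {w : (Fin d → ℝ) → Fin d → ℝ}

theorem tame_wave (hl : 1 ≤ l) (hη : ∑ i, |η i| ≤ 1) (ha : Tame a) : Tame (wave l η a) :=
  fun m => by
  obtain ⟨K, hK⟩ := ha.freqBd m
  exact (freqBd_wave (by linarith) hη (hK l hl)).freq_one (by linarith)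

theorem tame_incW (hl : 1 ≤ l) (hη : ∑ i, |η i| ≤ 1) (ha : Tame a)
    (hv : Tame fun x => v x e₀) (j : Fin d) : Tame (incW e₀ l η a v j) := fun m => by
  obtain ⟨K, hK⟩ := ha.freqBd (m + 1)
  obtain ⟨V, hV⟩ := (hv.pd j).freqBd m
  exact (freqBd_incW zero_le_one hl (by linarith) hη (hK 1 le_rfl) (hV l hl)).freq_one (by linarith)

theorem tame_corrV (hl : 1 ≤ l) (hη : ∑ i, |η i| ≤ 1) (ha : Tame a)
    (hv : ∀ e, Tame fun x => v x e) (e : Fin k) : Tame fun x => corrV e₀ l η a v x e := by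
  unfold corrV
  by_cases h : e = e₀
  · simpa [h] using (hv e₀).add (tame_wave hl hη ha)
  · simpa [h] using hv e

theorem tame_corrW (hl : 1 ≤ l) (hη : ∑ i, |η i| ≤ 1) (ha : Tame a)
    (hv : ∀ e, Tame fun x => v x e) (hw : ∀ j, Tame fun x => w x j) (j : Fin d) :
    Tame fun x => corrW e₀ l η a v w x j :=
  (hw j).add (tame_incW hl hη ha (hv e₀) j)

end Tame

section Decomposition

variable {d : ℕ}

/-- The vector `½(e_a + e_b)`. -/
def halfSum (d : ℕ) (p : Fin d × Fin d) (i : Fin d) : ℝ :=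
  ((if i = p.1 then 1 else 0) + (if i = p.2 then 1 else 0)) / 2

theorem halfSum_swap (p : Fin d × Fin d) : halfSum d p.swap = halfSum d p := by
  funext i
  simp [halfSum, add_comm]

theorem sum_abs_halfSum (p : Fin d × Fin d) : ∑ i, |halfSum d p i| ≤ 1 := by
  have : ∀ i, |halfSum d p i|
      = ((if i = p.1 then 1 else 0) + (if i = p.2 then 1 else 0)) / 2 := fun i => by
    rw [halfSum, abs_of_nonneg]
    positivity
  simp only [this]
  rw [← Finset.sum_div, Finset.sum_add_distrib]
  simp

theorem symmetric_decomposition {M : Fin d → Fin d → ℝ} (hM : ∀ i j, M i j = M j i)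
    (i j : Fin d) :
    M i j = ∑ p : Fin d × Fin d, (2 * M p.1 p.2 - if p.1 = p.2 then ∑ l, M p.1 l else 0)
      * (halfSum d p i * halfSum d p j) := by
  have h1 : ∑ p : Fin d × Fin d, (if p.1 = p.2 then ∑ l, M p.1 l else 0)
      * (halfSum d p i * halfSum d p j) = if i = j then ∑ l, M i l else 0 := by
    rw [Fintype.sum_prod_type]
    simp only [ite_mul, zero_mul, Finset.sum_ite_eq, Finset.mem_univ, if_true]
    simp only [halfSum, add_self_div_two]
    simp only [mul_ite, mul_one, mul_zero, Finset.sum_ite_eq, Finset.mem_univ, if_true]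
    by_cases h : i = j
    · simp [h]
    · simp [h]
  have h2 : ∑ p : Fin d × Fin d, 2 * M p.1 p.2 * (halfSum d p i * halfSum d p j)
      = M i j + if i = j then ∑ l, M i l else 0 := by
    rw [Fintype.sum_prod_type]
    have : ∀ x y : Fin d, 2 * M x y * (halfSum d (x, y) i * halfSum d (x, y) j)
        = (M x y * (if i = x then 1 else 0) * (if j = x then 1 else 0)
          + M x y * (if i = y then 1 else 0) * (if j = y then 1 else 0)
          + (M x y * (if i = x then 1 else 0) * (if j = y then 1 else 0)
          + M x y * (if i = y then 1 else 0) * (if j = x then 1 else 0))) / 2 := fun x y => by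
      simp only [halfSum]; ring
    simp only [this, ← Finset.sum_div, Finset.sum_add_distrib, mul_ite, mul_one, mul_zero,
      Finset.sum_ite_eq, Finset.mem_univ, if_true, Finset.sum_ite_irrel,
      Finset.sum_const_zero]
    by_cases h : i = j
    · subst h
      simp only [if_true]
      rw [Finset.sum_congr rfl fun l _ => hM l i]
      ring
    · simp [h, hM j i]
  simp only [sub_mul, Finset.sum_sub_distrib]
  rw [h1, h2]
  ring

/-- Symmetric matrices are linear combinations of `d(d+1)/2` fixed rank one matrices. -/
theorem exists_decomposition (d : ℕ) : ∃ (N : ℕ) (η : Fin N → Fin d → ℝ)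
    (L : Fin N → Fin d → Fin d → ℝ), 2 * N = d * (d + 1) ∧ (∀ n, ∑ i, |η n i| ≤ 1) ∧
      ∀ M : Fin d → Fin d → ℝ, (∀ i j, M i j = M j i) → ∀ i j,
        M i j = ∑ n, (∑ a, ∑ b, L n a b * M a b) * (η n i * η n j) := by
  classical
  let ηz : Sym2 (Fin d) → Fin d → ℝ := fun z => halfSum d z.out
  have hη : ∀ p : Fin d × Fin d, ηz (Sym2.mk p.1 p.2) = halfSum d p := fun p => by
    have h : Sym2.mk (Sym2.mk p.1 p.2).out.1 (Sym2.mk p.1 p.2).out.2 = Sym2.mk p.1 p.2 :=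
      Quot.out_eq _
    rcases Sym2.mk_eq_mk_iff.1 h with h' | h'
    · exact congrArg (halfSum d) h'
    · exact (congrArg (halfSum d) h').trans (halfSum_swap p)
  let Lz : Sym2 (Fin d) → Fin d → Fin d → ℝ := fun z a b =>
    ∑ p : Fin d × Fin d with Sym2.mk p.1 p.2 = z,
      (2 * (if p = (a, b) then 1 else 0) - if p.1 = p.2 then (if p.1 = a then 1 else 0) else 0)
  have hc : Fintype.card (Sym2 (Fin d)) = (d + 1).choose 2 := by rw [Sym2.card]; simp
  let e : Fin ((d + 1).choose 2) ≃ Sym2 (Fin d) := (Fintype.equivFinOfCardEq hc).symm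
  refine ⟨(d + 1).choose 2, fun n => ηz (e n), fun n => Lz (e n), ?_, fun n => ?_, ?_⟩
  · rw [Nat.choose_two_right, Nat.add_sub_cancel, mul_comm d]
    exact Nat.mul_div_cancel' (by rw [mul_comm]; exact (Nat.even_mul_succ_self d).two_dvd)
  · exact sum_abs_halfSum _
  · intro M hM i j
    have h1 : ∀ z, ∑ a, ∑ b, Lz z a b * M a b = ∑ p : Fin d × Fin d with Sym2.mk p.1 p.2 = z,
        (2 * M p.1 p.2 - if p.1 = p.2 then ∑ l, M p.1 l else 0) := fun z => by
      simp only [Lz, Finset.sum_mul]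
      have h2 : ∀ a : Fin d, ∑ b, ∑ p : Fin d × Fin d with Sym2.mk p.1 p.2 = z,
          (2 * (if p = (a, b) then 1 else 0)
            - if p.1 = p.2 then (if p.1 = a then 1 else 0) else 0) * M a b
          = ∑ p : Fin d × Fin d with Sym2.mk p.1 p.2 = z, ∑ b,
          (2 * (if p = (a, b) then 1 else 0)
            - if p.1 = p.2 then (if p.1 = a then 1 else 0) else 0) * M a b :=
        fun a => Finset.sum_comm
      simp only [h2]
      rw [Finset.sum_comm]
      refine Finset.sum_congr rfl fun p _ => ?_
      simp only [sub_mul, Finset.sum_sub_distrib]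
      congr 1
      · rw [← Fintype.sum_prod_type' (f := fun a b => 2 * (if p = (a, b) then 1 else 0) * M a b)]
        simp
      · by_cases h : p.1 = p.2
        · simp [h]
        · simp [h]
    rw [Equiv.sum_comp e fun z => (∑ a, ∑ b, Lz z a b * M a b) * (ηz z i * ηz z j)]
    simp only [h1]
    rw [symmetric_decomposition hM i j,
      ← Finset.sum_fiberwise_of_maps_to (g := fun p : Fin d × Fin d => Sym2.mk p.1 p.2)
      (t := Finset.univ) (fun _ _ => Finset.mem_univ _)]
    refine Finset.sum_congr rfl fun z _ => ?_
    rw [Finset.sum_mul]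
    refine Finset.sum_congr rfl fun p hp => ?_
    rw [← (Finset.mem_filter.1 hp).2, hη]

end Decomposition

section Increments

variable {d : ℕ} {f g : (Fin d → ℝ) → ℝ} {X X' μ l Λ Λ' : ℝ}

/-- Bounds for increments whose frequencies lie between `μ` and `Λ`, with gradient of size `X`. -/
def IncBd (X μ Λ : ℝ) (f : (Fin d → ℝ) → ℝ) : Prop :=
  ContDiff ℝ ∞ f ∧ ∀ x, ‖iteratedFDeriv ℝ 0 f x‖ ≤ X / μ ∧ ‖iteratedFDeriv ℝ 1 f x‖ ≤ X ∧
    ‖iteratedFDeriv ℝ 2 f x‖ ≤ X * Λ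

theorem IncBd.nonneg (h : IncBd X μ Λ f) : 0 ≤ X := (norm_nonneg _).trans (h.2 0).2.1

theorem IncBd.mono (h : IncBd X μ Λ f) (hμ : 0 < μ) (hX : X ≤ X') (hΛ : Λ ≤ Λ') (hΛ' : 0 ≤ Λ') :
    IncBd X' μ Λ' f := by
  have := h.nonneg
  refine ⟨h.1, fun x => ⟨(h.2 x).1.trans (by gcongr), (h.2 x).2.1.trans hX,
    (h.2 x).2.2.trans ((mul_le_mul_of_nonneg_left hΛ this).trans
      (mul_le_mul_of_nonneg_right hX hΛ'))⟩⟩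

theorem IncBd.add (hf : IncBd X μ Λ f) (hg : IncBd X' μ Λ g) :
    IncBd (X + X') μ Λ (fun x => f x + g x) := by
  refine ⟨hf.1.add hg.1, fun x => ?_⟩
  have : ∀ j : ℕ, iteratedFDeriv ℝ j (fun x => f x + g x) x
      = iteratedFDeriv ℝ j f x + iteratedFDeriv ℝ j g x := fun j =>
    iteratedFDeriv_add_apply (hf.1.of_le (by exact_mod_cast le_top)).contDiffAt
      (hg.1.of_le (by exact_mod_cast le_top)).contDiffAt
  rw [this, this, this, add_div, add_mul]
  exact ⟨(norm_add_le _ _).trans (add_le_add (hf.2 x).1 (hg.2 x).1),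
    (norm_add_le _ _).trans (add_le_add (hf.2 x).2.1 (hg.2 x).2.1),
    (norm_add_le _ _).trans (add_le_add (hf.2 x).2.2 (hg.2 x).2.2)⟩

theorem IncBd.zero (hX : 0 ≤ X) (hμ : 0 ≤ μ) (hΛ : 0 ≤ Λ) :
    IncBd X μ Λ (fun _ : Fin d → ℝ => (0 : ℝ)) := by
  have h := FreqBd.zero (d := d) (m := 2) (K := 0) (μ := 1) le_rfl zero_le_one
  refine ⟨h.1, fun x => ⟨(h.2 0 (by norm_num) x).trans ?_, (h.2 1 (by norm_num) x).trans ?_,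
    (h.2 2 (by norm_num) x).trans ?_⟩⟩
  · rw [zero_mul]; positivity
  · rw [zero_mul]; positivity
  · rw [zero_mul]; positivity

theorem FreqBd.incBd {m : ℕ} (h : FreqBd m (X / l) l f) (hm : 2 ≤ m) (hX : 0 ≤ X) (hμ : 0 < μ)
    (hμl : μ ≤ l) (hl : l ≤ Λ) : IncBd X μ Λ f := by
  have hl0 : 0 < l := hμ.trans_le hμl
  refine ⟨h.1, fun x => ⟨(h.2 0 (by omega) x).trans ?_, (h.2 1 (by omega) x).trans ?_,
    (h.2 2 hm x).trans ?_⟩⟩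
  · rw [pow_zero, mul_one]; gcongr
  · rw [pow_one, div_mul_cancel₀ _ hl0.ne']
  · rw [pow_two, ← mul_assoc, div_mul_cancel₀ _ hl0.ne']; gcongr

end Increments

section Stages

variable {d k : ℕ}

/-- The state of the iteration: the `r`-th component to be corrugated next has not been touched for
`k - r` corrugations, so its second derivatives are smaller by the factor `τ ^ (k - r - 1)`. -/
def Stage (q : ℕ) (C τ : ℝ) (n₀ : ℕ) (b Λ V : ℝ) (v : (Fin d → ℝ) → Fin k → ℝ) : Prop :=
  (∀ e, ContDiff ℝ ∞ fun x => v x e) ∧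
  (∀ r < k, ∀ e : Fin k, (e : ℕ) = (n₀ + r) % k → ∀ i j,
    FreqBd q (C * b * Λ * (τ ^ (r + 1) / τ ^ k)) Λ (pd i (pd j fun x => v x e))) ∧
  ∀ e j, FreqBd (q + 1) V Λ (pd j fun x => v x e)

variable {q n₀ : ℕ} {C τ b Λ V : ℝ} {v : (Fin d → ℝ) → Fin k → ℝ}

theorem stage_corrV (hk : 1 ≤ k) (hb : 0 ≤ b) (hΛ : 0 < Λ) (hτ : 1 ≤ τ)
    (hτk : 2 ≤ τ ^ k) (hv : Stage q (16 * 2 ^ q * C) τ n₀ b Λ V v) (hC : 0 ≤ C) {μ : ℝ}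
    (hμ : 0 ≤ μ) (hμΛ : μ ≤ Λ * τ) {η : Fin d → ℝ} (hη : ∑ i, |η i| ≤ 1) {a : (Fin d → ℝ) → ℝ}
    (ha : FreqBd (q + 2) (C * b) μ a) {e₀ : Fin k} (he₀ : (e₀ : ℕ) = n₀ % k) :
    Stage q (16 * 2 ^ q * C) τ (n₀ + 1) b (Λ * τ) (V + 8 * 2 ^ q * C * b)
      (corrV e₀ (Λ * τ) η a v) := by
  obtain ⟨hv1, hv2, hv3⟩ := hv
  have hl : 0 < Λ * τ := by positivity
  have hΛl : Λ ≤ Λ * τ := le_mul_of_one_le_right hΛ.le hτ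
  have hψ : FreqBd (q + 2) (2 * 2 ^ (q + 2) * (C * b / (Λ * τ))) (Λ * τ) (wave (Λ * τ) η a) :=
    freqBd_wave hl hη (ha.mono hμ le_rfl hμΛ)
  have hψ1 : ∀ j, FreqBd (q + 1) (8 * 2 ^ q * C * b) (Λ * τ) (pd j (wave (Λ * τ) η a)) :=
    fun j => (hψ.pd j).mono_const hl.le (le_of_eq (by field_simp; ring))
  have hpd : ∀ j, pd j (fun x => v x e₀ + wave (Λ * τ) η a x)
      = fun x => pd j (fun x => v x e₀) x + pd j (wave (Λ * τ) η a) x := fun j => by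
    funext x
    exact pd_add j ((hv1 e₀).differentiable (by simp) x)
      ((contDiff_wave ha.1).differentiable (by simp) x)
  have hpd2 : ∀ i j, pd i (pd j (fun x => v x e₀ + wave (Λ * τ) η a x))
      = fun x => pd i (pd j fun x => v x e₀) x + pd i (pd j (wave (Λ * τ) η a)) x := fun i j => by
    funext x
    rw [hpd]
    exact pd_add i ((contDiff_pd (hv1 e₀) j).differentiable (by simp) x)
      ((contDiff_pd (contDiff_wave ha.1) j).differentiable (by simp) x)
  have e0 : (fun x => corrV e₀ (Λ * τ) η a v x e₀)
      = fun x => v x e₀ + wave (Λ * τ) η a x := by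
    funext x; simp [corrV]
  have e1 : ∀ e, e ≠ e₀ → (fun x => corrV e₀ (Λ * τ) η a v x e) = fun x => v x e := by
    intro e he; funext x; simp [corrV, he]
  refine ⟨contDiff_corrV hv1 ha.1, fun r hr e he i j => ?_, fun e j => ?_⟩
  · by_cases h : e = e₀
    · subst h
      rw [e0, hpd2]
      have hr' : r + 1 = k := by
        rcases Nat.lt_or_ge (r + 1) k with h | h
        · exfalso
          rw [he₀, add_assoc] at he
          have h2 : (n₀ + 0) ≡ n₀ + (1 + r) [MOD k] := by
            rw [add_zero]; exact he
          have h3 := Nat.ModEq.add_left_cancel' n₀ h2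
          have := Nat.ModEq.eq_of_lt_of_lt h3 (by omega) (by omega)
          omega
        · omega
      have h1 := ((hv2 0 (by omega) e (by rw [he₀, add_zero]) i j).mono hΛ.le le_rfl hΛl).add
        ((hψ1 j).pd i)
      refine h1.mono_const hl.le ?_
      rw [hr']
      have h2 : τ ^ k / τ ^ k = 1 := div_self (by positivity)
      have h3 : τ ^ (0 + 1) / τ ^ k ≤ τ / 2 := by
        rw [zero_add, pow_one]; gcongr
      rw [h2]
      have h4 : 0 ≤ 16 * 2 ^ q * C * b * Λ := by positivity
      calc _ ≤ 16 * 2 ^ q * C * b * Λ * (τ / 2) + 8 * 2 ^ q * C * b * (Λ * τ) := by gcongr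
        _ = _ := by ring
    · rw [e1 e h]
      have hr' : r + 1 < k := by
        by_contra hcon
        have : r + 1 = k := by omega
        apply h
        ext
        rw [he, he₀, add_assoc, add_comm 1 r, this, Nat.add_mod_right]
      have h1 := (hv2 (r + 1) hr' e (by rw [he]; congr 1; ring) i j).mono hΛ.le le_rfl hΛl
      refine h1.mono_const hl.le (le_of_eq ?_)
      ring
  · by_cases h : e = e₀
    · subst h
      rw [e0, hpd]
      exact ((hv3 e j).mono hΛ.le le_rfl hΛl).add (hψ1 j)
    · rw [e1 e h]
      refine (hv3 e j).mono hΛ.le ?_ hΛl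
      have : 0 ≤ 8 * 2 ^ q * C * b := by positivity
      linarith

theorem exists_corrugations (hk : 1 ≤ k) (hq : 1 ≤ q) (hb : 0 ≤ b) (hτ : 1 ≤ τ)
    (hτk : 2 ≤ τ ^ k) (hC : 0 ≤ C) {μ W E X : ℝ} (hμ : 0 ≤ μ) (hΛ : 0 < Λ) (hμΛ : μ ≤ Λ * τ)
    (hE : 8 * 8 ^ q * (C * b * (16 * 2 ^ q * C * b * (1 / τ ^ k)) + (C * b * μ / (Λ * τ)) ^ 2) ≤ E)
    (hX : 8 * 8 ^ (q + 1) * (C * b * (W + C * b)) ≤ X)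
    {w : (Fin d → ℝ) → Fin d → ℝ} (hv : Stage q (16 * 2 ^ q * C) τ n₀ b Λ V v)
    (hw : ∀ j, ContDiff ℝ ∞ fun x => w x j) (n : ℕ) :
    ∀ (η : Fin n → Fin d → ℝ) (a : Fin n → (Fin d → ℝ) → ℝ), (∀ m, ∑ i, |η m i| ≤ 1) →
      (∀ m, FreqBd (q + 2) (C * b) μ (a m)) → V + n * (8 * 2 ^ q * C * b) ≤ W →
      ∃ (v' : (Fin d → ℝ) → Fin k → ℝ) (w' : (Fin d → ℝ) → Fin d → ℝ),
        Stage q (16 * 2 ^ q * C) τ (n₀ + n) b (Λ * τ ^ n) (V + n * (8 * 2 ^ q * C * b)) v' ∧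
        (∀ j, ContDiff ℝ ∞ fun x => w' x j) ∧
        (∀ e, IncBd (n * (8 * 2 ^ q * C * b)) Λ (Λ * τ ^ n) fun x => v' x e - v x e) ∧
        (∀ j, IncBd (n * X) Λ (Λ * τ ^ n) fun x => w' x j - w x j) ∧
        ∀ i j, FreqBd q (n * E) (Λ * τ ^ n) fun x => strain v' w' x i j - strain v w x i j
          - ∑ m, a m x ^ 2 * (η m i * η m j) := by
  induction n with
  | zero =>
    intro η a _ _ _
    refine ⟨v, w, by simpa using hv, hw, fun e => ?_, fun j => ?_, fun i j => ?_⟩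
    · simpa using IncBd.zero (d := d) le_rfl hΛ.le hΛ.le
    · simpa using IncBd.zero (d := d) le_rfl hΛ.le hΛ.le
    · simpa using FreqBd.zero (d := d) (m := q) le_rfl hΛ.le
  | succ n ih =>
    intro η a hη ha hVW
    have hC1 : 0 ≤ 8 * 2 ^ q * C * b := by positivity
    push_cast at hVW
    obtain ⟨v', w', h1, h2, h3, h4, h5⟩ := ih (fun m => η m.castSucc) (fun m => a m.castSucc)
      (fun m => hη _) (fun m => ha _) (by linarith)
    set e₀ : Fin k := ⟨(n₀ + n) % k, Nat.mod_lt _ hk⟩ with he₀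
    have hΛn : 0 < Λ * τ ^ n := by positivity
    have hΛle : Λ ≤ Λ * τ ^ n := le_mul_of_one_le_right hΛ.le (one_le_pow₀ hτ)
    have hl : Λ * τ ^ n * τ = Λ * τ ^ (n + 1) := by ring
    have hΛτ : Λ * τ ≤ Λ * τ ^ n * τ := mul_le_mul_of_nonneg_right hΛle (by linarith)
    have hl0 : 0 < Λ * τ ^ n * τ := by positivity
    have hnl : Λ * τ ^ n ≤ Λ * τ ^ n * τ := le_mul_of_one_le_right hΛn.le hτ
    have hμl : μ ≤ Λ * τ ^ n * τ := hμΛ.trans hΛτ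
    set η₀ := η (Fin.last n)
    set a₀ := a (Fin.last n)
    have hη₀ : ∑ i, |η₀ i| ≤ 1 := hη _
    have ha₀ : FreqBd (q + 2) (C * b) μ a₀ := ha _
    have hCb : 0 ≤ C * b := by positivity
    have hV0 : ∀ _ : Fin d, 0 ≤ V + n * (8 * 2 ^ q * C * b) := fun j => (h1.2.2 e₀ j).nonneg
    refine ⟨corrV e₀ (Λ * τ ^ n * τ) η₀ a₀ v', corrW e₀ (Λ * τ ^ n * τ) η₀ a₀ v' w', ?_,
      contDiff_corrW h1.1 h2 ha₀.1, fun e => ?_, fun j => ?_, fun i j => ?_⟩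
    · have := stage_corrV hk hb hΛn hτ hτk h1 hC hμ hμl hη₀ ha₀ (e₀ := e₀) rfl
      rw [hl] at this ⊢
      push_cast
      rwa [add_mul, one_mul, ← add_assoc, ← add_assoc]
    · have h6 := (h3 e).mono hΛ le_rfl hnl hl0.le
      have h7 : IncBd (8 * 2 ^ q * C * b) Λ (Λ * τ ^ n * τ)
          (fun x => if e = e₀ then wave (Λ * τ ^ n * τ) η₀ a₀ x else 0) := by
        by_cases h : e = e₀
        · simp only [h, if_true]
          refine FreqBd.incBd (m := q + 2) (l := Λ * τ ^ n * τ) ?_ (by omega) hC1 hΛ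
            (hΛle.trans hnl) le_rfl
          exact (freqBd_wave hl0 hη₀ (ha₀.mono hμ le_rfl hμl)).mono_const hl0.le
            (le_of_eq (by ring))
        · simp only [h, if_false]
          exact IncBd.zero hC1 hΛ.le hl0.le
      have h8 := h6.add h7
      rw [hl] at h8 ⊢
      push_cast
      rw [add_mul, one_mul]
      convert h8 using 2
      unfold corrV; ring
    · have h6 := (h4 j).mono hΛ le_rfl hnl hl0.le
      have hV' := hV0 j
      have h0 : 0 ≤ C * b * (V + n * (8 * 2 ^ q * C * b) + C * b) := by positivity
      have h7 : IncBd X Λ (Λ * τ ^ n * τ) (incW e₀ (Λ * τ ^ n * τ) η₀ a₀ v' j) := by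
        refine IncBd.mono (X := 8 * 8 ^ (q + 1)
          * (C * b * (V + n * (8 * 2 ^ q * C * b) + C * b))) ?_ hΛ ?_ le_rfl hl0.le
        · refine FreqBd.incBd (m := q + 1) (l := Λ * τ ^ n * τ) ?_ (by omega) (by positivity) hΛ
            (hΛle.trans hnl) le_rfl
          exact (freqBd_incW hμ hμl hl0 hη₀ ha₀ ((h1.2.2 e₀ j).mono hΛn.le le_rfl hnl)).mono_const
            hl0.le (le_of_eq (by ring))
        · refine le_trans ?_ hX
          gcongr
          linarith
      have h8 := h6.add h7
      rw [hl] at h8 ⊢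
      push_cast
      rw [add_mul, one_mul]
      convert h8 using 2
      unfold corrW; ring
    · have h6 := (h5 i j).mono hΛn.le le_rfl hnl
      have h7 := freqBd_corrErr (e₀ := e₀) (v := v') (i := i) (j := j) hμ hμl hl0 hη₀ ha₀
        ((h1.2.1 0 (by omega) e₀ (by simp [he₀]) i j).mono hΛn.le le_rfl hnl)
      have h7' : FreqBd q E (Λ * τ ^ n * τ) (corrErr e₀ (Λ * τ ^ n * τ) η₀ a₀ v' i j) := by
        refine h7.mono_const hl0.le (le_trans ?_ hE)
        have e1 : C * b * (16 * 2 ^ q * C * b * (Λ * τ ^ n) * (τ ^ (0 + 1) / τ ^ k))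
            / (Λ * τ ^ n * τ) = C * b * (16 * 2 ^ q * C * b * (1 / τ ^ k)) := by
          have : τ ≠ 0 := by positivity
          field_simp
          ring
        rw [e1]
        gcongr
      have h8 := h6.add h7'
      rw [hl] at h8 ⊢
      push_cast
      rw [add_mul, one_mul]
      convert h8 using 2 with x
      have h9 := strain_corr (e₀ := e₀) (l := Λ * τ ^ (n + 1)) (η := η₀) (a := a₀)
        (by positivity) h1.1 h2 ha₀.1 x i j
      rw [h9, Fin.sum_univ_castSucc]
      ring

end Stages

section Cycle

variable {d k : ℕ}

theorem IncBd.mono_left {f : (Fin d → ℝ) → ℝ} {X μ μ' Λ : ℝ} (h : IncBd X μ Λ f) (hμ : 0 < μ')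
    (hμ' : μ' ≤ μ) : IncBd X μ' Λ f := by
  have := h.nonneg
  exact ⟨h.1, fun x => ⟨(h.2 x).1.trans (by gcongr), (h.2 x).2⟩⟩

/-- The amplitudes used to cancel the error `G` after smoothing. -/
theorem exists_amplitudes {q N : ℕ} (η : Fin N → Fin d → ℝ) (L : Fin N → Fin d → Fin d → ℝ)
    (hL : ∀ M : Fin d → Fin d → ℝ, (∀ i j, M i j = M j i) → ∀ i j,
      M i j = ∑ n, (∑ a, ∑ b, L n a b * M a b) * (η n i * η n j)) :
    ∃ C r : ℝ, 1 ≤ C ∧ 0 < r ∧ ∀ {ς κ b Λ : ℝ} {G : Fin d → Fin d → (Fin d → ℝ) → ℝ},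
      2 ≤ ς → 1 ≤ κ → 0 < b → 0 < Λ → (∀ i j, G i j = G j i) →
      (∀ i j, FreqBd q (r * b ^ 2) Λ (G i j)) →
      ∃ a : Fin N → (Fin d → ℝ) → ℝ, (∀ n, FreqBd (q + 2) (C * b) (Λ * κ) (a n)) ∧
        ∀ i j, FreqBd q (2 ^ q * (r * b ^ 2) * (1 / κ) ^ q) (Λ * κ) fun x => G i j x
          + (b ^ 2 - b ^ 2 / ς ^ 2) * (∑ n, η n i * η n j) - ∑ n, a n x ^ 2 * (η n i * η n j) := by
  obtain ⟨CS, hCS1, hCS⟩ := exists_freqBd_smoothing d (q + 2) q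
  obtain ⟨CA, hCA1, hCA⟩ := FreqBd.sqrt_comp (q + 2)
  set CL : ℝ := 1 + ∑ n, ∑ a, ∑ b, |L n a b| with hCL
  have hCL1 : 1 ≤ CL := by
    have : 0 ≤ ∑ n, ∑ a, ∑ b, |L n a b| := by positivity
    linarith
  have hCLn : ∀ n, ∑ a, ∑ b, |L n a b| ≤ CL := fun n => by
    have := Finset.single_le_sum (f := fun n => ∑ a, ∑ b, |L n a b|)
      (fun n _ => by positivity) (Finset.mem_univ n)
    linarith
  refine ⟨CA, 1 / (2 * CL * CS), hCA1, by positivity, fun {ς κ b Λ G} hς hκ hb hΛ hsym hG => ?_⟩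
  set r : ℝ := 1 / (2 * CL * CS) with hr
  have hr0 : 0 < r := by positivity
  have hμ : 0 < Λ * κ := by positivity
  have hΛμ : Λ ≤ Λ * κ := le_mul_of_one_le_right hΛ.le hκ
  have hT := fun i j => hCS hμ hΛ.le hΛμ (hG i j)
  set TG : Fin d → Fin d → (Fin d → ℝ) → ℝ := fun i j => smoothing q (Λ * κ) (G i j) with hTG
  have hσ : 0 ≤ 1 / ς ^ 2 ∧ 1 / ς ^ 2 ≤ 1 / 4 := by
    refine ⟨by positivity, ?_⟩
    apply one_div_le_one_div_of_le (by norm_num); nlinarith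
  set S : Fin N → (Fin d → ℝ) → ℝ := fun n x => ∑ a, ∑ c, L n a c / b ^ 2 * TG a c x with hS
  have hSb : ∀ n, FreqBd (q + 2) (1 / 2) (Λ * κ) (S n) := fun n => by
    refine (FreqBd.sum Finset.univ hμ.le fun a _ => FreqBd.sum Finset.univ hμ.le fun c _ =>
      (hT a c).1.const_mul (L n a c / b ^ 2)).mono_const hμ.le ?_
    have e : ∀ a c, |L n a c / b ^ 2| * (CS * (r * b ^ 2)) = |L n a c| * (CS * r) := fun a c => by
      rw [abs_div, abs_of_pos (by positivity : 0 < b ^ 2)]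
      field_simp
    simp only [e, ← Finset.sum_mul]
    calc _ ≤ CL * (CS * r) := by
          have := hCLn n
          gcongr
      _ = 1 / 2 := by rw [hr]; field_simp
  have hSabs : ∀ n x, |S n x| ≤ 1 / 2 := fun n x => (hSb n).abs_le x
  set h : Fin N → (Fin d → ℝ) → ℝ := fun n x => (1 - 1 / ς ^ 2) + S n x with hh
  have hhb : ∀ n, FreqBd (q + 2) 2 (Λ * κ) (h n) := fun n => by
    refine ((FreqBd.const (K := 1) ?_ hμ.le).add (hSb n)).mono_const hμ.le (by norm_num)
    rw [abs_of_nonneg (by linarith)]; linarith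
  have hh4 : ∀ n x, 1 / 4 ≤ h n x := fun n x => by
    have := abs_le.1 (hSabs n x)
    simp only [hh]; linarith
  refine ⟨fun n x => b * √(h n x), fun n => hCA hμ.le hb.le (hhb n) (hh4 n), fun i j => ?_⟩
  have h2 := (hT i j).2
  have e1 : Λ / (Λ * κ) = 1 / κ := by field_simp
  rw [e1] at h2
  convert h2 using 2 with x
  have e2 : ∀ n, (b * √(h n x)) ^ 2
      = (b ^ 2 - b ^ 2 / ς ^ 2) + ∑ a, ∑ c, L n a c * TG a c x := fun n => by
    rw [mul_pow, Real.sq_sqrt (by linarith [hh4 n x])]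
    simp only [hh, hS, mul_add, Finset.mul_sum]
    congr 1
    · ring
    · refine Finset.sum_congr rfl fun a _ => Finset.sum_congr rfl fun c _ => ?_
      field_simp
  simp only [e2, add_mul, Finset.sum_add_distrib]
  rw [← hL (fun a c => TG a c x) (fun a c => by simp only [hTG, hsym a c]) i j, ← Finset.mul_sum]
  ring

/-- One full cycle of corrugations divides the deficit by `ς ^ 2`. -/
theorem exists_cycle {q N : ℕ} (hk : 1 ≤ k) (hq : 1 ≤ q) (hN : 1 ≤ N) (η : Fin N → Fin d → ℝ)
    (L : Fin N → Fin d → Fin d → ℝ) (hη : ∀ n, ∑ i, |η n i| ≤ 1)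
    (hL : ∀ M : Fin d → Fin d → ℝ, (∀ i j, M i j = M j i) → ∀ i j,
      M i j = ∑ n, (∑ a, ∑ b, L n a b * M a b) * (η n i * η n j)) :
    ∃ C₀ C r : ℝ, 0 < C₀ ∧ 1 ≤ C ∧ 0 < r ∧ ∀ {ς κ : ℝ}, 2 ≤ ς → 1 ≤ κ →
      C * ς ^ 2 ≤ (κ ^ 2) ^ k → C ≤ κ ^ 2 → C * ς ^ 2 ≤ κ ^ q →
      ∀ {n₀ : ℕ} {b Λ V : ℝ} {v : (Fin d → ℝ) → Fin k → ℝ} {w : (Fin d → ℝ) → Fin d → ℝ}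
        {G : Fin d → Fin d → (Fin d → ℝ) → ℝ}, 0 < b → b ≤ 1 → 0 < Λ → 1 ≤ V →
        Stage q C₀ (κ ^ 2) n₀ (b * ς) Λ V v → (∀ j, ContDiff ℝ ∞ fun x => w x j) →
        (∀ i j, G i j = G j i) → (∀ i j, FreqBd q (r * b ^ 2) Λ (G i j)) →
        ∃ (v' : (Fin d → ℝ) → Fin k → ℝ) (w' : (Fin d → ℝ) → Fin d → ℝ),
          Stage q C₀ (κ ^ 2) (n₀ + N) b (Λ * (ς * (κ ^ 2) ^ N)) (V + C * b) v' ∧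
          (∀ j, ContDiff ℝ ∞ fun x => w' x j) ∧
          (∀ e, IncBd (C * b) Λ (Λ * (ς * (κ ^ 2) ^ N)) fun x => v' x e - v x e) ∧
          (∀ j, IncBd (C * b * V) Λ (Λ * (ς * (κ ^ 2) ^ N)) fun x => w' x j - w x j) ∧
          ∀ i j, FreqBd q (r / 2 * (b ^ 2 / ς ^ 2)) (Λ * (ς * (κ ^ 2) ^ N)) fun x =>
            G i j x + (b ^ 2 - b ^ 2 / ς ^ 2) * (∑ n, η n i * η n j)
              - (strain v' w' x i j - strain v w x i j) := by
  obtain ⟨CA, r, hCA1, hr, hA⟩ := exists_amplitudes (q := q) η L hL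
  set D : ℝ := 8 * 2 ^ q * CA with hD
  set P : ℝ := 8 * 8 ^ (q + 1) * CA * (1 + N * D + CA) with hP
  set M : ℝ := 64 * 8 ^ q * CA * (2 * D) * (N + 1) / r with hM
  have hD0 : 0 ≤ D := by positivity
  have hP0 : 0 ≤ P := by positivity
  have hM0 : 0 ≤ M := by positivity
  have h2q : (1 : ℝ) ≤ 2 ^ q := one_le_pow₀ (by norm_num)
  refine ⟨16 * 2 ^ q * CA, 4 * 2 ^ q + N * D + N * P + M, r, by positivity, ?_, hr,
    fun {ς κ} hς hκ c1 c2 c3 {n₀ b Λ V v w G} hb hb1 hΛ hV hst hw hsym hG => ?_⟩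
  · have : 0 ≤ N * D + N * P + M := by positivity
    linarith
  set C : ℝ := 4 * 2 ^ q + N * D + N * P + M with hC
  have hND : 0 ≤ N * D := by positivity
  have hNP : 0 ≤ N * P := by positivity
  have hC0 : 0 ≤ C := by positivity
  have hτ : 1 ≤ κ ^ 2 := one_le_pow₀ hκ
  have hς0 : 0 < ς := by linarith
  have hς1 : 1 ≤ ς := by linarith
  have hσ4 : 4 ≤ ς ^ 2 := by nlinarith
  have hτk : 2 ≤ (κ ^ 2) ^ k := by
    refine le_trans ?_ c1
    have : 4 ≤ C := by linarith
    nlinarith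
  obtain ⟨a, ha, haG⟩ := hA hς hκ hb hΛ hsym hG
  have hΛς : 0 < Λ * ς := by positivity
  have hΛle : Λ ≤ Λ * ς := le_mul_of_one_le_right hΛ.le hς1
  have hst' : Stage q (16 * 2 ^ q * CA) (κ ^ 2) n₀ b (Λ * ς) V v := by
    refine ⟨hst.1, fun r hr e he i j => ?_, fun e j => (hst.2.2 e j).mono hΛ.le le_rfl hΛle⟩
    refine (hst.2.1 r hr e he i j).mono hΛ.le (le_of_eq ?_) hΛle
    ring
  have hμ : 0 ≤ Λ * κ := by positivity
  have hμΛ : Λ * κ ≤ Λ * ς * κ ^ 2 := by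
    calc Λ * κ = Λ * 1 * (κ * 1) := by ring
      _ ≤ Λ * ς * (κ * κ) := by gcongr
      _ = _ := by ring
  set W : ℝ := V + N * (D * b) with hW
  have hE : 8 * 8 ^ q * (CA * b * (16 * 2 ^ q * CA * b * (1 / (κ ^ 2) ^ k))
      + (CA * b * (Λ * κ) / (Λ * ς * κ ^ 2)) ^ 2) ≤ r / (4 * (N + 1)) * (b ^ 2 / ς ^ 2) := by
    have e1 : CA * b * (Λ * κ) / (Λ * ς * κ ^ 2) = CA * b / (ς * κ) := by field_simp
    rw [e1]
    have hMC : M ≤ C := by rw [hC]; linarith [show (0:ℝ) ≤ 4 * 2 ^ q by positivity]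
    have k1 : 8 * 8 ^ q * (CA * b * (16 * 2 ^ q * CA * b * (1 / (κ ^ 2) ^ k)))
        ≤ r / (8 * (N + 1)) * (b ^ 2 / ς ^ 2) := by
      have : M * ς ^ 2 ≤ (κ ^ 2) ^ k := le_trans (by gcongr) c1
      calc _ = r / (8 * (N + 1)) * b ^ 2 * (M / (κ ^ 2) ^ k) := by
            rw [hM, hD]; field_simp; ring
        _ ≤ r / (8 * (N + 1)) * b ^ 2 * (1 / ς ^ 2) := by
            refine mul_le_mul_of_nonneg_left ?_ (by positivity)
            rw [div_le_div_iff₀ (by positivity) (by positivity)]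
            linarith
        _ = _ := by ring
    have k2 : 8 * 8 ^ q * ((CA * b / (ς * κ)) ^ 2) ≤ r / (8 * (N + 1)) * (b ^ 2 / ς ^ 2) := by
      have k3 : M ≤ κ ^ 2 := hMC.trans c2
      have k4 : 64 * 8 ^ q * CA ^ 2 * (N + 1) / r ≤ M := by
        rw [hM]
        have : CA ≤ 2 * D := by rw [hD]; nlinarith
        calc 64 * 8 ^ q * CA ^ 2 * (N + 1) / r = 64 * 8 ^ q * CA * CA * (N + 1) / r := by ring
          _ ≤ _ := by gcongr
      calc _ = r / (8 * (N + 1)) * (b ^ 2 / ς ^ 2)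
            * ((64 * 8 ^ q * CA ^ 2 * (N + 1) / r) / κ ^ 2) := by field_simp; ring
        _ ≤ r / (8 * (N + 1)) * (b ^ 2 / ς ^ 2) * 1 := by
            refine mul_le_mul_of_nonneg_left ?_ (by positivity)
            rw [div_le_one (by positivity)]
            linarith
        _ = _ := by ring
    rw [mul_add]
    refine (add_le_add k1 k2).trans (le_of_eq ?_)
    field_simp
    ring
  have hX : 8 * 8 ^ (q + 1) * (CA * b * (W + CA * b)) ≤ P * b * V := by
    have e1 : W + CA * b ≤ (1 + N * D + CA) * V := by
      rw [hW]
      have k1 : N * (D * b) ≤ N * D * V := by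
        calc N * (D * b) = N * D * b := by ring
          _ ≤ N * D * V := by gcongr; linarith
      have k2 : CA * b ≤ CA * V := by gcongr; linarith
      linarith
    calc _ ≤ 8 * 8 ^ (q + 1) * (CA * b * ((1 + N * D + CA) * V)) := by gcongr
      _ = _ := by rw [hP]; ring
  obtain ⟨v', w', s1, s2, s3, s4, s5⟩ := exists_corrugations (q := q) (n₀ := n₀) (τ := κ ^ 2)
    (C := CA) (b := b) (Λ := Λ * ς) (V := V) (v := v) (w := w) (μ := Λ * κ) (W := W)
    (E := r / (4 * (N + 1)) * (b ^ 2 / ς ^ 2)) (X := P * b * V) hk hq hb.le hτ hτk (by linarith)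
    hμ hΛς hμΛ hE hX hst' hw N η a hη ha (by simp only [hW, hD]; exact le_rfl)
  have eΛ : Λ * ς * (κ ^ 2) ^ N = Λ * (ς * (κ ^ 2) ^ N) := by ring
  rw [eΛ] at s1 s3 s4 s5
  have hΛ' : 0 < Λ * (ς * (κ ^ 2) ^ N) := by positivity
  have hDb : N * (D * b) ≤ C * b := by
    rw [← mul_assoc]
    have : N * D ≤ C := by rw [hC]; linarith [show (0:ℝ) ≤ 4 * 2 ^ q by positivity]
    gcongr
  refine ⟨v', w', ⟨s1.1, s1.2.1, fun e j => (s1.2.2 e j).mono_const hΛ'.le ?_⟩, s2,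
    fun e => ((s3 e).mono hΛς ?_ le_rfl hΛ'.le).mono_left hΛ hΛle,
    fun j => ((s4 j).mono hΛς ?_ le_rfl hΛ'.le).mono_left hΛ hΛle, fun i j => ?_⟩
  · linarith
  · exact hDb
  · have : N * P ≤ C := by rw [hC]; linarith [show (0:ℝ) ≤ 4 * 2 ^ q by positivity]
    calc N * (P * b * V) = N * P * b * V := by ring
      _ ≤ _ := by gcongr
  · have hμΛ' : Λ * κ ≤ Λ * (ς * (κ ^ 2) ^ N) := by
      refine hμΛ.trans ?_
      rw [mul_assoc]
      gcongr
      exact le_self_pow₀ hτ (by omega)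
    have h := ((haG i j).mono hμ le_rfl hμΛ').sub (s5 i j)
    have h' := h.mono_const (K' := r / 2 * (b ^ 2 / ς ^ 2)) hΛ'.le ?_
    · convert h' using 2 with x
      ring
    · have k1 : 2 ^ q * (r * b ^ 2) * (1 / κ) ^ q ≤ r / 4 * (b ^ 2 / ς ^ 2) := by
        have : 4 * 2 ^ q * ς ^ 2 ≤ κ ^ q := by
          refine le_trans ?_ c3
          gcongr
          rw [hC]; linarith
        calc _ = r / 4 * b ^ 2 * (4 * 2 ^ q / κ ^ q) := by rw [div_pow, one_pow]; ring
          _ ≤ r / 4 * b ^ 2 * (1 / ς ^ 2) := by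
            refine mul_le_mul_of_nonneg_left ?_ (by positivity)
            rw [div_le_div_iff₀ (by positivity) (by positivity)]
            linarith
          _ = _ := by ring
      have k2 : N * (r / (4 * (N + 1)) * (b ^ 2 / ς ^ 2)) ≤ r / 4 * (b ^ 2 / ς ^ 2) := by
        calc _ = r / 4 * (b ^ 2 / ς ^ 2) * (N / (N + 1)) := by field_simp
          _ ≤ r / 4 * (b ^ 2 / ς ^ 2) * 1 := by
            refine mul_le_mul_of_nonneg_left ?_ (by positivity)
            rw [div_le_one (by positivity)]
            linarith
          _ = _ := by ring
      linarith

end Cycle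

/-- Choice of the decay rate `ς` of the deficit and of the frequency ratio `κ ^ 2`. -/
theorem exists_rates {N k : ℕ} (hN : 1 ≤ N) (hk : 1 ≤ k) {α β : ℝ} (hβ0 : 0 < β) (hβ1 : β ≤ 1)
    (hα0 : 0 < α) (hα1 : α < min (β / 2) (1 / (1 + 2 * N / k))) (C : ℝ) :
    ∃ ς κ : ℝ, 2 ≤ ς ∧ 1 ≤ κ ∧ C * ς ^ 2 ≤ (κ ^ 2) ^ k ∧ C ≤ κ ^ 2 ∧ C * ς ^ 2 ≤ κ ^ (4 * N) ∧
      ς ^ 2 ≤ (ς * (κ ^ 2) ^ N) ^ β ∧ (ς * (κ ^ 2) ^ N) ^ α < ς := by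
  have hN0 : (0 : ℝ) < N := by exact_mod_cast hN
  have hk0 : (0 : ℝ) < k := by exact_mod_cast hk
  have h1 : 2 / β < 1 / α := by
    have := (lt_min_iff.1 hα1).1
    rw [div_lt_div_iff₀ hβ0 hα0]; linarith
  have h2 : 1 + 2 * N / k < 1 / α := by
    have := (lt_min_iff.1 hα1).2
    rwa [lt_one_div (by positivity) hα0]
  obtain ⟨y, hy1, hy2⟩ := exists_between (max_lt h1 h2)
  obtain ⟨hyβ, hyN⟩ := max_lt_iff.1 hy1
  have hβ2 : 2 ≤ 2 / β := by rw [le_div_iff₀ hβ0]; linarith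
  set p : ℝ := (y - 1) / 2 with hp
  have hp1 : 1 / 2 < p := by rw [hp]; linarith
  have hp2 : N < p * k := by
    have : 2 * (N : ℝ) / k < 2 * p := by rw [hp]; linarith
    rw [div_lt_iff₀ hk0] at this
    linarith
  have hp0 : 0 < p := by linarith
  have key : ∀ z : ℝ, 2 < z → ∀ᶠ ς : ℝ in Filter.atTop, C * ς ^ 2 ≤ ς ^ z := fun z hz => by
    filter_upwards [(tendsto_rpow_atTop (sub_pos.2 hz)).eventually_ge_atTop C,
      Filter.eventually_gt_atTop 0] with ς h h0
    calc C * ς ^ 2 ≤ ς ^ (z - 2) * ς ^ 2 := by gcongr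
      _ = ς ^ z := by rw [← rpow_natCast, ← rpow_add h0]; norm_num
  obtain ⟨ς, c1, c2, c3, hς⟩ := ((key (p / N * 2 * k) (by
      rw [div_mul_eq_mul_div, div_mul_eq_mul_div, lt_div_iff₀ hN0]; linarith)).and
    (((tendsto_rpow_atTop (by positivity : 0 < p / N * 2)).eventually_ge_atTop C).and
    ((key (4 * p) (by linarith)).and (Filter.eventually_ge_atTop 2)))).exists
  have hς0 : 0 ≤ ς := by linarith
  have hς1 : 1 < ς := by linarith
  have e1 : (ς ^ (p / N)) ^ 2 = ς ^ (p / N * 2) := by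
    rw [rpow_mul hς0]; norm_cast
  have e2 : ς * ((ς ^ (p / N)) ^ 2) ^ N = ς ^ y := by
    rw [e1, ← rpow_mul_natCast hς0]
    nth_rewrite 1 [← rpow_one ς]
    rw [← rpow_add (by linarith)]
    congr 1
    rw [hp]; field_simp; ring
  refine ⟨ς, ς ^ (p / N), hς, one_le_rpow hς1.le (by positivity), ?_, ?_, ?_, ?_, ?_⟩
  · rwa [e1, ← rpow_mul_natCast hς0]
  · rwa [e1]
  · rw [← rpow_mul_natCast hς0]
    convert c3 using 2
    push_cast; field_simp
  · rw [e2, ← rpow_mul hς0, ← rpow_natCast]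
    refine rpow_le_rpow_of_exponent_le hς1.le ?_
    rw [div_lt_iff₀ hβ0] at hyβ
    push_cast; exact hyβ.le
  · rw [e2, ← rpow_mul hς0]
    nth_rewrite 2 [← rpow_one ς]
    rw [lt_div_iff₀ hα0] at hy2
    exact rpow_lt_rpow_of_exponent_lt hς1 hy2

section Hoelder

variable {d : ℕ} {E : Type*} [NormedAddCommGroup E] {β : ℝ} {f : (Fin d → ℝ) → E}

theorem IsHolder.of_le (hβ : 0 ≤ β) {K : ℝ} (hK : 0 ≤ K)
    (h : ∀ x y, ‖f x - f y‖ ≤ K * dist x y ^ β) : IsHolder β f := by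
  refine ⟨K.toNNReal, fun x y => ?_⟩
  rw [edist_dist, edist_dist, dist_eq_norm, Real.coe_toNNReal β hβ,
    ENNReal.ofReal_rpow_of_nonneg dist_nonneg hβ]
  change _ ≤ ENNReal.ofReal K * _
  rw [← ENNReal.ofReal_mul hK]
  exact ENNReal.ofReal_le_ofReal (h x y)

theorem IsHolder.exists_le (hβ : 0 ≤ β) (h : IsHolder β f) :
    ∃ K : ℝ, 0 ≤ K ∧ ∀ x y, ‖f x - f y‖ ≤ K * dist x y ^ β := by
  obtain ⟨C, hC⟩ := h
  refine ⟨C, C.2, fun x y => ?_⟩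
  have := hC.dist_le x y
  rwa [dist_eq_norm, Real.coe_toNNReal β hβ] at this

theorem IsHolder.continuous (hβ : 0 < β) (h : IsHolder β f) : Continuous f := by
  obtain ⟨C, hC⟩ := h
  exact hC.continuous (by simpa using hβ)

/-- Interpolation between a uniform bound and a Lipschitz bound. -/
theorem norm_sub_le_mul_rpow {X L : ℝ} (hX : 0 ≤ X) (hL : 0 ≤ L) (hβ0 : 0 ≤ β) (hβ1 : β ≤ 1)
    (h0 : ∀ x, ‖f x‖ ≤ X) (h1 : ∀ x y, ‖f x - f y‖ ≤ X * L * dist x y) (x y : Fin d → ℝ) :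
    ‖f x - f y‖ ≤ 2 * X * L ^ β * dist x y ^ β := by
  rw [mul_assoc, ← mul_rpow hL dist_nonneg]
  rcases le_total 1 (L * dist x y) with h | h
  · calc ‖f x - f y‖ ≤ ‖f x‖ + ‖f y‖ := norm_sub_le _ _
      _ ≤ 2 * X * 1 := by linarith [h0 x, h0 y]
      _ ≤ _ := by
        gcongr
        exact one_le_rpow h hβ0
  · rcases eq_or_lt_of_le (by positivity : 0 ≤ L * dist x y) with h' | h'
    · have h2 := h1 x y
      rw [mul_assoc, ← h', mul_zero] at h2
      exact h2.trans (by positivity)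
    · calc ‖f x - f y‖ ≤ X * L * dist x y := h1 x y
        _ = X * (L * dist x y) ^ (1 : ℝ) := by rw [rpow_one]; ring
        _ ≤ X * (L * dist x y) ^ β := by
          have := rpow_le_rpow_of_exponent_ge h' h hβ1
          gcongr
        _ ≤ _ := by
          have : 0 ≤ X * (L * dist x y) ^ β := by positivity
          linarith

end Hoelder

section Limit

variable {d : ℕ} {α : ℝ}

theorem lipschitz_fderiv_of_iteratedFDeriv_two {f : (Fin d → ℝ) → ℝ} {K : ℝ}
    (hf : ContDiff ℝ ∞ f) (h : ∀ x, ‖iteratedFDeriv ℝ 2 f x‖ ≤ K) (x y : Fin d → ℝ) :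
    ‖fderiv ℝ f x - fderiv ℝ f y‖ ≤ K * dist x y := by
  have h2 : ∀ x, ‖fderiv ℝ (fderiv ℝ f) x‖ ≤ K := fun x => by
    have := h x
    rwa [← norm_iteratedFDeriv_fderiv, norm_iteratedFDeriv_one] at this
  rw [dist_eq_norm]
  exact convex_univ.norm_image_sub_le_of_norm_fderiv_le
    (fun z _ => (hf.fderiv_right (m := ∞) le_rfl).differentiable (by simp) z)
    (fun z _ => h2 z) (Set.mem_univ y) (Set.mem_univ x)

theorem norm_fderiv_sub_le_mul_rpow {f : (Fin d → ℝ) → ℝ} {X μ L : ℝ} (hf : IncBd X μ L f)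
    (hL : 0 ≤ L) (hα0 : 0 ≤ α) (hα1 : α ≤ 1) (x y : Fin d → ℝ) :
    ‖fderiv ℝ f x - fderiv ℝ f y‖ ≤ 2 * X * L ^ α * dist x y ^ α :=
  norm_sub_le_mul_rpow hf.nonneg hL hα0 hα1
    (fun x => by have := (hf.2 x).2.1; rwa [norm_iteratedFDeriv_one] at this)
    (lipschitz_fderiv_of_iteratedFDeriv_two hf.1 fun x => (hf.2 x).2.2) x y

/-- A sequence whose increments decay geometrically converges in `C^{1,α}`. -/
theorem exists_limit {f : ℕ → (Fin d → ℝ) → ℝ} {X Λ₀ σ ς : ℝ} (h0 : Tame (f 0)) (hX : 0 ≤ X)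
    (hΛ : 1 ≤ Λ₀) (hς : 2 ≤ ς) (hσ : 1 ≤ σ) (hα0 : 0 < α) (hα1 : α ≤ 1) (hσς : σ ^ α < ς)
    (h : ∀ s, IncBd (X / ς ^ s) (Λ₀ * σ ^ s) (Λ₀ * σ ^ (s + 1)) fun x => f (s + 1) x - f s x) :
    ∃ g : (Fin d → ℝ) → ℝ, IsC1Holder α g ∧ (∀ x, |g x - f 0 x| ≤ 2 * X / Λ₀) ∧
      ∀ i x, Filter.Tendsto (fun s => pd i (f s) x) Filter.atTop (nhds (pd i g x)) := by
  have hς0 : 0 < ς := by linarith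
  have hΛ0 : 0 < Λ₀ := by linarith
  have hσ0 : 0 < σ := by linarith
  set u : ℕ → (Fin d → ℝ) → ℝ := fun s x => f (s + 1) x - f s x with hu
  have hgeo : Summable fun s : ℕ => X * ((1 : ℝ) / 2) ^ s :=
    (summable_geometric_two).mul_left X
  have hgeoS : ∑' s : ℕ, X * ((1 : ℝ) / 2) ^ s = 2 * X := by
    rw [tsum_mul_left, tsum_geometric_two]; ring
  have hXs : ∀ s : ℕ, X / ς ^ s ≤ X * (1 / 2) ^ s := fun s => by
    rw [div_eq_mul_one_div, ← one_div_pow]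
    gcongr
  have hu0 : ∀ s x, ‖u s x‖ ≤ X * (1 / 2) ^ s / Λ₀ := fun s x => by
    have := ((h s).2 x).1
    rw [norm_iteratedFDeriv_zero] at this
    refine this.trans ?_
    have h1 : Λ₀ ≤ Λ₀ * σ ^ s := le_mul_of_one_le_right hΛ0.le (one_le_pow₀ hσ)
    have h2 := hXs s
    gcongr
  have hu1 : ∀ s x, ‖fderiv ℝ (u s) x‖ ≤ X * (1 / 2) ^ s := fun s x => by
    have := ((h s).2 x).2.1
    rw [norm_iteratedFDeriv_one] at this
    exact this.trans (hXs s)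
  have hud : ∀ s, Differentiable ℝ (u s) := fun s => (h s).1.differentiable (by simp)
  have hS0 : ∀ x, Summable fun s => u s x := fun x =>
    Summable.of_norm_bounded (hgeo.div_const Λ₀) fun s => hu0 s x
  have hS1 : ∀ x, Summable fun s => fderiv ℝ (u s) x := fun x =>
    Summable.of_norm_bounded hgeo fun s => hu1 s x
  set T : (Fin d → ℝ) → ℝ := fun x => ∑' s, u s x with hT
  have hTC : ContDiff ℝ 1 T := by
    refine contDiff_tsum (𝕜 := ℝ) (N := 1) (v := fun _ s => X * ((1 : ℝ) / 2) ^ s)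
      (fun s => (h s).1.of_le (by exact_mod_cast le_top)) (fun _ _ => hgeo) fun k s x hk => ?_
    have hk' : k ≤ 1 := by exact_mod_cast hk
    interval_cases k
    · rw [norm_iteratedFDeriv_zero]
      exact (hu0 s x).trans (div_le_self (by positivity) hΛ)
    · rw [norm_iteratedFDeriv_one]
      exact hu1 s x
  have hTd : ∀ x, fderiv ℝ T x = ∑' s, fderiv ℝ (u s) x := fun x =>
    fderiv_tsum_apply (x₀ := 0) hgeo hud hu1 (hS0 0) x
  have hf0 : ContDiff ℝ 1 (f 0) := h0.contDiff.of_le (by exact_mod_cast le_top)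
  have hfd : ∀ s, Differentiable ℝ (f s) := fun s => by
    induction s with
    | zero => exact hf0.differentiable (by simp)
    | succ s ih =>
      have : f (s + 1) = fun x => u s x + f s x := by funext x; simp [hu]
      rw [this]
      exact (hud s).add ih
  have hgd : ∀ x, fderiv ℝ (fun x => f 0 x + T x) x = fderiv ℝ (f 0) x + fderiv ℝ T x := fun x =>
    fderiv_fun_add (hf0.differentiable (by simp) x) (hTC.differentiable (by simp) x)
  refine ⟨fun x => f 0 x + T x, ⟨hf0.add hTC, ?_⟩, fun x => ?_, fun i x => ?_⟩
  · obtain ⟨K, hK⟩ := h0 2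
    have hK0 : IncBd K 1 1 (f 0) := by
      refine ⟨hK.1, fun x => ⟨?_, ?_, ?_⟩⟩
      · simpa using hK.2 0 (by norm_num) x
      · simpa using hK.2 1 (by norm_num) x
      · simpa using hK.2 2 (by norm_num) x
    set ρ : ℝ := σ ^ α / ς with hρ
    have hρ0 : 0 ≤ ρ := by positivity
    have hρ1 : ρ < 1 := by rw [hρ, div_lt_one hς0]; exact hσς
    have hρS := summable_geometric_of_lt_one hρ0 hρ1
    set M : ℝ := 2 * X * (Λ₀ * σ) ^ α with hM
    have hinc : ∀ s x y, ‖fderiv ℝ (u s) x - fderiv ℝ (u s) y‖ ≤ M * dist x y ^ α * ρ ^ s :=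
      fun s x y => by
      refine (norm_fderiv_sub_le_mul_rpow (h s) (by positivity) hα0.le hα1 x y).trans
        (le_of_eq ?_)
      rw [hM, hρ, div_pow, pow_succ', ← mul_assoc, mul_rpow (by positivity) (by positivity),
        ← rpow_natCast (σ ^ α), ← rpow_mul hσ0.le, ← rpow_natCast σ, ← rpow_mul hσ0.le,
        mul_comm (s : ℝ) α]
      ring
    have hK00 : 0 ≤ K := hK0.nonneg
    refine IsHolder.of_le hα0.le (K := 2 * K + M * (∑' s : ℕ, ρ ^ s)) ?_ fun x y => ?_
    · have : 0 ≤ ∑' s : ℕ, ρ ^ s := tsum_nonneg fun s => by positivity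
      positivity
    · rw [hgd, hgd, hTd, hTd, add_sub_add_comm, ← (hS1 x).tsum_sub (hS1 y)]
      have h1 := norm_fderiv_sub_le_mul_rpow hK0 zero_le_one hα0.le hα1 x y
      rw [one_rpow, mul_one] at h1
      have h2 := tsum_of_norm_bounded (hρS.mul_left (M * dist x y ^ α)).hasSum
        (fun s => hinc s x y)
      rw [tsum_mul_left] at h2
      refine (norm_add_le _ _).trans ((add_le_add h1 h2).trans (le_of_eq ?_))
      ring
  · rw [add_sub_cancel_left]
    refine (tsum_of_norm_bounded (hgeo.div_const Λ₀).hasSum fun s => hu0 s x).trans (le_of_eq ?_)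
    rw [tsum_div_const, hgeoS]
  · have hsum : ∀ s, fderiv ℝ (f s) x
        = fderiv ℝ (f 0) x + ∑ n ∈ Finset.range s, fderiv ℝ (u n) x := fun s => by
      have : ∀ n, fderiv ℝ (u n) x = fderiv ℝ (f (n + 1)) x - fderiv ℝ (f n) x := fun n =>
        fderiv_fun_sub (hfd _ x) (hfd _ x)
      simp only [this, Finset.sum_range_sub (fun n => fderiv ℝ (f n) x)]
      abel
    have h1 := (hS1 x).hasSum.tendsto_sum_nat.const_add (fderiv ℝ (f 0) x)
    simp only [← hsum] at h1
    rw [← hTd, ← hgd] at h1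
    exact ((ContinuousLinearMap.apply ℝ ℝ (Pi.single i (1 : ℝ))).continuous.tendsto _).comp h1

end Limit

section Iteration

variable {d k : ℕ}

theorem exists_seq {S : Type*} {P : ℕ → S → Prop} {R : ℕ → S → S → Prop} {x₀ : S} (h0 : P 0 x₀)
    (h : ∀ s x, P s x → ∃ y, P (s + 1) y ∧ R s x y) :
    ∃ u : ℕ → S, u 0 = x₀ ∧ ∀ s, P s (u s) ∧ R s (u s) (u (s + 1)) := by
  choose! F hF using h
  set u : ℕ → S := fun s => Nat.rec x₀ F s with hu
  have hP : ∀ s, P s (u s) := fun s => by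
    induction s with
    | zero => exact h0
    | succ s ih => exact (hF s _ ih).1
  exact ⟨u, rfl, fun s => ⟨hP s, (hF s _ (hP s)).2⟩⟩

theorem strain_symm (v : (Fin d → ℝ) → Fin k → ℝ) (w : (Fin d → ℝ) → Fin d → ℝ) (x : Fin d → ℝ)
    (i j : Fin d) : strain v w x i j = strain v w x j i := by
  simp only [strain, gradTgrad, symGrad, mul_comm, add_comm]

theorem abs_moll_sub_le {l K : ℝ} {f : (Fin d → ℝ) → ℝ} (hl : 0 < l) (hf : Continuous f)
    (h : ∀ x y, dist y x ≤ l → |f y - f x| ≤ K) (x : Fin d → ℝ) : |moll l f x - f x| ≤ K :=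
  norm_moll_sub_le hl hf fun y hy => h x y hy

/-- Tame maps are in the initial state of the iteration at all large frequencies. -/
theorem exists_stage {q : ℕ} {C τ b : ℝ} (hC : 0 < C) (hτ : 1 ≤ τ) (hb : 0 < b)
    {v : (Fin d → ℝ) → Fin k → ℝ} (hv : ∀ e, Tame fun x => v x e) :
    ∃ V : ℝ, 1 ≤ V ∧ ∀ᶠ Λ in Filter.atTop, Stage q C τ 0 b Λ V v := by
  choose K₁ hK₁ using fun (e : Fin k) (j : Fin d) => ((hv e).pd j).freqBd (q + 1)
  choose K₂ hK₂ using fun (e : Fin k) (i j : Fin d) => (((hv e).pd j).pd i).freqBd q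
  have hK₁0 : ∀ e j, 0 ≤ K₁ e j := fun e j => (hK₁ e j 1 le_rfl).nonneg
  have hK₂0 : ∀ e i j, 0 ≤ K₂ e i j := fun e i j => (hK₂ e i j 1 le_rfl).nonneg
  set V : ℝ := 1 + ∑ e, ∑ j, K₁ e j with hV
  set W : ℝ := ∑ e, ∑ i, ∑ j, K₂ e i j with hW
  have hV1 : 1 ≤ V := by
    have : 0 ≤ ∑ e, ∑ j, K₁ e j := Finset.sum_nonneg fun e _ => Finset.sum_nonneg fun j _ => hK₁0 e j
    linarith
  have hVle : ∀ e j, K₁ e j ≤ V := fun e j => by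
    have h1 := Finset.single_le_sum (f := fun j => K₁ e j) (fun j _ => hK₁0 e j) (Finset.mem_univ j)
    have h2 := Finset.single_le_sum (f := fun e => ∑ j, K₁ e j)
      (fun e _ => Finset.sum_nonneg fun j _ => hK₁0 e j) (Finset.mem_univ e)
    linarith
  have hWle : ∀ e i j, K₂ e i j ≤ W := fun e i j => by
    have h1 := Finset.single_le_sum (f := fun j => K₂ e i j) (fun j _ => hK₂0 e i j)
      (Finset.mem_univ j)
    have h2 := Finset.single_le_sum (f := fun i => ∑ j, K₂ e i j)
      (fun i _ => Finset.sum_nonneg fun j _ => hK₂0 e i j) (Finset.mem_univ i)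
    have h3 := Finset.single_le_sum (f := fun e => ∑ i, ∑ j, K₂ e i j)
      (fun e _ => Finset.sum_nonneg fun i _ => Finset.sum_nonneg fun j _ => hK₂0 e i j)
      (Finset.mem_univ e)
    linarith
  have hτ0 : 0 < τ := by linarith
  refine ⟨V, hV1, ?_⟩
  filter_upwards [Filter.eventually_ge_atTop 1, Filter.eventually_ge_atTop (W * τ ^ k / (C * b))]
    with Λ h1 h2
  have hΛ : 0 ≤ Λ := by linarith
  refine ⟨fun e => (hv e).contDiff, fun r _ e _ i j => (hK₂ e i j Λ h1).mono_const hΛ ?_,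
    fun e j => (hK₁ e j Λ h1).mono_const hΛ (hVle e j)⟩
  have hr1 : 1 ≤ τ ^ (r + 1) := one_le_pow₀ hτ
  rw [div_le_iff₀ (by positivity)] at h2
  calc K₂ e i j ≤ W := hWle e i j
    _ ≤ C * b * Λ * (1 / τ ^ k) := by
      rw [mul_one_div, le_div_iff₀ (by positivity)]
      linarith
    _ ≤ _ := by gcongr

variable {α β : ℝ}

set_option maxHeartbeats 1000000 in
/-- Convex integration on `ℝ^d`, starting from a deficit close to a small multiple of
`∑ n, η n ⊗ η n`. -/
theorem exists_strain_eq {N : ℕ} (hk : 1 ≤ k) (hN : 1 ≤ N) (η : Fin N → Fin d → ℝ)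
    (L : Fin N → Fin d → Fin d → ℝ) (hη : ∀ n, ∑ i, |η n i| ≤ 1)
    (hL : ∀ M : Fin d → Fin d → ℝ, (∀ i j, M i j = M j i) → ∀ i j,
      M i j = ∑ n, (∑ a, ∑ b, L n a b * M a b) * (η n i * η n j))
    (hβ0 : 0 < β) (hβ1 : β ≤ 1) (hα0 : 0 < α)
    (hα1 : α < min (β / 2) (1 / (1 + 2 * N / k))) :
    ∃ ρ : ℝ, 0 < ρ ∧ ∀ {b ε : ℝ} {v₀ : (Fin d → ℝ) → Fin k → ℝ} {w₀ : (Fin d → ℝ) → Fin d → ℝ}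
      {F : Fin d → Fin d → (Fin d → ℝ) → ℝ}, 0 < b → b ≤ 1 → 0 < ε →
      (∀ e, Tame fun x => v₀ x e) → (∀ j, Tame fun x => w₀ x j) → (∀ i j, F i j = F j i) →
      (∀ i j, IsHolder β (F i j)) → (∀ i j x, |F i j x| ≤ ρ * b ^ 2) →
      ∃ (v : (Fin d → ℝ) → Fin k → ℝ) (w : (Fin d → ℝ) → Fin d → ℝ),
        (∀ e, IsC1Holder α fun x => v x e) ∧ (∀ j, IsC1Holder α fun x => w x j) ∧
        (∀ x e, |v x e - v₀ x e| ≤ ε) ∧ (∀ x j, |w x j - w₀ x j| ≤ ε) ∧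
        ∀ x i j, strain v w x i j
          = strain v₀ w₀ x i j + b ^ 2 * (∑ n, η n i * η n j) + F i j x := by
  obtain ⟨C₀, C, r, hC₀, hC1, hr, hcyc⟩ := exists_cycle (d := d) (k := k) (q := 4 * N) hk
    (by omega) hN η L hη hL
  obtain ⟨ς, κ, hς, hκ, p1, p2, p3, p4, p5⟩ := exists_rates hN hk hβ0 hβ1 hα0 hα1 C
  obtain ⟨M₁, hM₁, hmoll⟩ := exists_freqBd_moll d (4 * N)
  obtain ⟨M₂, hM₂, hinc⟩ := exists_freqBd_moll_sub_moll d (4 * N)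
  set σ : ℝ := ς * (κ ^ 2) ^ N with hσ
  have hς0 : 0 < ς := by linarith
  have hτ : 1 ≤ κ ^ 2 := one_le_pow₀ hκ
  have hσ1 : 1 ≤ σ := by
    have : 1 ≤ (κ ^ 2) ^ N := one_le_pow₀ hτ
    rw [hσ]; nlinarith
  have hσ0 : 0 < σ := by linarith
  have hα1' : α ≤ 1 := by
    have := (lt_min_iff.1 hα1).1
    linarith
  refine ⟨r / M₁, by positivity, fun {b ε v₀ w₀ F} hb hb1 hε hv₀ hw₀ hFs hFh hFb => ?_⟩
  obtain ⟨V₀, hV₀, hstage⟩ := exists_stage (q := 4 * N) hC₀ hτ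
    (by positivity : 0 < b * ς) hv₀
  choose K hK0 hK using fun i j => IsHolder.exists_le hβ0.le (hFh i j)
  set Km : ℝ := ∑ i, ∑ j, K i j with hKm
  have hKm0 : 0 ≤ Km := Finset.sum_nonneg fun i _ => Finset.sum_nonneg fun j _ => hK0 i j
  have hKle : ∀ i j, K i j ≤ Km := fun i j => by
    have h1 := Finset.single_le_sum (f := fun j => K i j) (fun j _ => hK0 i j) (Finset.mem_univ j)
    have h2 := Finset.single_le_sum (f := fun i => ∑ j, K i j)
      (fun i _ => Finset.sum_nonneg fun j _ => hK0 i j) (Finset.mem_univ i)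
    linarith
  have hFc : ∀ i j, Continuous (F i j) := fun i j => IsHolder.continuous hβ0 (hFh i j)
  have hFosc : ∀ i j {l : ℝ}, 0 < l → ∀ x y, dist y x ≤ l → |F i j y - F i j x| ≤ Km * l ^ β :=
    fun i j l hl x y hxy => by
    refine (hK i j y x).trans ?_
    have h1 := hKle i j
    have h2 := hK0 i j
    gcongr
  set V₁ : ℝ := V₀ + 2 * C * b with hV₁
  have hV₁1 : 1 ≤ V₁ := by
    have : 0 ≤ 2 * C * b := by positivity
    linarith
  obtain ⟨Λ₀, hst0, hΛ1, hΛβ, hΛv, hΛw⟩ := (hstage.and ((Filter.eventually_ge_atTop 1).and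
    (((tendsto_rpow_atTop hβ0).eventually_ge_atTop (2 * M₂ * Km * ς ^ 2 / (r * b ^ 2))).and
    ((Filter.eventually_ge_atTop (2 * (C * b) / ε)).and
      (Filter.eventually_ge_atTop (2 * (C * b * V₁) / ε)))))).exists
  have hΛ0 : 0 < Λ₀ := by linarith
  set Λ : ℕ → ℝ := fun s => Λ₀ * σ ^ s with hΛ
  set B : ℕ → ℝ := fun s => b / ς ^ s with hB
  have hΛpos : ∀ s, 0 < Λ s := fun s => by positivity
  have hBpos : ∀ s, 0 < B s := fun s => by positivity
  have hBle : ∀ s, B s ≤ b := fun s => div_le_self hb.le (one_le_pow₀ (by linarith))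
  have hBs : ∀ s, B s = B (s + 1) * ς := fun s => by
    simp only [hB, pow_succ]; field_simp
  have hΛs : ∀ s, Λ (s + 1) = Λ s * σ := fun s => by
    simp only [hΛ, pow_succ]; ring
  have hosc : ∀ s, M₂ * (Km * (Λ s)⁻¹ ^ β) ≤ r / 2 * (B s ^ 2 / ς ^ 2) := fun s => by
    rw [div_le_iff₀ (by positivity)] at hΛβ
    have h1 : ς ^ (2 * s) ≤ (σ ^ s) ^ β := by
      rw [pow_mul, ← rpow_natCast σ, ← rpow_mul hσ0.le, mul_comm, rpow_mul hσ0.le, rpow_natCast]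
      exact pow_le_pow_left₀ (by positivity) p4 s
    have h2 : M₂ * Km * (2 * ς ^ 2 * ς ^ (2 * s)) ≤ r * b ^ 2 * (Λ s) ^ β := by
      simp only [hΛ]
      rw [mul_rpow hΛ0.le (by positivity)]
      calc _ = (2 * M₂ * Km * ς ^ 2) * ς ^ (2 * s) := by ring
        _ ≤ (Λ₀ ^ β * (r * b ^ 2)) * (σ ^ s) ^ β := by gcongr
        _ = _ := by ring
    rw [inv_rpow (hΛpos s).le]
    have h3 : 0 < (Λ s) ^ β := rpow_pos_of_pos (hΛpos s) _
    simp only [hB]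
    rw [← div_eq_mul_inv, ← mul_div_assoc, div_le_iff₀ h3]
    calc M₂ * Km = M₂ * Km * (2 * ς ^ 2 * ς ^ (2 * s)) / (2 * ς ^ 2 * ς ^ (2 * s)) := by
          field_simp
      _ ≤ r * b ^ 2 * (Λ s) ^ β / (2 * ς ^ 2 * ς ^ (2 * s)) := by gcongr
      _ = _ := by
        rw [pow_mul, ← pow_mul, mul_comm 2 s, pow_mul]
        field_simp
  set G : ℕ → ((Fin d → ℝ) → Fin k → ℝ) → ((Fin d → ℝ) → Fin d → ℝ) → Fin d → Fin d →
      (Fin d → ℝ) → ℝ := fun s v w i j x => moll (Λ s)⁻¹ (F i j) x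
    + (b ^ 2 - B s ^ 2) * (∑ n, η n i * η n j) + (strain v₀ w₀ x i j - strain v w x i j) with hG
  let P : ℕ → ((Fin d → ℝ) → Fin k → ℝ) × ((Fin d → ℝ) → Fin d → ℝ) → Prop := fun s p =>
    Stage (4 * N) C₀ (κ ^ 2) (N * s) (B s * ς) (Λ s) (V₀ + 2 * C * (b - B s)) p.1 ∧
      (∀ j, ContDiff ℝ ∞ fun x => p.2 x j) ∧
      ∀ i j, FreqBd (4 * N) (r * B s ^ 2) (Λ s) (G s p.1 p.2 i j)
  let R : ℕ → ((Fin d → ℝ) → Fin k → ℝ) × ((Fin d → ℝ) → Fin d → ℝ) →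
      ((Fin d → ℝ) → Fin k → ℝ) × ((Fin d → ℝ) → Fin d → ℝ) → Prop := fun s p p' =>
    (∀ e, IncBd (C * B s) (Λ s) (Λ (s + 1)) fun x => p'.1 x e - p.1 x e) ∧
      ∀ j, IncBd (C * B s * V₁) (Λ s) (Λ (s + 1)) fun x => p'.2 x j - p.2 x j
  have hP0 : P 0 (v₀, w₀) := by
    refine ⟨?_, fun j => (hw₀ j).contDiff, fun i j => ?_⟩
    · simpa [hB, hΛ] using hst0
    · have h1 := hmoll (inv_pos.2 hΛ0) (hFc i j) (hFb i j)
      rw [inv_inv] at h1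
      have e1 : M₁ * (r / M₁ * b ^ 2) = r * b ^ 2 := by field_simp
      rw [e1] at h1
      simpa [hG, hΛ, hB] using h1
  have hPR : ∀ s p, P s p → ∃ p', P (s + 1) p' ∧ R s p p' := by
    rintro s ⟨v, w⟩ ⟨a1, a2, a3⟩
    simp only at a1 a2 a3
    have hV : 1 ≤ V₀ + 2 * C * (b - B s) := by
      have := mul_nonneg (by positivity : 0 ≤ 2 * C) (sub_nonneg.2 (hBle s))
      linarith
    obtain ⟨v', w', c1, c2, c3, c4, c5⟩ := hcyc hς hκ p1 p2 p3 (hBpos s) ((hBle s).trans hb1)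
      (hΛpos s) hV a1 a2 (fun i j => by
        funext x
        simp only [hG, hFs i j, strain_symm _ _ x i j, mul_comm]) a3
    rw [← hσ, ← hΛs] at c1 c3 c4 c5
    have hΛn := (hΛpos (s + 1)).le
    refine ⟨(v', w'), ⟨?_, c2, fun i j => ?_⟩, c3, fun j => (c4 j).mono (hΛpos s) ?_ le_rfl hΛn⟩
    · rw [← hBs, Nat.mul_succ]
      refine ⟨c1.1, c1.2.1, fun e j => (c1.2.2 e j).mono_const hΛn ?_⟩
      have h1 : 2 * B (s + 1) ≤ B s := by
        rw [hBs s]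
        have := (hBpos (s + 1)).le
        nlinarith
      nlinarith
    · have h1 := hinc (l := (Λ s)⁻¹) (l' := (Λ (s + 1))⁻¹) (inv_pos.2 (hΛpos _))
        (inv_anti₀ (hΛpos s) (by rw [hΛs]; exact le_mul_of_one_le_right (hΛpos s).le hσ1))
        (hFc i j) (hFosc i j (inv_pos.2 (hΛpos s)))
      rw [inv_inv] at h1
      have h2 := (c5 i j).add (h1.mono_const hΛn (hosc s))
      have e2 : B s ^ 2 / ς ^ 2 = B (s + 1) ^ 2 := by
        rw [hBs s]; field_simp
      rw [e2] at h2
      have e3 : r / 2 * B (s + 1) ^ 2 + r / 2 * B (s + 1) ^ 2 = r * B (s + 1) ^ 2 := by ring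
      rw [e3] at h2
      convert h2 using 2 with x
      simp only [hG]
      ring
    · have h1 : V₀ + 2 * C * (b - B s) ≤ V₁ := by
        have := mul_nonneg (by positivity : 0 ≤ 2 * C) (hBpos s).le
        rw [hV₁]; linarith
      have := hBpos s
      gcongr
  obtain ⟨u, hu0, hu⟩ := exists_seq hP0 hPR
  have hconvV : ∀ e, ∃ g : (Fin d → ℝ) → ℝ, IsC1Holder α g ∧ (∀ x, |g x - v₀ x e| ≤ ε) ∧
      ∀ i x, Filter.Tendsto (fun s => pd i (fun y => (u s).1 y e) x) Filter.atTop
        (nhds (pd i g x)) := fun e => by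
    obtain ⟨g, g1, g2, g3⟩ := exists_limit (f := fun s y => (u s).1 y e) (X := C * b) (Λ₀ := Λ₀)
      (σ := σ) (ς := ς) (α := α) (by rw [hu0]; exact hv₀ e) (by positivity) hΛ1 hς hσ1 hα0 hα1' p5
      fun s => by
        have := (hu s).2.1 e
        rwa [← mul_div_assoc] at this
    refine ⟨g, g1, fun x => ?_, g3⟩
    have := g2 x
    rw [hu0] at this
    refine this.trans ?_
    rw [div_le_iff₀ hε] at hΛv
    rw [div_le_iff₀ hΛ0]
    linarith
  have hconvW : ∀ j, ∃ g : (Fin d → ℝ) → ℝ, IsC1Holder α g ∧ (∀ x, |g x - w₀ x j| ≤ ε) ∧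
      ∀ i x, Filter.Tendsto (fun s => pd i (fun y => (u s).2 y j) x) Filter.atTop
        (nhds (pd i g x)) := fun j => by
    obtain ⟨g, g1, g2, g3⟩ := exists_limit (f := fun s y => (u s).2 y j) (X := C * b * V₁)
      (Λ₀ := Λ₀) (σ := σ) (ς := ς) (α := α) (by rw [hu0]; exact hw₀ j) (by positivity) hΛ1 hς hσ1
      hα0 hα1' p5 fun s => by
        have := (hu s).2.2 j
        have e1 : C * B s * V₁ = C * b * V₁ / ς ^ s := by simp only [hB]; ring
        rwa [e1] at this
    refine ⟨g, g1, fun x => ?_, g3⟩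
    have := g2 x
    rw [hu0] at this
    refine this.trans ?_
    rw [div_le_iff₀ hε] at hΛw
    rw [div_le_iff₀ hΛ0]
    linarith
  choose gv gv1 gv2 gv3 using hconvV
  choose gw gw1 gw2 gw3 using hconvW
  refine ⟨fun x e => gv e x, fun x j => gw j x, gv1, gw1, fun x e => gv2 e x, fun x j => gw2 j x,
    fun x i j => ?_⟩
  have hlim : Filter.Tendsto (fun s => strain (u s).1 (u s).2 x i j) Filter.atTop
      (nhds (strain (fun x e => gv e x) (fun x j => gw j x) x i j)) := by
    simp only [strain, gradTgrad, symGrad]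
    exact ((tendsto_finsetSum _ fun e _ => (gv3 e i x).mul (gv3 e j x)).const_mul _).add
      (((gw3 j i x).add (gw3 i j x)).div_const _)
  refine tendsto_nhds_unique hlim ?_
  set Hij : ℝ := ∑ n, η n i * η n j with hHij
  rw [tendsto_iff_dist_tendsto_zero]
  have hB0 : Filter.Tendsto (fun s => B s ^ 2 * (|Hij| + 2 * r)) Filter.atTop (nhds 0) := by
    have h1 : Filter.Tendsto B Filter.atTop (nhds 0) := by
      simp only [hB]
      exact (tendsto_pow_atTop_atTop_of_one_lt (by linarith)).const_div_atTop b
    simpa using (h1.pow 2).mul_const (|Hij| + 2 * r)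
  refine squeeze_zero (fun _ => dist_nonneg) (fun s => ?_) hB0
  have h1 := ((hu s).1.2.2 i j).abs_le x
  have h2 := abs_moll_sub_le (inv_pos.2 (hΛpos s)) (hFc i j)
    (hFosc i j (inv_pos.2 (hΛpos s))) x
  have h3 : Km * (Λ s)⁻¹ ^ β ≤ r * B s ^ 2 := by
    have h4 : 0 ≤ Km * (Λ s)⁻¹ ^ β := by
      have := hΛpos s
      positivity
    have h5 : B s ^ 2 / ς ^ 2 ≤ B s ^ 2 := div_le_self (by positivity) (by nlinarith)
    have h6 : r / 2 * (B s ^ 2 / ς ^ 2) ≤ r * B s ^ 2 := by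
      have : 0 ≤ B s ^ 2 / ς ^ 2 := by positivity
      nlinarith
    have := hosc s
    nlinarith
  have e1 : strain (u s).1 (u s).2 x i j - (strain v₀ w₀ x i j + b ^ 2 * Hij + F i j x)
      = (moll (Λ s)⁻¹ (F i j) x - F i j x) - G s (u s).1 (u s).2 i j x - B s ^ 2 * Hij := by
    simp only [hG]; ring
  rw [dist_eq_norm, e1, Real.norm_eq_abs]
  have h7 : |B s ^ 2 * Hij| = B s ^ 2 * |Hij| := by
    rw [abs_mul, abs_of_nonneg (by positivity : 0 ≤ B s ^ 2)]
  have h8 := abs_sub ((moll (Λ s)⁻¹ (F i j) x - F i j x) - G s (u s).1 (u s).2 i j x)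
    (B s ^ 2 * Hij)
  have h9 := abs_sub (moll (Λ s)⁻¹ (F i j) x - F i j x) (G s (u s).1 (u s).2 i j x)
  linarith

end Iteration

section Approximation

variable {d k : ℕ} {K : Set (Fin d → ℝ)} {f : (Fin d → ℝ) → ℝ} {δ : ℝ}

theorem exists_cutoff (hK : IsCompact K) : ∃ χ : (Fin d → ℝ) → ℝ, ContDiff ℝ ∞ χ ∧
    HasCompactSupport χ ∧ ∀ x ∈ K, χ =ᶠ[nhds x] 1 := by
  obtain ⟨R, hR, hKR⟩ := hK.isBounded.subset_ball_lt 0 0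
  let φ : ContDiffBump (0 : Fin d → ℝ) := ⟨R, R + 1, hR, by linarith⟩
  exact ⟨φ, φ.contDiff, φ.hasCompactSupport, fun x hx => φ.eventuallyEq_one_of_mem_ball (hKR hx)⟩

theorem exists_norm_moll_sub_le {F : Type*} [NormedAddCommGroup F] [NormedSpace ℝ F]
    [CompleteSpace F] {f : (Fin d → ℝ) → F} (hf : Continuous f) (hs : HasCompactSupport f)
    (hδ : 0 < δ) : ∃ l₀ : ℝ, 0 < l₀ ∧ ∀ l, 0 < l → l ≤ l₀ → ∀ x, ‖moll l f x - f x‖ ≤ δ := by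
  obtain ⟨l₀, hl₀, h⟩ := Metric.uniformContinuous_iff.1 (hs.uniformContinuous_of_continuous hf) δ hδ
  refine ⟨l₀ / 2, by positivity, fun l hl hll x => norm_moll_sub_le hl hf fun y hy => ?_⟩
  rw [← dist_eq_norm]
  exact (h (by linarith)).le

theorem exists_tame_approx (hK : IsCompact K) (hf : Continuous f) (hδ : 0 < δ) :
    ∃ g, Tame g ∧ ∀ x ∈ K, |g x - f x| ≤ δ := by
  obtain ⟨χ, hχ, hχs, hχ1⟩ := exists_cutoff hK
  have hc : Continuous fun x => χ x * f x := hχ.continuous.mul hf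
  have hs : HasCompactSupport fun x => χ x * f x := hχs.mul_right
  obtain ⟨l, hl, h⟩ := exists_norm_moll_sub_le hc hs hδ
  refine ⟨moll l fun x => χ x * f x, Tame.of_hasCompactSupport (contDiff_moll hc)
    (hasCompactSupport_moll hl hs), fun x hx => ?_⟩
  have h1 := h l hl le_rfl x
  rwa [show χ x = 1 from (hχ1 x hx).eq_of_nhds, one_mul] at h1

theorem exists_tame_approx_one (hK : IsCompact K) (hf : ContDiff ℝ 1 f) (hδ : 0 < δ) :
    ∃ g, Tame g ∧ ∀ x ∈ K, |g x - f x| ≤ δ ∧ ∀ i, |pd i g x - pd i f x| ≤ δ := by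
  obtain ⟨χ, hχ, hχs, hχ1⟩ := exists_cutoff hK
  have hc : ContDiff ℝ 1 fun x => χ x * f x := (hχ.of_le (by exact_mod_cast le_top)).mul hf
  have hs : HasCompactSupport fun x => χ x * f x := hχs.mul_right
  obtain ⟨l₁, hl₁, h1⟩ := exists_norm_moll_sub_le hc.continuous hs hδ
  obtain ⟨l₂, hl₂, h2⟩ := exists_norm_moll_sub_le (hc.continuous_fderiv (by simp))
    (hs.fderiv (𝕜 := ℝ)) hδ
  have hl : 0 < min l₁ l₂ := lt_min hl₁ hl₂
  refine ⟨moll (min l₁ l₂) fun x => χ x * f x,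
    Tame.of_hasCompactSupport (contDiff_moll hc.continuous) (hasCompactSupport_moll hl hs),
    fun x hx => ?_⟩
  have he : (fun x => χ x * f x) =ᶠ[nhds x] f := by
    filter_upwards [hχ1 x hx] with y hy
    rw [hy, Pi.one_apply, one_mul]
  have h3 := h1 _ hl (min_le_left _ _) x
  have h4 := h2 _ hl (min_le_right _ _) x
  rw [← fderiv_moll hl hc, he.fderiv_eq] at h4
  rw [show χ x * f x = f x from he.eq_of_nhds] at h3
  refine ⟨h3, fun i => ?_⟩
  have h5 := (fderiv ℝ (moll (min l₁ l₂) fun x => χ x * f x) x - fderiv ℝ f x).le_opNorm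
    (Pi.single i (1 : ℝ))
  rw [Pi.norm_single, norm_one, mul_one] at h5
  exact h5.trans h4

theorem continuous_pd (hf : ContDiff ℝ 1 f) (i : Fin d) : Continuous (pd i f) :=
  (hf.continuous_fderiv (by simp)).clm_apply continuous_const

theorem exists_abs_le (hK : IsCompact K) (hf : Continuous f) : ∃ M, 0 ≤ M ∧ ∀ x ∈ K, |f x| ≤ M := by
  obtain ⟨M, hM⟩ := hK.exists_bound_of_continuousOn hf.continuousOn
  exact ⟨max M 0, le_max_right _ _, fun x hx => (hM x hx).trans (le_max_left _ _)⟩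

theorem exists_square_approx (hK : IsCompact K) (hf : Continuous f) (hf0 : ∀ x, 0 ≤ f x)
    (hδ : 0 < δ) : ∃ a, Tame a ∧ ∀ x ∈ K, |a x ^ 2 - f x| ≤ δ := by
  have hc : Continuous fun x => √(f x) := hf.sqrt
  obtain ⟨M, hM0, hM⟩ := exists_abs_le hK hc
  set δ' : ℝ := min 1 (δ / (2 * M + 1)) with hδ'
  have hδ'0 : 0 < δ' := by positivity
  obtain ⟨a, ha, h⟩ := exists_tame_approx hK hc hδ'0
  refine ⟨a, ha, fun x hx => ?_⟩
  have e : a x ^ 2 - f x = (a x - √(f x)) * ((a x - √(f x)) + 2 * √(f x)) := by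
    have := Real.sq_sqrt (hf0 x)
    nlinarith
  have h1 := h x hx
  have h2 : |(a x - √(f x)) + 2 * √(f x)| ≤ 2 * M + 1 := by
    have h3 := abs_add_le (a x - √(f x)) (2 * √(f x))
    have h4 := hM x hx
    have h5 : δ' ≤ 1 := min_le_left _ _
    rw [abs_mul, abs_two] at h3
    linarith
  rw [e, abs_mul]
  calc _ ≤ δ' * (2 * M + 1) := by gcongr
    _ ≤ δ / (2 * M + 1) * (2 * M + 1) := by
      gcongr
      exact min_le_right _ _
    _ = δ := by field_simp

theorem exists_tame_strain (hK : IsCompact K) {v : (Fin d → ℝ) → Fin k → ℝ}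
    {w : (Fin d → ℝ) → Fin d → ℝ} (hv : ∀ e, ContDiff ℝ 1 fun x => v x e)
    (hw : ∀ j, ContDiff ℝ 1 fun x => w x j) (hδ : 0 < δ) :
    ∃ (v' : (Fin d → ℝ) → Fin k → ℝ) (w' : (Fin d → ℝ) → Fin d → ℝ),
      (∀ e, Tame fun x => v' x e) ∧ (∀ j, Tame fun x => w' x j) ∧
      (∀ x ∈ K, ∀ e, |v' x e - v x e| ≤ δ) ∧ (∀ x ∈ K, ∀ j, |w' x j - w x j| ≤ δ) ∧
      ∀ x ∈ K, ∀ i j, |strain v' w' x i j - strain v w x i j| ≤ δ := by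
  choose M hM0 hM using fun (e : Fin k) (i : Fin d) => exists_abs_le hK (continuous_pd (hv e) i)
  set Mm : ℝ := ∑ e, ∑ i, M e i with hMm
  have hMm0 : 0 ≤ Mm := Finset.sum_nonneg fun e _ => Finset.sum_nonneg fun i _ => hM0 e i
  have hMle : ∀ e i, M e i ≤ Mm := fun e i => by
    have h1 := Finset.single_le_sum (f := fun i => M e i) (fun i _ => hM0 e i) (Finset.mem_univ i)
    have h2 := Finset.single_le_sum (f := fun e => ∑ i, M e i)
      (fun e _ => Finset.sum_nonneg fun i _ => hM0 e i) (Finset.mem_univ e)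
    linarith
  set κ : ℝ := min (min 1 δ) (δ / (k * (2 * Mm + 1) + 1)) with hκ
  have hκ0 : 0 < κ := by positivity
  have hκ1 : κ ≤ 1 := (min_le_left _ _).trans (min_le_left _ _)
  have hκδ : κ ≤ δ := (min_le_left _ _).trans (min_le_right _ _)
  choose gv gv1 gv2 using fun e => exists_tame_approx_one hK (hv e) hκ0
  choose gw gw1 gw2 using fun j => exists_tame_approx_one hK (hw j) hκ0
  refine ⟨fun x e => gv e x, fun x j => gw j x, gv1, gw1, fun x hx e => ((gv2 e x hx).1).trans hκδ,
    fun x hx j => ((gw2 j x hx).1).trans hκδ, fun x hx i j => ?_⟩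
  have hprod : ∀ e, |pd i (gv e) x * pd j (gv e) x
      - pd i (fun y => v y e) x * pd j (fun y => v y e) x| ≤ κ * (2 * Mm + 1) := fun e => by
    set p := pd i (gv e) x
    set q := pd j (gv e) x
    set p' := pd i (fun y => v y e) x
    set q' := pd j (fun y => v y e) x
    have h1 : |p - p'| ≤ κ := (gv2 e x hx).2 i
    have h2 : |q - q'| ≤ κ := (gv2 e x hx).2 j
    have h3 : |p'| ≤ Mm := (hM e i x hx).trans (hMle e i)
    have h4 : |q'| ≤ Mm := (hM e j x hx).trans (hMle e j)
    have e1 : p * q - p' * q' = (p - p') * (q - q') + (p' * (q - q') + (p - p') * q') := by ring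
    rw [e1]
    refine (abs_add_le _ _).trans ((add_le_add le_rfl (abs_add_le _ _)).trans ?_)
    rw [abs_mul, abs_mul, abs_mul]
    calc _ ≤ κ * 1 + (Mm * κ + κ * Mm) := by
          gcongr
          exact h2.trans hκ1
      _ = _ := by ring
  have hsum : |gradTgrad (fun x e => gv e x) x i j - gradTgrad v x i j|
      ≤ k * (κ * (2 * Mm + 1)) := by
    simp only [gradTgrad]
    rw [← Finset.sum_sub_distrib]
    refine (Finset.abs_sum_le_sum_abs _ _).trans ((Finset.sum_le_sum fun e _ => hprod e).trans ?_)
    simp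
  have hsym : |symGrad (fun x j => gw j x) x i j - symGrad w x i j| ≤ κ := by
    simp only [symGrad]
    have h1 := abs_le.1 ((gw2 j x hx).2 i)
    have h2 := abs_le.1 ((gw2 i x hx).2 j)
    rw [abs_le]
    constructor <;> linarith
  have h1 : κ * (k * (2 * Mm + 1) + 1) ≤ δ := by
    rw [← le_div_iff₀ (by positivity)]
    exact min_le_right _ _
  simp only [strain]
  have h2 : 0 ≤ k * (κ * (2 * Mm + 1)) := by positivity
  have h3 := abs_le.1 hsum
  have h4 := abs_le.1 hsym
  rw [abs_le]
  constructor <;> nlinarith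

end Approximation

section Primitive

variable {d k : ℕ} {K : Set (Fin d → ℝ)} {δ : ℝ}

theorem exists_sum_rank_one (M : Fin d → Fin d → ℝ) (hM : ∀ i j, M i j = M j i)
    (h0 : ∀ ξ : Fin d → ℝ, 0 ≤ ∑ i, ∑ j, M i j * ξ i * ξ j) :
    ∃ (n : ℕ) (ζ : Fin n → Fin d → ℝ), ∀ i j, M i j = ∑ m, ζ m i * ζ m j := by
  have hp : (Matrix.of M).PosSemidef := by
    refine Matrix.PosSemidef.of_dotProduct_mulVec_nonneg (Matrix.IsHermitian.ext fun i j => hM j i)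
      fun ξ => ?_
    refine (h0 ξ).trans (le_of_eq ?_)
    simp only [dotProduct, Matrix.mulVec, Finset.mul_sum, Matrix.of_apply, Pi.star_apply,
      star_trivial]
    exact Finset.sum_congr rfl fun i _ => Finset.sum_congr rfl fun j _ => by ring
  obtain ⟨n, ζ, h⟩ := Matrix.posSemidef_iff_eq_sum_vecMulVec.1 hp
  refine ⟨n, ζ, fun i j => ?_⟩
  have := congrFun (congrFun h i) j
  simpa [Matrix.sum_apply, Matrix.vecMulVec_apply] using this

/-- A continuous field of positive semidefinite matrices is uniformly approximated on a compact set
by a finite sum of primitive metrics with smooth amplitudes. -/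
theorem exists_primitive_approx (hK : IsCompact K) (S : Fin d → Fin d → (Fin d → ℝ) → ℝ)
    (hS : ∀ i j, Continuous (S i j)) (hsym : ∀ x i j, S i j x = S j i x)
    (h0 : ∀ x ∈ K, ∀ ξ : Fin d → ℝ, 0 ≤ ∑ i, ∑ j, S i j x * ξ i * ξ j) (hδ : 0 < δ) :
    ∃ (ι : Type) (_ : Fintype ι) (η : ι → Fin d → ℝ) (a : ι → (Fin d → ℝ) → ℝ),
      (∀ m, ∑ i, |η m i| ≤ 1) ∧ (∀ m, Tame (a m)) ∧
      ∀ x ∈ K, ∀ i j, |S i j x - ∑ m, a m x ^ 2 * (η m i * η m j)| ≤ δ := by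
  classical
  set U : (Fin d → ℝ) → Set (Fin d → ℝ) := fun y => ⋂ i, ⋂ j, {x | |S i j y - S i j x| < δ / 2}
    with hU
  have hUo : ∀ y, IsOpen (U y) := fun y => isOpen_iInter_of_finite fun i =>
    isOpen_iInter_of_finite fun j =>
      isOpen_lt ((continuous_const.sub (hS i j)).abs) continuous_const
  have hUy : ∀ y, y ∈ U y := fun y => by simp [hU, hδ]
  obtain ⟨t, htK, ht⟩ := hK.elim_nhds_subcover U fun y _ => (hUo y).mem_nhds (hUy y)
  let e := t.equivFin.symm
  have hcov : K ⊆ ⋃ i, U (e i) := fun x hx => by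
    obtain ⟨y, hy, hxy⟩ := Set.mem_iUnion₂.1 (ht hx)
    refine Set.mem_iUnion.2 ⟨e.symm ⟨y, hy⟩, ?_⟩
    simpa using hxy
  obtain ⟨f, hf1, hf2, hf3, -⟩ := exists_continuous_sum_one_of_isOpen_isCompact
    (s := fun i => U (e i)) (fun i => hUo _) hK hcov
  choose n ζ hζ using fun i => exists_sum_rank_one (fun a b => S a b (e i)) (hsym _)
    (h0 _ (htK _ (e i).2))
  let ι : Type := Σ i, Fin (n i)
  set L : ι → ℝ := fun m => 1 + ∑ i, |ζ m.1 m.2 i| with hL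
  have hL0 : ∀ m, 0 < L m := fun m => by
    have : 0 ≤ ∑ i, |ζ m.1 m.2 i| := Finset.sum_nonneg fun _ _ => abs_nonneg _
    simp only [hL]
    linarith
  set T : ℝ := (Fintype.card ι : ℝ) with hT
  have hT0 : 0 ≤ T := Nat.cast_nonneg _
  have hδ' : 0 < δ / (2 * (T + 1)) := by positivity
  choose a ha1 ha2 using fun m : ι => exists_square_approx hK
    (f := fun x => L m ^ 2 * f m.1 x) (continuous_const.mul (f m.1).continuous)
    (fun x => mul_nonneg (sq_nonneg _) (hf3 m.1 x).1) hδ'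
  have hη : ∀ m : ι, ∑ i, |ζ m.1 m.2 i / L m| ≤ 1 := fun m => by
    simp only [abs_div, abs_of_pos (hL0 m)]
    rw [← Finset.sum_div, div_le_one (hL0 m)]
    simp [hL]
  refine ⟨ι, inferInstance, fun m i => ζ m.1 m.2 i / L m, a, hη, ha1, fun x hx i j => ?_⟩
  have hη1 : ∀ m : ι, ∀ i, |ζ m.1 m.2 i / L m| ≤ 1 := fun m i =>
    (Finset.single_le_sum (f := fun i => |ζ m.1 m.2 i / L m|) (fun _ _ => abs_nonneg _)
      (Finset.mem_univ i)).trans (hη m)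
  have hsum1 : ∑ i, f i x = 1 := by
    have := hf2 hx
    simpa using this
  have e1 : ∑ m : ι, (L m ^ 2 * f m.1 x) * (ζ m.1 m.2 i / L m * (ζ m.1 m.2 j / L m))
      = ∑ p, f p x * S i j (e p) := by
    rw [Fintype.sum_sigma]
    refine Finset.sum_congr rfl fun p _ => ?_
    rw [hζ p i j, Finset.mul_sum]
    refine Finset.sum_congr rfl fun m _ => ?_
    have := (hL0 ⟨p, m⟩).ne'
    field_simp
  have e2 : |∑ p, f p x * S i j (e p) - S i j x| ≤ δ / 2 := by
    have : ∑ p, f p x * S i j (e p) - S i j x = ∑ p, f p x * (S i j (e p) - S i j x) := by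
      simp only [mul_sub, Finset.sum_sub_distrib]
      rw [← Finset.sum_mul, hsum1, one_mul]
    rw [this]
    refine (Finset.abs_sum_le_sum_abs _ _).trans ?_
    calc _ ≤ ∑ p, f p x * (δ / 2) := Finset.sum_le_sum fun p _ => by
          by_cases hz : f p x = 0
          · simp [hz]
          · have hm : x ∈ U (e p) := hf1 p (subset_tsupport _ hz)
            have hm' : |S i j (e p) - S i j x| < δ / 2 := by
              have := Set.mem_iInter.1 (Set.mem_iInter.1 hm i) j
              exact this
            rw [abs_mul, abs_of_nonneg (hf3 p x).1]
            exact mul_le_mul_of_nonneg_left hm'.le (hf3 p x).1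
      _ = δ / 2 := by rw [← Finset.sum_mul, hsum1, one_mul]
  have e3 : |∑ m : ι, a m x ^ 2 * (ζ m.1 m.2 i / L m * (ζ m.1 m.2 j / L m))
      - ∑ m : ι, (L m ^ 2 * f m.1 x) * (ζ m.1 m.2 i / L m * (ζ m.1 m.2 j / L m))| ≤ δ / 2 := by
    rw [← Finset.sum_sub_distrib]
    refine (Finset.abs_sum_le_sum_abs _ _).trans ?_
    calc _ ≤ ∑ m : ι, δ / (2 * (T + 1)) := Finset.sum_le_sum fun m _ => by
          rw [← sub_mul, abs_mul, abs_mul]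
          calc _ ≤ δ / (2 * (T + 1)) * (1 * 1) := by
                gcongr
                · exact ha2 m x hx
                · exact hη1 m i
                · exact hη1 m j
            _ = _ := by ring
      _ = T * (δ / (2 * (T + 1))) := by simp [hT]
      _ ≤ (T + 1) * (δ / (2 * (T + 1))) := by gcongr; linarith
      _ = δ / 2 := by field_simp
  rw [e1] at e3
  have h2 := abs_le.1 e2
  have h3 := abs_le.1 e3
  rw [abs_le]
  constructor <;> linarith [h2.1, h2.2, h3.1, h3.2]

/-- Finitely many successive corrugations realise a finite sum of primitive metrics up to an
arbitrarily small error. -/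
theorem exists_sum_corrugations (hk : 1 ≤ k) {ι : Type*} (s : Finset ι) (η : ι → Fin d → ℝ)
    (a : ι → (Fin d → ℝ) → ℝ) (hη : ∀ m, ∑ i, |η m i| ≤ 1) (ha : ∀ m, Tame (a m))
    {v : (Fin d → ℝ) → Fin k → ℝ} {w : (Fin d → ℝ) → Fin d → ℝ}
    (hv : ∀ e, Tame fun x => v x e) (hw : ∀ j, Tame fun x => w x j) :
    ∀ {δ : ℝ}, 0 < δ → ∃ (v' : (Fin d → ℝ) → Fin k → ℝ) (w' : (Fin d → ℝ) → Fin d → ℝ),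
      (∀ e, Tame fun x => v' x e) ∧ (∀ j, Tame fun x => w' x j) ∧
      (∀ x e, |v' x e - v x e| ≤ δ) ∧ (∀ x j, |w' x j - w x j| ≤ δ) ∧
      ∀ x i j, |strain v' w' x i j - strain v w x i j
        - ∑ m ∈ s, a m x ^ 2 * (η m i * η m j)| ≤ δ := by
  classical
  induction s using Finset.induction_on with
  | empty =>
    intro δ hδ
    exact ⟨v, w, hv, hw, by simp [hδ.le], by simp [hδ.le], by simp [hδ.le]⟩
  | insert p s hp ih =>
    intro δ hδ
    obtain ⟨v₁, w₁, hv₁, hw₁, h1, h2, h3⟩ := ih (half_pos hδ)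
    set e₀ : Fin k := ⟨0, hk⟩ with he₀
    obtain ⟨B, hB⟩ := (ha p).freqBd 2
    choose V hV using fun j => ((hv₁ e₀).pd j).freqBd 0
    choose Q hQ using fun i j => (((hv₁ e₀).pd j).pd i).freqBd 0
    have hB0 : 0 ≤ B := (hB 1 le_rfl).nonneg
    have hV0 : ∀ j, 0 ≤ V j := fun j => (hV j 1 le_rfl).nonneg
    have hQ0 : ∀ i j, 0 ≤ Q i j := fun i j => (hQ i j 1 le_rfl).nonneg
    set Vm : ℝ := ∑ j, V j with hVm
    set Qm : ℝ := ∑ i, ∑ j, Q i j with hQm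
    have hVm0 : 0 ≤ Vm := Finset.sum_nonneg fun j _ => hV0 j
    have hQm0 : 0 ≤ Qm := Finset.sum_nonneg fun i _ => Finset.sum_nonneg fun j _ => hQ0 i j
    have hVle : ∀ j, V j ≤ Vm := fun j =>
      Finset.single_le_sum (f := V) (fun i _ => hV0 i) (Finset.mem_univ j)
    have hQle : ∀ i j, Q i j ≤ Qm := fun i j =>
      (Finset.single_le_sum (f := fun j => Q i j) (fun j _ => hQ0 i j) (Finset.mem_univ j)).trans
        (Finset.single_le_sum (f := fun i => ∑ j, Q i j)
          (fun i _ => Finset.sum_nonneg fun j _ => hQ0 i j) (Finset.mem_univ i))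
    set Z : ℝ := 8 * (B + B * (Vm + B) + (B * Qm + B ^ 2)) with hZ
    have hZ0 : 0 ≤ Z := by positivity
    set l : ℝ := 1 + Z / (δ / 2) with hl
    have hl1 : 1 ≤ l := by
      have : 0 ≤ Z / (δ / 2) := by positivity
      linarith
    have hl0 : 0 < l := by linarith
    have hZl : Z / l ≤ δ / 2 := by
      rw [div_le_iff₀ hl0, hl]
      have : (δ / 2) * (Z / (δ / 2)) = Z := by field_simp
      nlinarith
    have hb : ∀ y, y ≤ Z → y / l ≤ δ / 2 := fun y hy =>
      (div_le_div_of_nonneg_right hy hl0.le).trans hZl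
    have hwave : ∀ x, |wave l (η p) (a p) x| ≤ δ / 2 := fun x => by
      have h := (freqBd_wave hl0 (hη p) ((hB l hl1).of_le (Nat.zero_le 2))).abs_le x
      refine h.trans ((le_of_eq ?_).trans (hb (2 * B) ?_))
      · ring
      · nlinarith [mul_nonneg hB0 hVm0, mul_nonneg hB0 hQm0, mul_nonneg hB0 hB0]
    have hincW : ∀ x j, |incW e₀ l (η p) (a p) v₁ j x| ≤ δ / 2 := fun x j => by
      have h := (freqBd_incW zero_le_one hl1 hl0 (hη p) ((hB 1 le_rfl).of_le (by norm_num))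
        (hV j l hl1)).abs_le x
      refine h.trans ((le_of_eq ?_).trans (hb (8 * (B * (V j + B))) ?_))
      · ring
      · have := mul_le_mul_of_nonneg_left (hVle j) hB0
        nlinarith [mul_nonneg hB0 hVm0, mul_nonneg hB0 hQm0, mul_nonneg hB0 hB0]
    have herr : ∀ x i j, |corrErr e₀ l (η p) (a p) v₁ i j x| ≤ δ / 2 := fun x i j => by
      have h := (freqBd_corrErr zero_le_one hl1 hl0 (hη p) (hB 1 le_rfl) (hQ i j l hl1)).abs_le x
      refine h.trans (le_trans ?_ (hb (8 * (B * Q i j + B ^ 2)) ?_))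
      · have : (B * 1 / l) ^ 2 ≤ B ^ 2 / l := by
          rw [mul_one, div_pow]
          gcongr
          nlinarith
        calc 8 * 8 ^ 0 * (B * Q i j / l + (B * 1 / l) ^ 2)
            ≤ 8 * 8 ^ 0 * (B * Q i j / l + B ^ 2 / l) := by gcongr
          _ = _ := by ring
      · have := mul_le_mul_of_nonneg_left (hQle i j) hB0
        nlinarith [mul_nonneg hB0 hVm0, mul_nonneg hB0 hQm0, mul_nonneg hB0 hB0]
    refine ⟨corrV e₀ l (η p) (a p) v₁, corrW e₀ l (η p) (a p) v₁ w₁,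
      tame_corrV hl1 (hη p) (ha p) hv₁, tame_corrW hl1 (hη p) (ha p) hv₁ hw₁,
      fun x e => ?_, fun x j => ?_, fun x i j => ?_⟩
    · have h4 := abs_le.1 (h1 x e)
      have h5 := abs_le.1 (hwave x)
      simp only [corrV]
      rw [abs_le]
      split_ifs <;> constructor <;> linarith [h4.1, h4.2, h5.1, h5.2]
    · have h4 := abs_le.1 (h2 x j)
      have h5 := abs_le.1 (hincW x j)
      simp only [corrW]
      rw [abs_le]
      constructor <;> linarith [h4.1, h4.2, h5.1, h5.2]
    · rw [strain_corr hl0.ne' (fun e => (hv₁ e).contDiff) (fun j => (hw₁ j).contDiff)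
        (ha p).contDiff, Finset.sum_insert hp]
      have h4 := abs_le.1 (h3 x i j)
      have h5 := abs_le.1 (herr x i j)
      rw [abs_le]
      constructor <;> linarith [h4.1, h4.2, h5.1, h5.2]

end Primitive

section Conclusion

variable {d k : ℕ}

theorem nonneg_of_perturbation {c : ℝ} (hc : 0 ≤ c) (D E : Fin d → Fin d → ℝ) (ξ : Fin d → ℝ)
    (hD : c * ∑ i, ξ i ^ 2 ≤ ∑ i, ∑ j, D i j * ξ i * ξ j)
    (hE : ∀ i j, |E i j| ≤ c / (d + 1)) : 0 ≤ ∑ i, ∑ j, (D i j + E i j) * ξ i * ξ j := by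
  have h1 : |∑ i, ∑ j, E i j * ξ i * ξ j| ≤ c / (d + 1) * (∑ i, |ξ i|) ^ 2 := by
    rw [sq, Finset.sum_mul_sum, Finset.mul_sum]
    refine (Finset.abs_sum_le_sum_abs _ _).trans (Finset.sum_le_sum fun i _ => ?_)
    rw [Finset.mul_sum]
    refine (Finset.abs_sum_le_sum_abs _ _).trans (Finset.sum_le_sum fun j _ => ?_)
    rw [abs_mul, abs_mul, mul_assoc]
    exact mul_le_mul_of_nonneg_right (hE i j) (by positivity)
  have h2 : (∑ i, |ξ i|) ^ 2 ≤ d * ∑ i, ξ i ^ 2 := by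
    simpa using sq_sum_le_card_mul_sum_sq (s := Finset.univ) (f := fun i => |ξ i|)
  have h3 : c / (d + 1) * (∑ i, |ξ i|) ^ 2 ≤ c * ∑ i, ξ i ^ 2 := by
    have h0 : 0 ≤ ∑ i, ξ i ^ 2 := Finset.sum_nonneg fun i _ => sq_nonneg _
    calc _ ≤ c / (d + 1) * ((d + 1) * ∑ i, ξ i ^ 2) := by
          gcongr
          linarith
      _ = _ := by field_simp
  have e : ∑ i, ∑ j, (D i j + E i j) * ξ i * ξ j
      = ∑ i, ∑ j, D i j * ξ i * ξ j + ∑ i, ∑ j, E i j * ξ i * ξ j := by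
    simp only [add_mul, Finset.sum_add_distrib]
  have h4 := (abs_le.1 h1).1
  rw [e]
  linarith

theorem exists_tame_of_matGt (hk : 1 ≤ k) {K : Set (Fin d → ℝ)} (hK : IsCompact K) {c δ : ℝ}
    (hc : 0 < c) (hδ : 0 < δ) {v : (Fin d → ℝ) → Fin k → ℝ} {w : (Fin d → ℝ) → Fin d → ℝ}
    (hv : ∀ e, ContDiff ℝ 1 fun x => v x e) (hw : ∀ j, ContDiff ℝ 1 fun x => w x j)
    {A : (Fin d → ℝ) → Fin d → Fin d → ℝ} (hA : ∀ i j, Continuous fun x => A x i j)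
    (hAsym : ∀ x i j, A x i j = A x j i)
    (hD : ∀ x ∈ K, MatGt (fun i j => A x i j - strain v w x i j) c)
    {H : Fin d → Fin d → ℝ} (hHsym : ∀ i j, H i j = H j i)
    (hH : ∀ i j, |H i j| ≤ c / (d + 1) / 2) :
    ∃ (v' : (Fin d → ℝ) → Fin k → ℝ) (w' : (Fin d → ℝ) → Fin d → ℝ),
      (∀ e, Tame fun x => v' x e) ∧ (∀ j, Tame fun x => w' x j) ∧
      (∀ x ∈ K, ∀ e, |v' x e - v x e| ≤ δ) ∧ (∀ x ∈ K, ∀ j, |w' x j - w x j| ≤ δ) ∧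
      ∀ x ∈ K, ∀ i j, |A x i j - H i j - strain v' w' x i j| ≤ δ := by
  set κ : ℝ := min (δ / 3) (c / (d + 1) / 2) with hκ
  have hκ0 : 0 < κ := by positivity
  have hκδ : κ ≤ δ / 3 := min_le_left _ _
  have hκc : κ ≤ c / (d + 1) / 2 := min_le_right _ _
  obtain ⟨v₁, w₁, hv₁, hw₁, h1, h2, h3⟩ := exists_tame_strain hK hv hw hκ0
  have hscont : ∀ i j, Continuous fun x => strain v₁ w₁ x i j := fun i j => by
    have hv' : ∀ e i, Continuous (pd i fun y => v₁ y e) := fun e i =>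
      continuous_pd ((hv₁ e).contDiff.of_le (by exact_mod_cast le_top)) i
    have hw' : ∀ e i, Continuous (pd i fun y => w₁ y e) := fun e i =>
      continuous_pd ((hw₁ e).contDiff.of_le (by exact_mod_cast le_top)) i
    simp only [strain, gradTgrad, symGrad]
    exact (continuous_const.mul (continuous_finsetSum _ fun e _ => (hv' e i).mul (hv' e j))).add
      (((hw' j i).add (hw' i j)).div_const _)
  obtain ⟨ι, _, η, a, hη, ha, hS⟩ := exists_primitive_approx hK
    (fun i j x => A x i j - strain v₁ w₁ x i j - H i j)
    (fun i j => ((hA i j).sub (hscont i j)).sub continuous_const)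
    (fun x i j => by rw [hAsym x i j, strain_symm v₁ w₁ x i j, hHsym i j])
    (fun x hx ξ => by
      have hD' : c * ∑ i, ξ i ^ 2 ≤ ∑ i, ∑ j, (A x i j - strain v w x i j) * ξ i * ξ j := by
        by_cases hξ : ξ = 0
        · simp [hξ]
        · exact (hD x hx ξ hξ).le
      have := nonneg_of_perturbation hc.le (fun i j => A x i j - strain v w x i j)
        (fun i j => strain v w x i j - strain v₁ w₁ x i j - H i j) ξ hD' fun i j => by
          have h4 := abs_le.1 (h3 x hx i j)
          have h5 := abs_le.1 (hH i j)
          rw [abs_le]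
          constructor <;> linarith [h4.1, h4.2, h5.1, h5.2]
      refine this.trans (le_of_eq ?_)
      refine Finset.sum_congr rfl fun i _ => Finset.sum_congr rfl fun j _ => ?_
      ring) (show 0 < δ / 3 by positivity)
  obtain ⟨v₂, w₂, hv₂, hw₂, g1, g2, g3⟩ := exists_sum_corrugations hk Finset.univ η a hη ha hv₁ hw₁
    (show 0 < δ / 3 by positivity)
  refine ⟨v₂, w₂, hv₂, hw₂, fun x hx e => ?_, fun x hx j => ?_, fun x hx i j => ?_⟩
  · have h4 := abs_le.1 (h1 x hx e)
    have h5 := abs_le.1 (g1 x e)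
    rw [abs_le]
    constructor <;> linarith [h4.1, h4.2, h5.1, h5.2]
  · have h4 := abs_le.1 (h2 x hx j)
    have h5 := abs_le.1 (g2 x j)
    rw [abs_le]
    constructor <;> linarith [h4.1, h4.2, h5.1, h5.2]
  · have h4 := abs_le.1 (hS x hx i j)
    have h5 := abs_le.1 (g3 x i j)
    rw [abs_le]
    constructor <;> linarith [h4.1, h4.2, h5.1, h5.2]

theorem Tame.exists_norm_le_and_lipschitz {f : (Fin d → ℝ) → ℝ} (hf : Tame f) :
    ∃ M, 0 ≤ M ∧ (∀ x, |f x| ≤ M) ∧ ∀ x y, |f x - f y| ≤ M * dist x y := by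
  obtain ⟨M, hM⟩ := hf 1
  refine ⟨M, hM.nonneg, hM.abs_le, fun x y => ?_⟩
  have h := Convex.norm_image_sub_le_of_norm_fderiv_le (𝕜 := ℝ) (f := f) (C := M) (s := Set.univ)
    (x := y) (y := x)
    (fun z _ => hM.differentiable z) (fun z _ => ?_) convex_univ (Set.mem_univ _) (Set.mem_univ _)
  · rwa [← dist_eq_norm x y, Real.norm_eq_abs] at h
  · have h1 := hM.2 1 le_rfl z
    rwa [norm_iteratedFDeriv_one, one_pow, mul_one] at h1

theorem strain_bounded_lipschitz {v : (Fin d → ℝ) → Fin k → ℝ} {w : (Fin d → ℝ) → Fin d → ℝ}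
    (hv : ∀ e, Tame fun x => v x e) (hw : ∀ j, Tame fun x => w x j) (i j : Fin d) :
    ∃ M, 0 ≤ M ∧ (∀ x, |strain v w x i j| ≤ M) ∧
      ∀ x y, |strain v w x i j - strain v w y i j| ≤ M * dist x y := by
  choose V hV0 hV1 hV2 using fun e i => ((hv e).pd i).exists_norm_le_and_lipschitz
  choose W hW0 hW1 hW2 using fun e i => ((hw e).pd i).exists_norm_le_and_lipschitz
  have hP : 0 ≤ ∑ e, V e i * V e j :=
    Finset.sum_nonneg fun e _ => mul_nonneg (hV0 e i) (hV0 e j)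
  have hWi := hW0 j i
  have hWj := hW0 i j
  refine ⟨∑ e, V e i * V e j + W j i + W i j, by positivity, fun x => ?_, fun x y => ?_⟩
  · have h1 : |gradTgrad v x i j| ≤ ∑ e, V e i * V e j := by
      refine (Finset.abs_sum_le_sum_abs _ _).trans (Finset.sum_le_sum fun e _ => ?_)
      rw [abs_mul]
      exact mul_le_mul (hV1 e i x) (hV1 e j x) (abs_nonneg _) (hV0 e i)
    have h2 := abs_le.1 (hW1 j i x)
    have h3 := abs_le.1 (hW1 i j x)
    have h4 := abs_le.1 h1
    simp only [strain, symGrad]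
    rw [abs_le]
    constructor <;> linarith [h2.1, h2.2, h3.1, h3.2, h4.1, h4.2]
  · have hd := dist_nonneg (x := x) (y := y)
    have h1 : |gradTgrad v x i j - gradTgrad v y i j| ≤ 2 * (∑ e, V e i * V e j) * dist x y := by
      simp only [gradTgrad]
      rw [← Finset.sum_sub_distrib, Finset.mul_sum, Finset.sum_mul]
      refine (Finset.abs_sum_le_sum_abs _ _).trans (Finset.sum_le_sum fun e _ => ?_)
      set p := pd i (fun y => v y e) x
      set q := pd j (fun y => v y e) x
      set p' := pd i (fun y => v y e) y
      set q' := pd j (fun y => v y e) y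
      have e1 : p * q - p' * q' = (p - p') * q + p' * (q - q') := by ring
      rw [e1]
      refine (abs_add_le _ _).trans ?_
      rw [abs_mul, abs_mul]
      calc _ ≤ (V e i * dist x y) * V e j + V e i * (V e j * dist x y) := by
            gcongr
            · exact mul_nonneg (hV0 e i) hd
            · exact hV2 e i x y
            · exact hV1 e j x
            · exact hV0 e i
            · exact hV1 e i y
            · exact hV2 e j x y
        _ = _ := by ring
    have h2 := abs_le.1 (hW2 j i x y)
    have h3 := abs_le.1 (hW2 i j x y)
    have h4 := abs_le.1 h1
    have h5 : 0 ≤ W j i * dist x y := mul_nonneg hWi hd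
    have h6 : 0 ≤ W i j * dist x y := mul_nonneg hWj hd
    simp only [strain, symGrad, add_mul]
    rw [abs_le]
    constructor <;> linarith [h2.1, h2.2, h3.1, h3.2, h4.1, h4.2]

theorem isHolder_of_bounded_lipschitz {β M : ℝ} (hβ0 : 0 ≤ β) (hβ1 : β ≤ 1)
    {f : (Fin d → ℝ) → ℝ} (hM : 0 ≤ M) (h0 : ∀ x, |f x| ≤ M)
    (h1 : ∀ x y, |f x - f y| ≤ M * dist x y) : IsHolder β f := by
  have h := norm_sub_le_mul_rpow (f := f) hM zero_le_one hβ0 hβ1 h0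
    (fun x y => by simpa using h1 x y)
  exact IsHolder.of_le hβ0 (K := 2 * M) (by positivity) fun x y => by simpa using h x y

theorem IsHolder.sub {β : ℝ} (hβ : 0 ≤ β) {f g : (Fin d → ℝ) → ℝ} (hf : IsHolder β f)
    (hg : IsHolder β g) : IsHolder β fun x => f x - g x := by
  obtain ⟨M, hM, h1⟩ := IsHolder.exists_le hβ hf
  obtain ⟨L, hL, h2⟩ := IsHolder.exists_le hβ hg
  refine IsHolder.of_le hβ (add_nonneg hM hL) fun x y => ?_
  rw [show f x - g x - (f y - g y) = (f x - f y) - (g x - g y) by ring, add_mul]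
  exact (norm_sub_le _ _).trans (add_le_add (h1 x y) (h2 x y))

theorem IsHolder.clamp {β r : ℝ} (hβ : 0 ≤ β) {f : (Fin d → ℝ) → ℝ} (hf : IsHolder β f) :
    IsHolder β fun x => max (-r) (min r (f x)) := by
  obtain ⟨M, hM, h1⟩ := IsHolder.exists_le hβ hf
  refine IsHolder.of_le hβ hM fun x y => le_trans ?_ (h1 x y)
  simp only [Real.norm_eq_abs]
  have h2 := abs_max_sub_max_le_abs (min r (f x)) (min r (f y)) (-r)
  have h3 := abs_min_sub_min_le_max r (f x) r (f y)
  rw [max_comm (-r), max_comm (-r)]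
  refine h2.trans (h3.trans ?_)
  simp

theorem isHolder_pi {β : ℝ} (hβ : 0 ≤ β) {n : ℕ} {E : Type*} [NormedAddCommGroup E]
    {f : (Fin d → ℝ) → Fin n → E} (hf : IsHolder β f) (i : Fin n) : IsHolder β fun x => f x i := by
  obtain ⟨M, hM, h1⟩ := IsHolder.exists_le hβ hf
  exact IsHolder.of_le hβ hM fun x y => (norm_le_pi_norm (f x - f y) i).trans (h1 x y)

theorem isC1Holder_pi {α : ℝ} (hα : 0 ≤ α) {n : ℕ} {f : (Fin d → ℝ) → Fin n → ℝ}
    (hf : ∀ e, IsC1Holder α fun x => f x e) : IsC1Holder α f := by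
  have hc : ContDiff ℝ 1 f := contDiff_pi.2 fun e => (hf e).1
  refine ⟨hc, ?_⟩
  choose M hM0 hM using fun e => IsHolder.exists_le hα (hf e).2
  have hs : 0 ≤ ∑ e, M e := Finset.sum_nonneg fun e _ => hM0 e
  have hdiff : ∀ x e, DifferentiableAt ℝ (fun x => f x e) x := fun x e =>
    ((hf e).1.differentiable (by simp)) x
  refine IsHolder.of_le hα hs fun x y => ?_
  have hr : 0 ≤ dist x y ^ α := by positivity
  refine ContinuousLinearMap.opNorm_le_bound _ (mul_nonneg hs hr) fun z => ?_
  refine (pi_norm_le_iff_of_nonneg (by positivity)).2 fun e => ?_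
  have e1 : ((fderiv ℝ f x - fderiv ℝ f y) z) e
      = (fderiv ℝ (fun x => f x e) x - fderiv ℝ (fun x => f x e) y) z := by
    have h1 : ∀ x, (fderiv ℝ f x z) e = fderiv ℝ (fun x => f x e) x z := fun x => by
      have := fderiv_pi (𝕜 := ℝ) (φ := fun e x => f x e) (x := x) (hdiff x)
      rw [this]
      rfl
    simp [h1]
  rw [e1]
  refine (ContinuousLinearMap.le_opNorm _ _).trans ?_
  gcongr
  refine (hM e x y).trans ?_
  gcongr
  exact Finset.single_le_sum (f := M) (fun e _ => hM0 e) (Finset.mem_univ e)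

theorem supNorm_sub_le {n : ℕ} {Ω : Set (Fin d → ℝ)} (hΩ : Ω.Nonempty)
    {f g : (Fin d → ℝ) → Fin n → ℝ} {ε : ℝ} (hε : 0 ≤ ε)
    (h : ∀ x ∈ closure Ω, ∀ e, |f x e - g x e| ≤ ε) : supNorm Ω (fun x => f x - g x) ≤ ε := by
  have : Nonempty (closure Ω) := hΩ.closure.to_subtype
  exact ciSup_le fun x => (pi_norm_le_iff_of_nonneg hε).2 fun e => h x x.2 e

end Conclusion

end VonKarman

/-- Theorem 1.1 (flexibility of the von Kármán system up to `C^{1,1/(1+d(d+1)/k)}`). -/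
theorem flexibility_VK_corrugations
    {d k : ℕ} (hd : 1 ≤ d) (hk : 1 ≤ k)
    (ω : Set (Fin d → ℝ)) (hω : IsOpen ω) (hωbd : Bornology.IsBounded ω)
    (hωne : ω.Nonempty)
    (v : (Fin d → ℝ) → Fin k → ℝ) (w : (Fin d → ℝ) → Fin d → ℝ)
    (A : (Fin d → ℝ) → Fin d → Fin d → ℝ)
    (hv : ContDiff ℝ 1 v) (hw : ContDiff ℝ 1 w)
    (β : ℝ) (hβ0 : 0 < β) (hβ1 : β ≤ 1)
    (hA : IsHolder β A) (hAsym : ∀ x i j, A x i j = A x j i)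
    (c : ℝ) (hc : 0 < c)
    (hD : ∀ x ∈ closure ω, MatGt (deficit A v w x) c)
    (ε : ℝ) (hε : 0 < ε)
    (α : ℝ) (hα0 : 0 < α)
    (hα1 : α < min (β / 2) (1 / (1 + (d : ℝ) * ((d : ℝ) + 1) / (k : ℝ)))) :
    ∃ (vt : (Fin d → ℝ) → Fin k → ℝ) (wt : (Fin d → ℝ) → Fin d → ℝ),
      IsC1Holder α vt ∧ IsC1Holder α wt ∧
      supNorm ω (fun x => vt x - v x) ≤ ε ∧
      supNorm ω (fun x => wt x - w x) ≤ ε ∧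
      ∀ x ∈ closure ω, ∀ i j, deficit A vt wt x i j = 0 := by
  classical
  obtain ⟨N, η, L, hNd, hη, hL⟩ := VonKarman.exists_decomposition d
  have hN : 1 ≤ N := by
    have : 1 * 2 ≤ d * (d + 1) := Nat.mul_le_mul hd (by omega)
    omega
  have hα1' : α < min (β / 2) (1 / (1 + 2 * (N : ℝ) / (k : ℝ))) := by
    have e : (2 : ℝ) * N = d * (d + 1) := by exact_mod_cast hNd
    rwa [e]
  obtain ⟨ρ, hρ, hmain⟩ := VonKarman.exists_strain_eq (d := d) (k := k) hk hN η L hη hL hβ0 hβ1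
    hα0 hα1'
  have hN0 : (0 : ℝ) < N := by exact_mod_cast hN
  set b : ℝ := min 1 (c / (d + 1) / 2 / N) with hb
  have hb0 : 0 < b := by positivity
  have hb1 : b ≤ 1 := min_le_left _ _
  have hbc : b * N ≤ c / (d + 1) / 2 := by
    rw [← le_div_iff₀ hN0]
    exact min_le_right _ _
  set H : Fin d → Fin d → ℝ := fun i j => b ^ 2 * ∑ n, η n i * η n j with hHdef
  have hHsym : ∀ i j, H i j = H j i := fun i j => by
    simp only [hHdef, mul_comm]
  have hη1 : ∀ n i, |η n i| ≤ 1 := fun n i =>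
    (Finset.single_le_sum (f := fun i => |η n i|) (fun _ _ => abs_nonneg _)
      (Finset.mem_univ i)).trans (hη n)
  have hH : ∀ i j, |H i j| ≤ c / (d + 1) / 2 := fun i j => by
    have h1 : |∑ n, η n i * η n j| ≤ N := by
      refine (Finset.abs_sum_le_sum_abs _ _).trans ?_
      calc _ ≤ ∑ n : Fin N, (1 : ℝ) := Finset.sum_le_sum fun n _ => by
            rw [abs_mul]
            exact mul_le_one₀ (hη1 n i) (abs_nonneg _) (hη1 n j)
        _ = N := by simp
    rw [hHdef, abs_mul, abs_of_pos (by positivity : 0 < b ^ 2)]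
    refine le_trans ?_ hbc
    have h2 : b ^ 2 ≤ b := by nlinarith
    exact mul_le_mul h2 h1 (abs_nonneg _) hb0.le
  have hAh : ∀ i j, IsHolder β fun x => A x i j := fun i j =>
    VonKarman.isHolder_pi hβ0.le (VonKarman.isHolder_pi hβ0.le hA i) j
  obtain ⟨v₀, w₀, hv₀, hw₀, h1, h2, h3⟩ := VonKarman.exists_tame_of_matGt (K := closure ω)
    (δ := min (ε / 2) (ρ * b ^ 2)) hk hωbd.isCompact_closure hc (by positivity)
    (fun e => contDiff_pi.1 hv e) (fun j => contDiff_pi.1 hw j)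
    (fun i j => VonKarman.IsHolder.continuous hβ0 (hAh i j)) hAsym hD hHsym hH
  set F : Fin d → Fin d → (Fin d → ℝ) → ℝ := fun i j x =>
    max (-(ρ * b ^ 2)) (min (ρ * b ^ 2) (A x i j - VonKarman.strain v₀ w₀ x i j - H i j)) with hF
  have hr : 0 < ρ * b ^ 2 := by positivity
  have hFs : ∀ i j, F i j = F j i := fun i j => by
    funext x
    simp only [hF]
    rw [hAsym x i j, VonKarman.strain_symm v₀ w₀ x i j, hHsym i j]
  have hFh : ∀ i j, IsHolder β (F i j) := fun i j => by
    obtain ⟨M, hM, g1, g2⟩ := VonKarman.strain_bounded_lipschitz hv₀ hw₀ i j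
    have hs := VonKarman.isHolder_of_bounded_lipschitz hβ0.le hβ1 hM g1 g2
    have hcst : IsHolder β fun _ : Fin d → ℝ => H i j :=
      VonKarman.IsHolder.of_le hβ0.le le_rfl fun x y => by simp
    exact VonKarman.IsHolder.clamp hβ0.le
      (VonKarman.IsHolder.sub hβ0.le (VonKarman.IsHolder.sub hβ0.le (hAh i j) hs) hcst)
  have hFb : ∀ i j x, |F i j x| ≤ ρ * b ^ 2 := fun i j x =>
    abs_le.2 ⟨le_max_left _ _, max_le (by linarith) (min_le_left _ _)⟩
  obtain ⟨vt, wt, hvt, hwt, g1, g2, g3⟩ := hmain hb0 hb1 (half_pos hε) hv₀ hw₀ hFs hFh hFb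
  refine ⟨vt, wt, VonKarman.isC1Holder_pi hα0.le hvt, VonKarman.isC1Holder_pi hα0.le hwt,
    VonKarman.supNorm_sub_le hωne hε.le fun x hx e => ?_,
    VonKarman.supNorm_sub_le hωne hε.le fun x hx e => ?_, fun x hx i j => ?_⟩
  · have h4 := abs_le.1 ((h1 x hx e).trans (min_le_left _ _))
    have h5 := abs_le.1 (g1 x e)
    rw [abs_le]
    constructor <;> linarith [h4.1, h4.2, h5.1, h5.2]
  · have h4 := abs_le.1 ((h2 x hx e).trans (min_le_left _ _))
    have h5 := abs_le.1 (g2 x e)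
    rw [abs_le]
    constructor <;> linarith [h4.1, h4.2, h5.1, h5.2]
  · have h4 := abs_le.1 ((h3 x hx i j).trans (min_le_right _ _))
    have h5 : F i j x = A x i j - VonKarman.strain v₀ w₀ x i j - H i j := by
      simp only [hF]
      rw [min_eq_right (by linarith [h4.2]), max_eq_right (by linarith [h4.1])]
    have h6 := g3 x i j
    rw [h5] at h6
    change A x i j - VonKarman.strain vt wt x i j = 0
    rw [h6]
    simp only [hHdef]
    ring
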